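/- Let f ∈ M_p, 1<p<∞, β₁,β₂,r₁,r₂>0, δ₁,δ₂ ∈ (0,1/2). Then ω_{β₁,β₂}(f^{(r₁,r₂)},δ₁,δ₂)_p ≍ (∫₀^{δ₁}∫₀^{δ₂} t₁^{−r₁p−1} t₂^{−r₂p−1} ω_{r₁+β₁,r₂+β₂}(f,t₁,t₂)_p^p dt₁ dt₂)^{1/p}, in the sense that either side is finite if and only if the other is, and then each is bounded by a constant multiple of the other with constants independent of f, δ₁, δ₂. -/

import Mathlib

open MeasureTheory Real
open scoped ENNReal

noncomputable section

/-- The `L_p` norm of a function of two variables over the period square `(0,2π]²`. -/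
def Lp2Norm (p : ℝ) (f : ℝ → ℝ → ℝ) : ℝ≥0∞ :=
  (∫⁻ x in Set.Ioc (0:ℝ) (2*π), ∫⁻ y in Set.Ioc (0:ℝ) (2*π),
      ENNReal.ofReal (|f x y| ^ p)) ^ (1/p)

/-- `f ∈ L_p^0(T²)`: measurable, `2π`-periodic in each variable, finite `L_p` norm,
and zero mean in each variable separately. -/
structure MemLp0 (p : ℝ) (f : ℝ → ℝ → ℝ) : Prop where
  meas : Measurable (Function.uncurry f)
  periodic_x : ∀ y, Function.Periodic (fun x => f x y) (2*π)
  periodic_y : ∀ x, Function.Periodic (f x) (2*π)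
  norm_ne_top : Lp2Norm p f ≠ ⊤
  mean_x : ∀ᵐ (y : ℝ) ∂volume, (∫ x in (0:ℝ)..(2*π), f x y) = 0
  mean_y : ∀ᵐ (x : ℝ) ∂volume, (∫ y in (0:ℝ)..(2*π), f x y) = 0

/-- Generalized (fractional) binomial coefficient `C(α,ν) = α(α-1)⋯(α-ν+1)/ν!`. -/
def fracBinom (α : ℝ) : ℕ → ℝ
  | 0 => 1
  | n+1 => fracBinom α n * (α - (n : ℝ)) / ((n : ℝ) + 1)

/-- Fractional difference of order `α` with step `h` in the first variable. -/
def diffX (α h : ℝ) (f : ℝ → ℝ → ℝ) : ℝ → ℝ → ℝ :=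
  fun x y => ∑' ν : ℕ, (-1 : ℝ) ^ ν * fracBinom α ν * f (x + (α - (ν : ℝ)) * h) y

/-- Fractional difference of order `α` with step `h` in the second variable. -/
def diffY (α h : ℝ) (f : ℝ → ℝ → ℝ) : ℝ → ℝ → ℝ :=
  fun x y => ∑' ν : ℕ, (-1 : ℝ) ^ ν * fracBinom α ν * f x (y + (α - (ν : ℝ)) * h)

/-- The mixed (fractional) modulus of smoothness `ω_{α₁,α₂}(f, δ₁, δ₂)_p`. -/
def mixedMod (p α₁ α₂ δ₁ δ₂ : ℝ) (f : ℝ → ℝ → ℝ) : ℝ≥0∞ :=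
  ⨆ (h₁ : ℝ) (_ : |h₁| ≤ δ₁) (h₂ : ℝ) (_ : |h₂| ≤ δ₂),
    Lp2Norm p (diffX α₁ h₁ (diffY α₂ h₂ f))

/-- Cosine-cosine Fourier coefficient `a_{n₁,n₂}` of `f`. -/
def fourierCC (f : ℝ → ℝ → ℝ) (n₁ n₂ : ℕ) : ℝ :=
  (1/π^2) * ∫ x in (0:ℝ)..(2*π), ∫ y in (0:ℝ)..(2*π),
    f x y * Real.cos ((n₁ : ℝ) * x) * Real.cos ((n₂ : ℝ) * y)

/-- Sine-cosine Fourier coefficient `b_{n₁,n₂}` of `f`. -/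
def fourierSC (f : ℝ → ℝ → ℝ) (n₁ n₂ : ℕ) : ℝ :=
  (1/π^2) * ∫ x in (0:ℝ)..(2*π), ∫ y in (0:ℝ)..(2*π),
    f x y * Real.sin ((n₁ : ℝ) * x) * Real.cos ((n₂ : ℝ) * y)

/-- Cosine-sine Fourier coefficient `c_{n₁,n₂}` of `f`. -/
def fourierCS (f : ℝ → ℝ → ℝ) (n₁ n₂ : ℕ) : ℝ :=
  (1/π^2) * ∫ x in (0:ℝ)..(2*π), ∫ y in (0:ℝ)..(2*π),
    f x y * Real.cos ((n₁ : ℝ) * x) * Real.sin ((n₂ : ℝ) * y)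

/-- Sine-sine Fourier coefficient `d_{n₁,n₂}` of `f`. -/
def fourierSS (f : ℝ → ℝ → ℝ) (n₁ n₂ : ℕ) : ℝ :=
  (1/π^2) * ∫ x in (0:ℝ)..(2*π), ∫ y in (0:ℝ)..(2*π),
    f x y * Real.sin ((n₁ : ℝ) * x) * Real.sin ((n₂ : ℝ) * y)

/-- The class `M_p`: `f ∈ L_p^0(T²)` with a pure cosine-cosine Fourier series
`Σ a_{ν₁,ν₂} cos ν₁x cos ν₂y` whose coefficients have nonnegative mixed differences. -/
def InMclass (p : ℝ) (f : ℝ → ℝ → ℝ) (a : ℕ → ℕ → ℝ) : Prop :=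
  MemLp0 p f ∧
  (∀ ν₁ ν₂ : ℕ, 1 ≤ ν₁ → 1 ≤ ν₂ → fourierCC f ν₁ ν₂ = a ν₁ ν₂) ∧
  (∀ n₁ n₂ : ℕ, fourierSC f n₁ n₂ = 0 ∧ fourierCS f n₁ n₂ = 0 ∧ fourierSS f n₁ n₂ = 0) ∧
  (∀ ν₁ ν₂ : ℕ, 1 ≤ ν₁ → 1 ≤ ν₂ →
    0 ≤ a ν₁ ν₂ - a (ν₁+1) ν₂ - a ν₁ (ν₂+1) + a (ν₁+1) (ν₂+1))

/-- Complex Fourier coefficient of a (real-valued) function on `T²`. -/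
def fourierCoefZ (f : ℝ → ℝ → ℝ) (m₁ m₂ : ℤ) : ℂ :=
  (((2*π)^2)⁻¹ : ℝ) * ∫ x in (0:ℝ)..(2*π), ∫ y in (0:ℝ)..(2*π),
    (f x y : ℂ) * Complex.exp (-Complex.I * ((m₁ : ℂ) * (x : ℂ) + (m₂ : ℂ) * (y : ℂ)))

/-- `g` is the mixed Weyl derivative `f^{(ρ₁,ρ₂)}` of `f` (and `g ∈ L_p^0(T²)`):
the Fourier coefficients of `g` arise from those of `f` by multiplication
with `(i m₁)^{ρ₁} (i m₂)^{ρ₂}`. -/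
def HasWeylDeriv (p ρ₁ ρ₂ : ℝ) (f g : ℝ → ℝ → ℝ) : Prop :=
  MemLp0 p g ∧ ∀ m₁ m₂ : ℤ,
    fourierCoefZ g m₁ m₂ =
      (Complex.I * (m₁ : ℂ)) ^ (ρ₁ : ℂ) * (Complex.I * (m₂ : ℂ)) ^ (ρ₂ : ℂ) * fourierCoefZ f m₁ m₂

/-- `(∫₀^a ∫₀^b t₁^{-r₁s-1} t₂^{-r₂s-1} ω_{r₁+β₁,r₂+β₂}(f,t₁,t₂)_p^s dt₁ dt₂)^{1/s}`. -/
def derivMajorant (p β₁ β₂ r₁ r₂ s a b : ℝ) (f : ℝ → ℝ → ℝ) : ℝ≥0∞ :=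
  (∫⁻ t₁ in Set.Ioo (0:ℝ) a, ∫⁻ t₂ in Set.Ioo (0:ℝ) b,
      ENNReal.ofReal (t₁ ^ (-r₁*s-1) * t₂ ^ (-r₂*s-1)) *
        mixedMod p (r₁+β₁) (r₂+β₂) t₁ t₂ f ^ s) ^ (1/s)

/-- Jensen's inequality for weighted infinite sums of extended nonnegative reals. -/
theorem ENNReal.rpow_tsum_mul_le {ι : Type*} {p : ℝ} (hp : 1 < p) (w z : ι → ℝ≥0∞) :
    (∑' i, w i * z i) ^ p ≤ (∑' i, w i) ^ (p - 1) * ∑' i, w i * z i ^ p := by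
  have hp0 : 0 < p := by linarith
  have key : (∑' i, w i * z i) ≤
      ((∑' i, w i) ^ (p - 1) * ∑' i, w i * z i ^ p) ^ (p⁻¹) := by
    rw [ENNReal.tsum_eq_iSup_sum]
    refine iSup_le fun s => ?_
    refine (ENNReal.inner_le_weight_mul_Lp_of_nonneg s hp.le w z).trans ?_
    rw [ENNReal.mul_rpow_of_nonneg _ _ (by positivity), ← ENNReal.rpow_mul]
    have h1 : (p - 1) * p⁻¹ = 1 - p⁻¹ := by field_simp
    rw [h1]
    have h2 : 0 ≤ 1 - p⁻¹ := by
      rw [← h1]; have : 0 < p - 1 := by linarith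
      positivity
    gcongr
    · exact ENNReal.sum_le_tsum s
    · exact ENNReal.sum_le_tsum (f := fun i => w i * z i ^ p) s
  calc (∑' i, w i * z i) ^ p ≤ (((∑' i, w i) ^ (p - 1) * ∑' i, w i * z i ^ p) ^ (p⁻¹)) ^ p := by
        gcongr
    _ = _ := by rw [← ENNReal.rpow_mul, inv_mul_cancel₀ hp0.ne', ENNReal.rpow_one]

/-- The profile `1 / max(1, A u)`. -/
def hlProfile (A u : ℝ) : ℝ := (max 1 (A * u))⁻¹

theorem hlProfile_pos (A u : ℝ) : 0 < hlProfile A u := by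
  unfold hlProfile; positivity

theorem hlProfile_le_one (A u : ℝ) : hlProfile A u ≤ 1 := by
  unfold hlProfile; exact inv_le_one_of_one_le₀ (le_max_left _ _)

theorem hlProfile_comm (A u : ℝ) : hlProfile A u = hlProfile u A := by
  unfold hlProfile; rw [mul_comm]

theorem hlProfile_le_inv {A u : ℝ} (hA : 0 < A * u) : hlProfile A u ≤ (A * u)⁻¹ := by
  unfold hlProfile; exact inv_anti₀ hA (le_max_right _ _)

theorem hlProfile_anti {A u v : ℝ} (hA : 0 ≤ A) (h : u ≤ v) : hlProfile A v ≤ hlProfile A u := by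
  unfold hlProfile; gcongr

theorem measurable_hlProfile (A : ℝ) : Measurable (hlProfile A) := by
  unfold hlProfile; fun_prop

/-- The constant in the Hardy–Littlewood kernel estimates. -/
def hlConst (p : ℝ) : ℝ := p + (1 - 1 / p)⁻¹

theorem hlConst_pos {p : ℝ} (hp : 1 < p) : 0 < hlConst p := by
  have : 1 / p < 1 := by rw [div_lt_one (by linarith)]; exact hp
  have : 0 < 1 - 1 / p := by linarith
  unfold hlConst; positivity

theorem lintegral_hlProfile_le {p A : ℝ} (hp : 1 < p) (hA : 0 < A) :
    ∫⁻ u in Set.Ioi (0:ℝ), ENNReal.ofReal (u ^ (1 / p - 1) * hlProfile A u) ≤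
      ENNReal.ofReal (hlConst p * A ^ (-(1 / p))) := by
  have hp0 : 0 < p := by linarith
  have hq : 1 / p < 1 := by rw [div_lt_one (by linarith)]; exact hp
  have hq0 : 0 < 1 / p := by positivity
  have hAi : 0 < A⁻¹ := by positivity
  have hsplit : Set.Ioi (0:ℝ) = Set.Ioc 0 A⁻¹ ∪ Set.Ioi A⁻¹ := by
    rw [Set.Ioc_union_Ioi_eq_Ioi hAi.le]
  rw [hsplit]
  refine (lintegral_union_le _ _ _).trans ?_
  have h1 : ∫⁻ u in Set.Ioc (0:ℝ) A⁻¹, ENNReal.ofReal (u ^ (1 / p - 1) * hlProfile A u) ≤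
      ENNReal.ofReal (p * A ^ (-(1 / p))) := by
    calc _ ≤ ∫⁻ u in Set.Ioc (0:ℝ) A⁻¹, ENNReal.ofReal (u ^ (1 / p - 1)) := by
          refine setLIntegral_mono' measurableSet_Ioc fun u hu => ?_
          refine ENNReal.ofReal_le_ofReal ?_
          exact mul_le_of_le_one_right (Real.rpow_nonneg hu.1.le _) (hlProfile_le_one _ _)
      _ = ENNReal.ofReal (∫ u in Set.Ioc (0:ℝ) A⁻¹, u ^ (1 / p - 1)) := by
          rw [ofReal_integral_eq_lintegral_ofReal]
          · exact (intervalIntegrable_iff_integrableOn_Ioc_of_le hAi.le).mp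
              (intervalIntegral.intervalIntegrable_rpow' (by linarith))
          · filter_upwards [ae_restrict_mem measurableSet_Ioc] with u hu
            exact Real.rpow_nonneg hu.1.le _
      _ = _ := by
          rw [← intervalIntegral.integral_of_le hAi.le, integral_rpow (Or.inl (by linarith))]
          rw [sub_add_cancel, Real.zero_rpow hq0.ne', sub_zero, Real.inv_rpow hA.le,
            ← Real.rpow_neg hA.le]
          congr 1
          field_simp
  have h2 : ∫⁻ u in Set.Ioi A⁻¹, ENNReal.ofReal (u ^ (1 / p - 1) * hlProfile A u) ≤
      ENNReal.ofReal ((1 - 1 / p)⁻¹ * A ^ (-(1 / p))) := by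
    have h_int : IntegrableOn (fun u : ℝ => A⁻¹ * u ^ (1 / p - 2)) (Set.Ioi A⁻¹) :=
      (integrableOn_Ioi_rpow_of_lt (by linarith) hAi).const_mul _
    calc _ ≤ ∫⁻ u in Set.Ioi A⁻¹, ENNReal.ofReal (A⁻¹ * u ^ (1 / p - 2)) := by
          refine setLIntegral_mono' measurableSet_Ioi fun u hu => ?_
          refine ENNReal.ofReal_le_ofReal ?_
          have hu0 : 0 < u := hAi.trans hu
          calc u ^ (1 / p - 1) * hlProfile A u ≤ u ^ (1 / p - 1) * (A * u)⁻¹ := by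
                gcongr; exact hlProfile_le_inv (by positivity)
            _ = A⁻¹ * u ^ (1 / p - 2) := by
                have : u ^ (1 / p - 1) = u ^ (1 / p - 2) * u := by
                  rw [← Real.rpow_add_one hu0.ne']; congr 1; ring
                rw [this]; field_simp
      _ = ENNReal.ofReal (∫ u in Set.Ioi A⁻¹, A⁻¹ * u ^ (1 / p - 2)) := by
          rw [ofReal_integral_eq_lintegral_ofReal h_int]
          filter_upwards [ae_restrict_mem measurableSet_Ioi] with u hu
          have hu0 : 0 < u := hAi.trans hu
          positivity
      _ = _ := by
          rw [integral_const_mul, integral_Ioi_rpow_of_lt (by linarith) hAi]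
          congr 1
          rw [Real.inv_rpow hA.le, ← Real.rpow_neg hA.le]
          have e1 : A ^ (-(1 / p - 2 + 1)) = A ^ (-(1 / p)) * A := by
            rw [← Real.rpow_add_one hA.ne']; congr 1; ring
          have h3 : 1 / p - 2 + 1 = -(1 - 1 / p) := by ring
          rw [e1, h3]
          have h4 : 1 - 1 / p ≠ 0 := by linarith
          field_simp
  refine (add_le_add h1 h2).trans ?_
  have : 0 < 1 - 1 / p := by linarith
  rw [← ENNReal.ofReal_add (by positivity) (by positivity)]
  apply le_of_eq; congr 1; unfold hlConst; ring

theorem tsum_hlProfile_le {p θ : ℝ} (hp : 1 < p) (hθ : 0 < θ) :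
    ∑' n : ℕ, ENNReal.ofReal (((n:ℝ) + 1) ^ (1 / p - 1) * hlProfile ((n:ℝ) + 1) θ) ≤
      ENNReal.ofReal (hlConst p * θ ^ (-(1 / p))) := by
  have hp0 : 0 < p := by linarith
  have hq : 1 / p < 1 := by rw [div_lt_one (by linarith)]; exact hp
  refine le_trans ?_ (lintegral_hlProfile_le hp hθ)
  have hU : (⋃ n : ℕ, Set.Ioc (n:ℝ) ((n:ℝ) + 1)) ⊆ Set.Ioi (0:ℝ) := by
    refine Set.iUnion_subset fun n u hu => ?_
    exact lt_of_le_of_lt (Nat.cast_nonneg n) hu.1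
  refine le_trans ?_ (lintegral_mono_set hU)
  rw [lintegral_iUnion (fun _ => measurableSet_Ioc)]
  · refine ENNReal.tsum_le_tsum fun n => ?_
    calc ENNReal.ofReal (((n:ℝ) + 1) ^ (1 / p - 1) * hlProfile ((n:ℝ) + 1) θ)
        = ∫⁻ u in Set.Ioc (n:ℝ) ((n:ℝ) + 1),
            ENNReal.ofReal (((n:ℝ) + 1) ^ (1 / p - 1) * hlProfile ((n:ℝ) + 1) θ) := by
          simp
      _ ≤ _ := by
          refine setLIntegral_mono' measurableSet_Ioc fun u hu => ?_
          refine ENNReal.ofReal_le_ofReal ?_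
          have hu0 : 0 < u := lt_of_le_of_lt (Nat.cast_nonneg n) hu.1
          rw [hlProfile_comm]
          refine mul_le_mul ?_ (hlProfile_anti hθ.le hu.2) (hlProfile_pos _ _).le (by positivity)
          exact Real.rpow_le_rpow_of_nonpos hu0 hu.2 (by linarith)
  · intro i j hij
    have h := Set.pairwise_disjoint_Ioc_add_intCast (0:ℝ) (show (i:ℤ) ≠ (j:ℤ) by exact_mod_cast hij)
    simpa [Function.onFun] using h

/-- The `2π`-periodic Hardy–Littlewood kernel. -/
def hlKernel (k : ℕ) (x : ℝ) : ℝ≥0∞ := ENNReal.ofReal (hlProfile ((k:ℝ) + 1) |sin (x / 2)|)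

theorem measurable_hlKernel (k : ℕ) : Measurable (hlKernel k) := by
  unfold hlKernel
  exact ((measurable_hlProfile _).comp (by fun_prop)).ennreal_ofReal

theorem hlKernel_periodic (k : ℕ) : Function.Periodic (hlKernel k) (2 * π) := by
  intro x
  unfold hlKernel
  rw [show (x + 2 * π) / 2 = x / 2 + π by ring, Real.sin_add_pi, abs_neg]

theorem lintegral_hlKernel_le {p : ℝ} (hp : 1 < p) (k : ℕ) :
    ∫⁻ x in Set.Ioo (0:ℝ) (2 * π),
        ENNReal.ofReal (|sin (x / 2)| ^ (1 / p - 1)) * hlKernel k x ≤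
      ENNReal.ofReal (2 * π * hlConst p * ((k:ℝ) + 1) ^ (-(1 / p))) := by
  have hp0 : 0 < p := by linarith
  have hq : 1 / p < 1 := by rw [div_lt_one (by linarith)]; exact hp
  set F : ℝ → ℝ≥0∞ := fun u => ENNReal.ofReal (u ^ (1 / p - 1) * hlProfile ((k:ℝ) + 1) u) with hF
  have hFm : Measurable F := by
    have := measurable_hlProfile ((k:ℝ) + 1)
    simp only [hF]
    fun_prop
  have hFanti : ∀ u v : ℝ, 0 < u → u ≤ v → F v ≤ F u := by
    intro u v hu huv
    refine ENNReal.ofReal_le_ofReal ?_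
    refine mul_le_mul ?_ (hlProfile_anti (by positivity) huv) (hlProfile_pos _ _).le (by positivity)
    exact Real.rpow_le_rpow_of_nonpos hu huv (by linarith)
  have hpi := Real.pi_pos
  have hI : ∫⁻ x in Set.Ioo (0:ℝ) (2 * π), F (x / π) ≤
      ENNReal.ofReal (π * hlConst p * ((k:ℝ) + 1) ^ (-(1 / p))) := by
    have hk : (0:ℝ) < (k:ℝ) + 1 := by positivity
    have h := lintegral_hlProfile_le hp (show 0 < ((k:ℝ) + 1) / π by positivity)
    have h2 : ∫⁻ x in Set.Ioo (0:ℝ) (2 * π), F (x / π) ≤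
        ∫⁻ x in Set.Ioi (0:ℝ), ENNReal.ofReal (π ^ (1 - 1 / p)) *
          ENNReal.ofReal (x ^ (1 / p - 1) * hlProfile (((k:ℝ) + 1) / π) x) := by
      refine (lintegral_mono_set Set.Ioo_subset_Ioi_self).trans ?_
      refine setLIntegral_mono' measurableSet_Ioi fun x hx => ?_
      have hx0 : (0:ℝ) < x := hx
      rw [← ENNReal.ofReal_mul (by positivity)]
      refine ENNReal.ofReal_le_ofReal (le_of_eq ?_)
      rw [Real.div_rpow hx0.le hpi.le, show (1:ℝ) - 1 / p = -(1 / p - 1) by ring,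
        Real.rpow_neg hpi.le]
      have : hlProfile ((k:ℝ) + 1) (x / π) = hlProfile (((k:ℝ) + 1) / π) x := by
        unfold hlProfile; congr 2; ring
      rw [this]; field_simp
    refine h2.trans ?_
    rw [lintegral_const_mul' _ _ ENNReal.ofReal_ne_top]
    refine (mul_le_mul_right h _).trans ?_
    rw [← ENNReal.ofReal_mul (by positivity)]
    refine ENNReal.ofReal_le_ofReal (le_of_eq ?_)
    rw [Real.div_rpow hk.le hpi.le, Real.rpow_neg hpi.le, Real.rpow_sub hpi, Real.rpow_one]
    have : 0 < π ^ (1 / p) := by positivity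
    field_simp
  have hI' : ∫⁻ x in Set.Ioo (0:ℝ) (2 * π), F ((2 * π - x) / π) =
      ∫⁻ x in Set.Ioo (0:ℝ) (2 * π), F (x / π) := by
    have hmp : MeasurePreserving (fun x : ℝ => 2 * π - x) volume volume :=
      Measure.measurePreserving_sub_left volume (2 * π)
    have := hmp.setLIntegral_comp_preimage (s := Set.Ioo (0:ℝ) (2 * π)) measurableSet_Ioo
      (f := fun x => F (x / π)) (hFm.comp (by fun_prop))
    rw [← this]
    simp
  calc _ ≤ ∫⁻ x in Set.Ioo (0:ℝ) (2 * π), (F (x / π) + F ((2 * π - x) / π)) := by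
        refine setLIntegral_mono' measurableSet_Ioo fun x hx => ?_
        have hs : 0 < sin (x / 2) := Real.sin_pos_of_pos_of_lt_pi (by linarith [hx.1]) (by linarith [hx.2])
        have e : ENNReal.ofReal (|sin (x / 2)| ^ (1 / p - 1)) * hlKernel k x = F (sin (x / 2)) := by
          rw [abs_of_pos hs, hlKernel, ← ENNReal.ofReal_mul (by positivity), abs_of_pos hs]
        rw [e]
        rcases le_total x π with h | h
        · refine le_add_right (hFanti _ _ (div_pos hx.1 hpi) ?_)
          have := Real.mul_le_sin (x := x / 2) (by linarith [hx.1]) (by linarith)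
          calc x / π = 2 / π * (x / 2) := by ring
            _ ≤ _ := this
        · refine le_add_left (hFanti _ _ (div_pos (by linarith [hx.2]) hpi) ?_)
          have := Real.mul_le_sin (x := π - x / 2) (by linarith [hx.2]) (by linarith)
          rw [Real.sin_pi_sub] at this
          calc (2 * π - x) / π = 2 / π * (π - x / 2) := by ring
            _ ≤ _ := this
    _ = (∫⁻ x in Set.Ioo (0:ℝ) (2 * π), F (x / π)) +
          ∫⁻ x in Set.Ioo (0:ℝ) (2 * π), F ((2 * π - x) / π) :=
        lintegral_add_left (hFm.comp (measurable_id.div_const _)) _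
    _ ≤ _ := by
        rw [hI']
        refine (add_le_add hI hI).trans (le_of_eq ?_)
        have := hlConst_pos hp
        rw [← ENNReal.ofReal_add (by positivity) (by positivity)]
        congr 1; ring

/-- The family of kernels `κ` maps the weighted space `ℓ^p((k+1)^(p-2))` into `L_p(0,2π)`. -/
def HLBound (p : ℝ) (C : ℝ≥0∞) (κ : ℕ → ℝ → ℝ≥0∞) : Prop :=
  ∀ b : ℕ → ℝ≥0∞, ∫⁻ x in Set.Ioc (0:ℝ) (2 * π), (∑' k, κ k x * b k) ^ p ≤
    C * ∑' k, b k ^ p * ((k:ℝ≥0∞) + 1) ^ (p - 2)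

theorem ENNReal.natCast_add_one_rpow (n : ℕ) (s : ℝ) :
    ((n:ℝ≥0∞) + 1) ^ s = ENNReal.ofReal (((n:ℝ) + 1) ^ s) := by
  rw [← ENNReal.ofReal_rpow_of_pos (by positivity), ENNReal.ofReal_add (by positivity) (by positivity)]
  simp

/-- The constant in the Hardy–Littlewood inequality for `hlKernel`. -/
def hlConst' (p : ℝ) : ℝ := hlConst p ^ (p - 1) * (2 * π * hlConst p)

theorem hlBound_hlKernel {p : ℝ} (hp : 1 < p) :
    HLBound p (ENNReal.ofReal (hlConst' p)) hlKernel := by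
  intro b
  have hp0 : 0 < p := by linarith
  have hC := hlConst_pos hp
  rw [setLIntegral_congr (Ioo_ae_eq_Ioc).symm]
  set N : ℕ → ℝ≥0∞ := fun n => (n:ℝ≥0∞) + 1 with hN
  have hN0 : ∀ n, N n ≠ 0 := fun n => by simp [hN]
  have hNt : ∀ n, N n ≠ ⊤ := fun n => by simp [hN]
  set G : ℝ → ℝ≥0∞ := fun x => ENNReal.ofReal (|sin (x / 2)| ^ (1 / p - 1)) with hG
  have hpt : ∀ x ∈ Set.Ioo (0:ℝ) (2 * π), (∑' k, hlKernel k x * b k) ^ p ≤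
      ENNReal.ofReal (hlConst p ^ (p - 1)) *
        ∑' k, (G x * hlKernel k x) * (N k ^ (p - 2 + 1 / p) * b k ^ p) := by
    intro x hx
    have hs : 0 < |sin (x / 2)| := abs_pos.mpr (ne_of_gt
      (Real.sin_pos_of_pos_of_lt_pi (by linarith [hx.1]) (by linarith [hx.2])))
    have e1 : ∀ k, hlKernel k x * b k =
        (hlKernel k x * N k ^ (1 / p - 1)) * (N k ^ (1 - 1 / p) * b k) := by
      intro k
      have : N k ^ (1 / p - 1) * N k ^ (1 - 1 / p) = 1 := by
        rw [← ENNReal.rpow_add _ _ (hN0 k) (hNt k)]; simp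
      calc hlKernel k x * b k = hlKernel k x * (N k ^ (1 / p - 1) * N k ^ (1 - 1 / p)) * b k := by
            rw [this, mul_one]
        _ = _ := by ring
    simp_rw [e1]
    refine (ENNReal.rpow_tsum_mul_le hp _ _).trans ?_
    have h1 : (∑' k, hlKernel k x * N k ^ (1 / p - 1)) ^ (p - 1) ≤
        ENNReal.ofReal (hlConst p ^ (p - 1)) * G x := by
      have h := tsum_hlProfile_le hp hs
      have h' : ∑' k, hlKernel k x * N k ^ (1 / p - 1) ≤
          ENNReal.ofReal (hlConst p * |sin (x / 2)| ^ (-(1 / p))) := by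
        refine le_trans (le_of_eq ?_) h
        congr 1; funext n
        rw [ENNReal.natCast_add_one_rpow, hlKernel, mul_comm, ← ENNReal.ofReal_mul (by positivity)]
      refine (ENNReal.rpow_le_rpow h' (by linarith)).trans (le_of_eq ?_)
      rw [ENNReal.ofReal_rpow_of_nonneg (by positivity) (by linarith), hG,
        ← ENNReal.ofReal_mul (by positivity), Real.mul_rpow hC.le (by positivity),
        ← Real.rpow_mul hs.le]
      congr 3
      field_simp
      ring
    refine (mul_le_mul_left h1 _).trans (le_of_eq ?_)
    rw [mul_assoc, ← ENNReal.tsum_mul_left]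
    congr 2; funext k
    rw [ENNReal.mul_rpow_of_nonneg _ _ hp0.le, ← ENNReal.rpow_mul]
    have : N k ^ (1 / p - 1) * N k ^ ((1 - 1 / p) * p) = N k ^ (p - 2 + 1 / p) := by
      rw [← ENNReal.rpow_add _ _ (hN0 k) (hNt k)]; congr 1; field_simp; ring
    rw [← this]; ring
  refine (setLIntegral_mono' measurableSet_Ioo hpt).trans ?_
  have hGm : Measurable G := by simp only [hG]; fun_prop
  rw [lintegral_const_mul' _ _ ENNReal.ofReal_ne_top, lintegral_tsum]
  swap
  · intro k
    exact ((hGm.mul (measurable_hlKernel k)).mul_const _).aemeasurable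
  have h2 : ∀ k, ∫⁻ x in Set.Ioo (0:ℝ) (2 * π),
      (G x * hlKernel k x) * (N k ^ (p - 2 + 1 / p) * b k ^ p) ≤
      ENNReal.ofReal (2 * π * hlConst p) * (b k ^ p * N k ^ (p - 2)) := by
    intro k
    have hmk : Measurable fun x => G x * hlKernel k x := hGm.mul (measurable_hlKernel k)
    rw [lintegral_mul_const _ hmk]
    refine (mul_le_mul_left (lintegral_hlKernel_le hp k) _).trans (le_of_eq ?_)
    rw [ENNReal.ofReal_mul (by positivity), ← ENNReal.natCast_add_one_rpow]
    have : N k ^ (-(1 / p)) * N k ^ (p - 2 + 1 / p) = N k ^ (p - 2) := by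
      rw [← ENNReal.rpow_add _ _ (hN0 k) (hNt k)]; congr 1; ring
    rw [← this]; ring
  refine (mul_le_mul_right (ENNReal.tsum_le_tsum h2) _).trans (le_of_eq ?_)
  rw [ENNReal.tsum_mul_left, ← mul_assoc, ← ENNReal.ofReal_mul (by positivity)]
  rfl

/-- Boundedness of one-dimensional kernels tensorizes. -/
theorem HLBound.prod {p : ℝ} {C D : ℝ≥0∞} {κ η : ℕ → ℝ → ℝ≥0∞}
    (hκ : HLBound p C κ) (hη : HLBound p D η)
    (hκm : ∀ k, Measurable (κ k)) (b : ℕ → ℕ → ℝ≥0∞) :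
    ∫⁻ x in Set.Ioc (0:ℝ) (2 * π), ∫⁻ y in Set.Ioc (0:ℝ) (2 * π),
        (∑' k, ∑' l, κ k x * η l y * b k l) ^ p ≤
      C * D * ∑' k, ∑' l, b k l ^ p * (((k:ℝ≥0∞) + 1) ^ (p - 2) * ((l:ℝ≥0∞) + 1) ^ (p - 2)) := by
  have h1 : ∀ x, ∫⁻ y in Set.Ioc (0:ℝ) (2 * π), (∑' k, ∑' l, κ k x * η l y * b k l) ^ p ≤
      D * ∑' l, (∑' k, κ k x * b k l) ^ p * ((l:ℝ≥0∞) + 1) ^ (p - 2) := by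
    intro x
    refine le_trans (le_of_eq ?_) (hη fun l => ∑' k, κ k x * b k l)
    congr 1; funext y
    rw [ENNReal.tsum_comm]
    congr 2; funext l
    rw [← ENNReal.tsum_mul_left]
    congr 1; funext k; ring
  have hm : ∀ l, Measurable fun x => (∑' k, κ k x * b k l) ^ p := fun l =>
    (Measurable.tsum fun k => (hκm k).mul_const _).pow_const _
  refine (lintegral_mono h1).trans ?_
  rw [lintegral_const_mul]
  swap
  · exact Measurable.tsum fun l => (hm l).mul_const _
  rw [lintegral_tsum fun l => ((hm l).mul_const _).aemeasurable]
  simp_rw [lintegral_mul_const _ (hm _)]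
  calc _ ≤ D * ∑' l, (C * ∑' k, b k l ^ p * ((k:ℝ≥0∞) + 1) ^ (p - 2)) * ((l:ℝ≥0∞) + 1) ^ (p - 2) := by
        gcongr with l
        exact hκ fun k => b k l
    _ = _ := by
        rw [ENNReal.tsum_comm, mul_comm C D, mul_assoc, ← ENNReal.tsum_mul_left (a := C)]
        congr 2; funext l
        rw [mul_assoc, ← ENNReal.tsum_mul_right]
        congr 2; funext k; ring

theorem setLIntegral_Ioc_comp_add_of_periodic {F : ℝ → ℝ≥0∞}
    (hF : Function.Periodic F (2 * π)) (s : ℝ) :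
    ∫⁻ x in Set.Ioc (0:ℝ) (2 * π), F (x + s) = ∫⁻ x in Set.Ioc (0:ℝ) (2 * π), F x := by
  have h1 := (measurePreserving_add_right volume s).setLIntegral_comp_emb
    (measurableEmbedding_addRight s) F (Set.Ioc (0:ℝ) (2 * π))
  have : VAddInvariantMeasure (AddSubgroup.zmultiples (2 * π)) ℝ volume :=
    ⟨fun c s _ => measure_preimage_add _ _ _⟩
  rw [h1, Set.image_add_const_Ioc]
  have h2 := (isAddFundamentalDomain_Ioc Real.two_pi_pos s).setLIntegral_eq
    (isAddFundamentalDomain_Ioc Real.two_pi_pos 0) F hF.map_vadd_zmultiples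
  rw [zero_add] at h2
  rw [zero_add, add_comm (2 * π), h2]

/-- A weighted superposition of translates of the kernels `hlKernel`. -/
def shiftedKernel (e : ℕ → ℝ≥0∞) (s : ℕ → ℝ) (k : ℕ) (x : ℝ) : ℝ≥0∞ :=
  ∑' ν, e ν * hlKernel k (x + s ν)

theorem measurable_shiftedKernel (e : ℕ → ℝ≥0∞) (s : ℕ → ℝ) (k : ℕ) :
    Measurable (shiftedKernel e s k) := by
  unfold shiftedKernel
  exact Measurable.tsum fun ν => ((measurable_hlKernel k).comp (measurable_add_const _)).const_mul _

theorem hlBound_shiftedKernel {p : ℝ} (hp : 1 < p) (e : ℕ → ℝ≥0∞) (s : ℕ → ℝ) :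
    HLBound p ((∑' ν, e ν) ^ p * ENNReal.ofReal (hlConst' p)) (shiftedKernel e s) := by
  intro b
  set H : ℝ → ℝ≥0∞ := fun x => ∑' k, hlKernel k x * b k with hH
  have hHm : Measurable H := Measurable.tsum fun k => (measurable_hlKernel k).mul_const _
  have hHp : Function.Periodic H (2 * π) := fun x => by
    simp only [hH, (hlKernel_periodic _) x]
  have e1 : ∀ x, ∑' k, shiftedKernel e s k x * b k = ∑' ν, e ν * H (x + s ν) := by
    intro x
    simp only [shiftedKernel, hH, ← ENNReal.tsum_mul_right, ← ENNReal.tsum_mul_left]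
    rw [ENNReal.tsum_comm]
    simp only [mul_assoc]
  simp_rw [e1]
  refine (lintegral_mono fun x => ENNReal.rpow_tsum_mul_le hp _ _).trans ?_
  have hm : ∀ ν, Measurable fun x => H (x + s ν) ^ p := fun ν =>
    (hHm.comp (measurable_add_const _)).pow_const _
  rw [lintegral_const_mul _ (Measurable.tsum fun ν => (hm ν).const_mul _),
    lintegral_tsum fun ν => ((hm ν).const_mul _).aemeasurable]
  simp_rw [lintegral_const_mul _ (hm _)]
  have hHp' : Function.Periodic (fun x => H x ^ p) (2 * π) := fun x => by
    simp only [hHp x]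
  have e2 : ∀ ν, ∫⁻ x in Set.Ioc (0:ℝ) (2 * π), H (x + s ν) ^ p =
      ∫⁻ x in Set.Ioc (0:ℝ) (2 * π), H x ^ p := fun ν =>
    setLIntegral_Ioc_comp_add_of_periodic hHp' (s ν)
  simp_rw [e2]
  rw [ENNReal.tsum_mul_right, ← mul_assoc]
  have h3 : (∑' ν, e ν) ^ (p - 1) * (∑' ν, e ν) = (∑' ν, e ν) ^ p := by
    nth_rewrite 2 [← ENNReal.rpow_one (∑' ν, e ν)]
    rw [← ENNReal.rpow_add_of_nonneg _ _ (by linarith) (by linarith)]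
    congr 1; ring
  rw [h3, mul_assoc]
  gcongr
  exact hlBound_hlKernel hp b

theorem fracBinom_eq_choose (α : ℝ) (n : ℕ) : fracBinom α n = Ring.choose α n := by
  induction n with
  | zero => simp [fracBinom]
  | succ n ih =>
    rw [fracBinom, ih, Ring.choose_eq_smul, Ring.choose_eq_smul, descPochhammer_succ_right,
      Polynomial.smeval_mul, Polynomial.smeval_sub, Nat.factorial_succ]
    have : ((n:ℝ) + 1) ≠ 0 := by positivity
    have h2 : ((n.factorial : ℕ) : ℝ) ≠ 0 := by positivity
    simp [Polynomial.smeval_natCast]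
    field_simp

theorem fracBinom_succ_eq (α : ℝ) (n : ℕ) :
    fracBinom α (n + 1) = fracBinom (α - 1) n + fracBinom (α - 1) (n + 1) := by
  have := Ring.choose_succ_succ (α - 1) n
  rw [sub_add_cancel] at this
  simpa only [fracBinom_eq_choose] using this

theorem sum_range_fracBinom (α : ℝ) (n : ℕ) :
    ∑ ν ∈ Finset.range (n + 1), (-1 : ℝ) ^ ν * fracBinom α ν = (-1) ^ n * fracBinom (α - 1) n := by
  induction n with
  | zero => simp [fracBinom]
  | succ n ih =>
    rw [Finset.sum_range_succ, ih, fracBinom_succ_eq]; ring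

theorem abs_fracBinom_le (α : ℝ) (hα : -1 < α) :
    ∃ B : ℝ, ∀ n, |fracBinom α n| ≤ B := by
  obtain ⟨m, hm⟩ := exists_nat_ge α
  have hstep : ∀ n, m ≤ n → |fracBinom α (n + 1)| ≤ |fracBinom α n| := by
    intro n hn
    have hn' : (m:ℝ) ≤ n := by exact_mod_cast hn
    rw [fracBinom, abs_div, abs_mul, div_le_iff₀ (abs_pos.mpr (by positivity)),
      abs_of_nonneg (show (0:ℝ) ≤ n + 1 by positivity)]
    gcongr
    rw [abs_le]; constructor <;> linarith
  refine ⟨∑ i ∈ Finset.range (m + 1), |fracBinom α i|, fun n => ?_⟩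
  rcases le_total n m with h | h
  · exact Finset.single_le_sum (f := fun i => |fracBinom α i|) (fun i _ => abs_nonneg _)
      (Finset.mem_range.mpr (by omega))
  · refine le_trans ?_ (Finset.single_le_sum (f := fun i => |fracBinom α i|)
      (fun i _ => abs_nonneg _) (Finset.mem_range.mpr (Nat.lt_succ_self m)))
    induction n, h using Nat.le_induction with
    | base => exact le_rfl
    | succ n hn ih => exact (hstep n hn).trans ih

theorem summable_abs_fracBinom {α : ℝ} (hα : 0 < α) : Summable fun n => |fracBinom α n| := by
  obtain ⟨B, hB⟩ := abs_fracBinom_le (α - 1) (by linarith)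
  obtain ⟨m, hm⟩ := exists_nat_ge α
  -- from index `m` on, the signs of `(-1)^n * fracBinom α n` are constant
  set c : ℕ → ℝ := fun n => (-1 : ℝ) ^ n * fracBinom α n with hc
  have habs : ∀ n, |fracBinom α n| = |c n| := fun n => by simp [hc, abs_mul]
  have hsame : ∀ n, 0 ≤ c m * c (m + n) := by
    intro n
    induction n with
    | zero => simpa using mul_self_nonneg (c m)
    | succ n ih =>
      have h1 : c (m + (n + 1)) = c (m + n) * ((((m + n : ℕ) : ℝ) - α) / (((m + n : ℕ) : ℝ) + 1)) := by
        simp only [hc, ← add_assoc, fracBinom, pow_succ]; ring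
      rw [h1, ← mul_assoc]
      refine mul_nonneg ih (div_nonneg ?_ (by positivity))
      push_cast
      have : (0:ℝ) ≤ n := by positivity
      linarith
  have hsgn : (∀ n, 0 ≤ c (m + n)) ∨ (∀ n, c (m + n) ≤ 0) := by
    rcases lt_trichotomy (c m) 0 with h | h | h
    · exact Or.inr fun n => by nlinarith [hsame n]
    · left
      have : ∀ n, c (m + n) = 0 := by
        intro n
        induction n with
        | zero => simpa using h
        | succ n ih =>
          have h1 : c (m + (n + 1)) =
              c (m + n) * ((((m + n : ℕ) : ℝ) - α) / (((m + n : ℕ) : ℝ) + 1)) := by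
            simp only [hc, ← add_assoc, fracBinom, pow_succ]; ring
          rw [h1, ih, zero_mul]
      exact fun n => (this n).ge
    · exact Or.inl fun n => by nlinarith [hsame n]
  have hps : ∀ n, |∑ i ∈ Finset.range n, c i| ≤ |B| := by
    intro n
    rcases n with _ | n
    · simp
    · rw [hc, sum_range_fracBinom, abs_mul, abs_pow, abs_neg, abs_one, one_pow, one_mul]
      exact (hB n).trans (le_abs_self _)
  have hpart : ∀ n, |∑ i ∈ Finset.range n, c (m + i)| ≤ 2 * |B| := by
    intro n
    have : ∑ i ∈ Finset.range n, c (m + i) =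
        ∑ i ∈ Finset.range (m + n), c i - ∑ i ∈ Finset.range m, c i := by
      rw [Finset.sum_range_add]; ring
    rw [this]
    refine (abs_sub _ _).trans ?_
    linarith [hps (m + n), hps m]
  simp_rw [habs]
  rw [← summable_nat_add_iff m]
  refine summable_of_sum_range_le (c := 2 * |B|) (fun n => abs_nonneg _) fun n => ?_
  rcases hsgn with h | h
  · refine le_trans (le_of_eq ?_) ((le_abs_self _).trans (hpart n))
    exact Finset.sum_congr rfl fun i _ => by rw [add_comm i m, abs_of_nonneg (h i)]
  · refine le_trans (le_of_eq ?_) ((neg_le_abs _).trans (hpart n))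
    rw [← Finset.sum_neg_distrib]
    exact Finset.sum_congr rfl fun i _ => by rw [add_comm i m, abs_of_nonpos (h i)]

/-- The coefficients `(-1)^ν C(α,ν)` of the fractional difference. -/
def diffCoef (α : ℝ) (ν : ℕ) : ℝ := (-1 : ℝ) ^ ν * fracBinom α ν

theorem summable_abs_diffCoef {α : ℝ} (hα : 0 < α) : Summable fun ν => |diffCoef α ν| := by
  have := summable_abs_fracBinom hα
  refine this.congr fun ν => ?_
  simp [diffCoef, abs_mul]

theorem hasSum_diffCoef_of_norm_lt {α : ℝ} {z : ℂ} (hz : ‖z‖ < 1) :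
    HasSum (fun ν => (diffCoef α ν : ℂ) * z ^ ν) ((1 - z) ^ (α : ℂ)) := by
  have h := (Complex.one_add_cpow_hasFPowerSeriesOnBall_zero (a := (α : ℂ))).hasSum (y := -z)
    (by simpa [← ENNReal.ofReal_one, Metric.eball_ofReal] using hz)
  simp only [zero_add] at h
  rw [← sub_eq_add_neg] at h
  suffices hs : (fun ν => (diffCoef α ν : ℂ) * z ^ ν) =
      fun n => (binomialSeries ℂ (α : ℂ) n) fun _ => -z from hs ▸ h
  funext ν
  have hc : ((Ring.choose α ν : ℝ) : ℂ) = Ring.choose (α : ℂ) ν :=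
    Ring.map_choose (algebraMap ℝ ℂ) α ν
  rw [binomialSeries_apply, diffCoef, fracBinom_eq_choose, Complex.ofReal_mul, hc]
  simp [neg_pow z]
  ring

theorem summable_norm_diffCoef {α : ℝ} (hα : 0 < α) {z : ℕ → ℂ} (hz : ∀ ν, ‖z ν‖ ≤ 1) :
    Summable fun ν => ‖(diffCoef α ν : ℂ) * z ν‖ := by
  refine Summable.of_nonneg_of_le (fun _ => norm_nonneg _) (fun ν => ?_) (summable_abs_diffCoef hα)
  rw [norm_mul, Complex.norm_real, Real.norm_eq_abs]
  exact mul_le_of_le_one_right (abs_nonneg _) (hz ν)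

/-- The binomial series converges to the binomial power on the closed unit disc. -/
theorem hasSum_diffCoef {α : ℝ} (hα : 0 < α) {z : ℂ} (hz : ‖z‖ ≤ 1) :
    HasSum (fun ν => (diffCoef α ν : ℂ) * z ^ ν) ((1 - z) ^ (α : ℂ)) := by
  have hsum : ∀ w : ℂ, ‖w‖ ≤ 1 → Summable fun ν => (diffCoef α ν : ℂ) * w ^ ν := fun w hw =>
    (summable_norm_diffCoef hα fun ν => by
      rw [norm_pow]; exact pow_le_one₀ (norm_nonneg _) hw).of_norm
  suffices h : ∑' ν, (diffCoef α ν : ℂ) * z ^ ν = (1 - z) ^ (α : ℂ) from h ▸ (hsum z hz).hasSum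
  have hc1 : ContinuousOn (fun w : ℂ => ∑' ν, (diffCoef α ν : ℂ) * w ^ ν) (Metric.closedBall 0 1) :=
    continuousOn_tsum (fun ν => by fun_prop) (summable_abs_diffCoef hα) fun ν w hw => by
      rw [norm_mul, Complex.norm_real, Real.norm_eq_abs, norm_pow]
      exact mul_le_of_le_one_right (abs_nonneg _)
        (pow_le_one₀ (norm_nonneg _) (by simpa using hw))
  have hc2 : ContinuousOn (fun w : ℂ => (1 - w) ^ (α : ℂ)) (Metric.closedBall 0 1) := by
    intro w hw
    have hre : w.re ≤ 1 := (Complex.re_le_norm w).trans (by simpa using hw)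
    have h1 : ContinuousAt (fun x : ℂ => x ^ (α : ℂ)) (1 - w) :=
      Complex.continuousAt_cpow_const_of_re_pos (Or.inl (by simpa using hre)) (by simpa using hα)
    have h2 : ContinuousAt (fun w : ℂ => 1 - w) w := by fun_prop
    exact (ContinuousAt.comp (g := fun x : ℂ => x ^ (α : ℂ)) h1 h2).continuousWithinAt
  have heq : Set.EqOn (fun w : ℂ => ∑' ν, (diffCoef α ν : ℂ) * w ^ ν)
      (fun w : ℂ => (1 - w) ^ (α : ℂ)) (Metric.ball 0 1) := fun w hw =>
    (hasSum_diffCoef_of_norm_lt (by simpa using hw)).tsum_eq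
  refine heq.of_subset_closure hc1 hc2 Metric.ball_subset_closedBall ?_ (by simpa using hz)
  rw [closure_ball _ one_ne_zero]

/-- The Fourier symbol of the fractional difference of order `α`, at `u = n h`. -/
def diffSymbol (α u : ℝ) : ℂ :=
  ∑' ν : ℕ, (diffCoef α ν : ℂ) * Complex.exp (Complex.I * ((α - ν) * u))

theorem diffSymbol_neg (α u : ℝ) : diffSymbol α (-u) = starRingEnd ℂ (diffSymbol α u) := by
  rw [diffSymbol, diffSymbol, Complex.conj_tsum]
  refine tsum_congr fun ν => ?_
  rw [map_mul, Complex.conj_ofReal, ← Complex.exp_conj]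
  simp

theorem diffSymbol_eq_exp_mul_cpow {α : ℝ} (hα : 0 < α) (u : ℝ) :
    diffSymbol α u = Complex.exp (Complex.I * (α * u)) *
      (1 - Complex.exp (-(u * Complex.I))) ^ (α : ℂ) := by
  have h1 := hasSum_diffCoef hα (z := Complex.exp (-(u * Complex.I)))
    (by rw [← neg_mul, ← Complex.ofReal_neg, Complex.norm_exp_ofReal_mul_I])
  have h2 := h1.mul_left (Complex.exp (Complex.I * (α * u)))
  rw [← h2.tsum_eq, diffSymbol]
  refine tsum_congr fun ν => ?_
  rw [← Complex.exp_nat_mul, mul_left_comm (Complex.exp _), ← Complex.exp_add]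
  congr 2; ring

theorem diffSymbol_eq {α u : ℝ} (hα : 0 < α) (hu : 0 ≤ u) (hu2 : u < 2 * π) :
    diffSymbol α u =
      Complex.exp (Complex.I * (α * (u + π) / 2)) * (((2 * sin (u / 2)) ^ α : ℝ) : ℂ) := by
  have h3 := diffSymbol_eq_exp_mul_cpow hα u
  rcases hu.eq_or_lt with rfl | hu
  · rw [h3]
    simp [hα.ne']
  have hsin : 0 < sin (u / 2) := sin_pos_of_pos_of_lt_pi (by linarith) (by linarith)
  have h4 : 1 - Complex.exp (-(u * Complex.I)) =
      ((2 * sin (u / 2) : ℝ) : ℂ) * Complex.exp (((π - u) / 2 : ℝ) * Complex.I) := by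
    have e1 : Complex.exp (((π - u) / 2 : ℝ) * Complex.I) =
        Complex.I * Complex.exp (-(u / 2 * Complex.I)) := by
      nth_rewrite 2 [← Complex.exp_pi_div_two_mul_I]
      rw [← Complex.exp_add]; congr 1; push_cast; ring
    have e2 : Complex.exp (-(u * Complex.I)) =
        Complex.exp (-(u / 2 * Complex.I)) * Complex.exp (-(u / 2 * Complex.I)) := by
      rw [← Complex.exp_add]; congr 1; ring
    have e3 : (1:ℂ) = Complex.exp (u / 2 * Complex.I) * Complex.exp (-(u / 2 * Complex.I)) := by
      rw [← Complex.exp_add]; simp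
    rw [e1, e2]
    nth_rewrite 1 [e3]
    push_cast
    rw [Complex.sin]
    have := Complex.I_mul_I
    rw [neg_mul]
    linear_combination (Complex.exp (-(u / 2 * Complex.I)) * Complex.exp (u / 2 * Complex.I) -
      Complex.exp (-(u / 2 * Complex.I)) * Complex.exp (-(u / 2 * Complex.I))) * this
  have hr : 0 < 2 * sin (u / 2) := by positivity
  have h5 : (1 - Complex.exp (-(u * Complex.I))) ^ (α : ℂ) =
      (((2 * sin (u / 2)) ^ α : ℝ) : ℂ) * Complex.exp (α * (((π - u) / 2 : ℝ) * Complex.I)) := by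
    have hlog : Complex.log (Complex.exp (((π - u) / 2 : ℝ) * Complex.I)) =
        ((π - u) / 2 : ℝ) * Complex.I := by
      apply Complex.log_exp
      · simp only [Complex.mul_im, Complex.ofReal_re, Complex.I_im, Complex.ofReal_im, Complex.I_re]
        linarith [pi_pos]
      · simp only [Complex.mul_im, Complex.ofReal_re, Complex.I_im, Complex.ofReal_im, Complex.I_re]
        linarith [pi_pos]
    rw [h4, Complex.cpow_def_of_ne_zero
      (mul_ne_zero (by exact_mod_cast hr.ne') (Complex.exp_ne_zero _)),
      Complex.log_ofReal_mul hr (Complex.exp_ne_zero _), hlog, add_mul, Complex.exp_add,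
      Real.rpow_def_of_pos hr]
    push_cast
    congr 2; ring
  rw [h3, h5, mul_left_comm, ← Complex.exp_add, mul_comm]
  congr 2
  push_cast; ring

theorem norm_sum_range_exp_le (k N : ℕ) (hN : N ≤ k + 1) (x : ℝ) :
    ‖∑ n ∈ Finset.range N, Complex.exp (Complex.I * (((n + 1 : ℕ) : ℝ) * x : ℝ))‖ ≤
      (k + 1) * hlProfile ((k:ℝ) + 1) |sin (x / 2)| := by
  have hN' : (N:ℝ) ≤ k + 1 := by exact_mod_cast hN
  have hexp : ∀ n : ℕ, Complex.exp (Complex.I * (((n + 1 : ℕ) : ℝ) * x : ℝ)) =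
      Complex.exp (Complex.I * x) ^ (n + 1) := fun n => by
    rw [← Complex.exp_nat_mul]; congr 1; push_cast; ring
  have h1 : ‖∑ n ∈ Finset.range N, Complex.exp (Complex.I * (((n + 1 : ℕ) : ℝ) * x : ℝ))‖ ≤ N := by
    refine (norm_sum_le _ _).trans ?_
    simp [mul_comm Complex.I, Complex.norm_exp_ofReal_mul_I, -Complex.ofReal_mul]
  have hw : ‖Complex.exp (Complex.I * x)‖ = 1 := by
    rw [mul_comm, Complex.norm_exp_ofReal_mul_I]
  have h2 : ‖∑ n ∈ Finset.range N, Complex.exp (Complex.I * (((n + 1 : ℕ) : ℝ) * x : ℝ))‖ *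
      |sin (x / 2)| ≤ 1 := by
    have e1 : (∑ n ∈ Finset.range N, Complex.exp (Complex.I * (((n + 1 : ℕ) : ℝ) * x : ℝ))) *
        (Complex.exp (Complex.I * x) - 1) =
        Complex.exp (Complex.I * x) * (Complex.exp (Complex.I * x) ^ N - 1) := by
      simp_rw [hexp, pow_succ']
      rw [← Finset.mul_sum, mul_assoc, geom_sum_mul]
    have e2 := congrArg norm e1
    rw [norm_mul, norm_mul, hw, one_mul, Complex.norm_exp_I_mul_ofReal_sub_one] at e2
    have e3 : ‖Complex.exp (Complex.I * x) ^ N - 1‖ ≤ 2 := by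
      refine (norm_sub_le _ _).trans ?_
      rw [norm_pow, hw]; norm_num
    rw [norm_mul, Real.norm_eq_abs, Real.norm_eq_abs, abs_two] at e2
    linarith
  rw [hlProfile, ← div_eq_mul_inv, le_div_iff₀ (by positivity)]
  rcases le_total (((k:ℝ) + 1) * |sin (x / 2)|) 1 with h | h
  · rw [max_eq_left h]; linarith
  · rw [max_eq_right h]
    nlinarith [show (0:ℝ) ≤ k by positivity]

/-- Abel summation: monotone coefficients against bounded partial sums. -/
theorem norm_sum_range_mul_le_of_monotone {v : ℕ → ℝ} {z : ℕ → ℂ} {k : ℕ} {B : ℝ}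
    (hv0 : 0 ≤ v 0) (hv : ∀ i < k, v i ≤ v (i + 1))
    (hz : ∀ N ≤ k + 1, ‖∑ n ∈ Finset.range N, z n‖ ≤ B) :
    ‖∑ n ∈ Finset.range (k + 1), (v n : ℂ) * z n‖ ≤ 2 * v k * B := by
  have hB : 0 ≤ B := (norm_nonneg _).trans (hz 0 (Nat.zero_le _))
  have hmono : ∀ i ≤ k, 0 ≤ v i := by
    intro i
    induction i with
    | zero => exact fun _ => hv0
    | succ i ih => exact fun h => (ih (by omega)).trans (hv i (by omega))
  have h := Finset.sum_range_by_parts (fun n => (v n : ℂ)) z (k + 1)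
  simp only [smul_eq_mul, Nat.add_sub_cancel] at h
  rw [h]
  refine (norm_sub_le _ _).trans ?_
  have h1 : ‖(v k : ℂ) * ∑ i ∈ Finset.range (k + 1), z i‖ ≤ v k * B := by
    rw [norm_mul, Complex.norm_real, Real.norm_of_nonneg (hmono k le_rfl)]
    exact mul_le_mul_of_nonneg_left (hz _ le_rfl) (hmono k le_rfl)
  have h2 : ‖∑ i ∈ Finset.range k, ((v (i + 1) : ℂ) - v i) * ∑ j ∈ Finset.range (i + 1), z j‖ ≤
      (v k - v 0) * B := by
    rw [← Finset.sum_range_sub v, Finset.sum_mul]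
    refine norm_sum_le_of_le _ fun i hi => ?_
    have hi' := Finset.mem_range.mp hi
    rw [norm_mul, ← Complex.ofReal_sub, Complex.norm_real,
      Real.norm_of_nonneg (sub_nonneg.mpr (hv i hi'))]
    exact mul_le_mul_of_nonneg_left (hz _ (by omega)) (sub_nonneg.mpr (hv i hi'))
  nlinarith [mul_nonneg hv0 hB]

theorem enorm_sum_range_mul_exp_le {v : ℕ → ℝ} {k : ℕ}
    (hv0 : 0 ≤ v 0) (hv : ∀ i < k, v i ≤ v (i + 1)) (x : ℝ) :
    ‖∑ n ∈ Finset.range (k + 1),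
      (v n : ℂ) * Complex.exp (Complex.I * (((n + 1 : ℕ) : ℝ) * x : ℝ))‖ₑ ≤
      ENNReal.ofReal (2 * v k * (k + 1)) * hlKernel k x := by
  have h := norm_sum_range_mul_le_of_monotone hv0 hv
    (fun N hN => norm_sum_range_exp_le k N hN x)
  have hpos : 0 < ((k:ℝ) + 1) * hlProfile ((k:ℝ) + 1) |sin (x / 2)| :=
    mul_pos (by positivity) (hlProfile_pos _ _)
  have hvk : 0 ≤ 2 * v k := nonneg_of_mul_nonneg_left ((norm_nonneg _).trans h) hpos
  rw [hlKernel, ← ENNReal.ofReal_mul (by positivity), ← ofReal_norm]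
  exact ENNReal.ofReal_le_ofReal (by rw [mul_assoc]; exact h)

/-- The real trigonometric polynomial `∑_{n=1}^{k+1} Re (ρ n e^{inx})`. -/
def trigPoly (ρ : ℕ → ℂ) (k : ℕ) (x : ℝ) : ℝ :=
  ∑ n ∈ Finset.range (k + 1),
    (ρ (n + 1) * Complex.exp (Complex.I * (((n + 1 : ℕ) : ℝ) * x : ℝ))).re

theorem enorm_trigPoly_le {ρ : ℕ → ℂ} {v : ℕ → ℝ} {k : ℕ} {c : ℕ → ℂ} {s : ℕ → ℝ}
    (hc : Summable fun ν => ‖c ν‖) (hv0 : 0 ≤ v 0) (hv : ∀ i < k, v i ≤ v (i + 1))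
    (hρ : ∀ n ≤ k, ρ (n + 1) =
      v n * ∑' ν, c ν * Complex.exp (Complex.I * (((n + 1 : ℕ) : ℝ) * s ν : ℝ))) (x : ℝ) :
    ‖trigPoly ρ k x‖ₑ ≤
      ENNReal.ofReal (2 * v k * (k + 1)) * shiftedKernel (fun ν => ‖c ν‖ₑ) s k x := by
  have hs : ∀ n : ℕ, Summable fun ν =>
      c ν * Complex.exp (Complex.I * (((n + 1 : ℕ) : ℝ) * s ν : ℝ)) := fun n => by
    refine Summable.of_norm (hc.congr fun ν => ?_)
    rw [norm_mul, mul_comm Complex.I, Complex.norm_exp_ofReal_mul_I, mul_one]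
  have h1 : HasSum (fun ν => c ν * ∑ n ∈ Finset.range (k + 1),
        (v n : ℂ) * Complex.exp (Complex.I * (((n + 1 : ℕ) : ℝ) * (x + s ν) : ℝ)))
      (∑ n ∈ Finset.range (k + 1),
        ρ (n + 1) * Complex.exp (Complex.I * (((n + 1 : ℕ) : ℝ) * x : ℝ))) := by
    have h2 : ∀ n ∈ Finset.range (k + 1), HasSum (fun ν => (v n *
        (c ν * Complex.exp (Complex.I * (((n + 1 : ℕ) : ℝ) * s ν : ℝ)))) *
          Complex.exp (Complex.I * (((n + 1 : ℕ) : ℝ) * x : ℝ)))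
        (ρ (n + 1) * Complex.exp (Complex.I * (((n + 1 : ℕ) : ℝ) * x : ℝ))) := fun n hn => by
      rw [hρ n (Nat.lt_succ_iff.mp (Finset.mem_range.mp hn))]
      exact ((hs n).hasSum.mul_left _).mul_right _
    convert hasSum_sum h2 using 2 with ν
    rw [Finset.mul_sum]
    refine Finset.sum_congr rfl fun n _ => ?_
    rw [mul_left_comm, mul_assoc, mul_assoc, ← Complex.exp_add]
    congr 3
    push_cast; ring_nf
  have h3 : ‖trigPoly ρ k x‖ₑ ≤ ‖∑ n ∈ Finset.range (k + 1),
        ρ (n + 1) * Complex.exp (Complex.I * (((n + 1 : ℕ) : ℝ) * x : ℝ))‖ₑ := by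
    rw [trigPoly, ← Complex.re_sum, enorm_le_iff_norm_le]
    exact Complex.abs_re_le_norm _
  refine h3.trans ?_
  rw [← h1.tsum_eq]
  refine enorm_tsum_le_tsum_enorm.trans ?_
  rw [shiftedKernel, ← ENNReal.tsum_mul_left]
  refine ENNReal.tsum_le_tsum fun ν => ?_
  rw [enorm_mul, mul_left_comm]
  gcongr
  exact enorm_sum_range_mul_exp_le hv0 hv _

/-- Prepend a term to a sequence. -/
def consSeq {α : Type*} (a : α) (e : ℕ → α) : ℕ → α
  | 0 => a
  | n + 1 => e n

theorem hlKernel_le_shiftedKernel_consSeq (e : ℕ → ℝ≥0∞) (t : ℝ) (s : ℕ → ℝ) (k : ℕ) (x : ℝ) :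
    hlKernel k (x + t) ≤ shiftedKernel (consSeq 1 e) (consSeq t s) k x := by
  refine le_trans ?_ (ENNReal.le_tsum 0)
  simp [consSeq]

theorem shiftedKernel_le_shiftedKernel_consSeq (e : ℕ → ℝ≥0∞) (t : ℝ) (s : ℕ → ℝ) (k : ℕ) (x : ℝ) :
    shiftedKernel e s k x ≤ shiftedKernel (consSeq 1 e) (consSeq t s) k x := by
  exact (le_add_left le_rfl).trans (tsum_eq_zero_add' ENNReal.summable).ge

theorem tsum_consSeq_ne_top {α : ℝ} (hα : 0 < α) :
    ∑' n, consSeq 1 (fun ν => ‖(diffCoef α ν : ℂ)‖ₑ) n ≠ ⊤ := by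
  rw [tsum_eq_zero_add' ENNReal.summable]
  refine ENNReal.add_ne_top.mpr ⟨by simp [consSeq], ?_⟩
  simp only [consSeq]
  have := (summable_abs_diffCoef hα).tsum_ofReal_ne_top
  simpa [← ofReal_norm] using this

/-- The growth of the symbol of a Weyl derivative followed by a fractional difference. -/
def symbolSize (r β δ : ℝ) (k : ℕ) : ℝ := ((k:ℝ) + 1) ^ r * (min 1 (((k:ℝ) + 1) * δ)) ^ β

theorem symbolSize_nonneg (r β : ℝ) {δ : ℝ} (hδ : 0 ≤ δ) (k : ℕ) : 0 ≤ symbolSize r β δ k := by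
  unfold symbolSize
  have : 0 ≤ min 1 (((k:ℝ) + 1) * δ) := le_min zero_le_one (by positivity)
  positivity

/-- The symbol `(i n)^r` of the Weyl derivative times that of a fractional difference. -/
def weylSymbol (r β h : ℝ) (n : ℤ) : ℂ :=
  (Complex.I * (n : ℂ)) ^ (r : ℂ) * diffSymbol β (n * h)

theorem I_mul_natCast_cpow (r : ℝ) (n : ℕ) :
    (Complex.I * ((n + 1 : ℕ) : ℂ)) ^ (r : ℂ) =
      ((((n:ℝ) + 1) ^ r : ℝ) : ℂ) * Complex.exp (Complex.I * (π * r / 2)) := by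
  have hn : (0:ℝ) < n + 1 := by positivity
  have h : (Complex.I * ((n + 1 : ℕ) : ℂ)) = (((n:ℝ) + 1 : ℝ) : ℂ) * Complex.I := by
    push_cast; ring
  rw [h, Complex.cpow_def_of_ne_zero (mul_ne_zero (by exact_mod_cast hn.ne') Complex.I_ne_zero),
    Complex.log_ofReal_mul hn Complex.I_ne_zero, Complex.log_I, add_mul, Complex.exp_add,
    Real.rpow_def_of_pos hn]
  push_cast
  congr 2; ring

theorem enorm_trigPoly_weylSymbol_le {r β δ h : ℝ} (hr : 0 ≤ r) (hβ : 0 < β)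
    (hh : |h| ≤ δ) (k : ℕ) (x : ℝ) :
    ‖trigPoly (fun n => weylSymbol r β h n) k x‖ₑ ≤
      ENNReal.ofReal (2 * symbolSize r β δ k * (k + 1)) *
        shiftedKernel (consSeq 1 fun ν => ‖(diffCoef β ν : ℂ)‖ₑ)
          (consSeq (β * h / 2) fun ν => (β - ν) * h) k x := by
  have hphase : ‖Complex.exp (Complex.I * (π * r / 2))‖ = 1 := by
    have : (Complex.I * (π * r / 2) : ℂ) = ((π * r / 2 : ℝ) : ℂ) * Complex.I := by
      push_cast; ring
    rw [this, Complex.norm_exp_ofReal_mul_I]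
  have hcast : ∀ n : ℕ, weylSymbol r β h ((n + 1 : ℕ) : ℤ) =
      ((((n:ℝ) + 1) ^ r : ℝ) : ℂ) * Complex.exp (Complex.I * (π * r / 2)) *
        diffSymbol β ((n + 1 : ℕ) * h) := fun n => by
    rw [weylSymbol, Int.cast_natCast, I_mul_natCast_cpow]; rfl
  rcases le_or_gt (((k:ℝ) + 1) * δ) 1 with hk | hk
  · -- low frequencies: the symbol is monotone up to a unimodular factor
    set v : ℕ → ℝ := fun n => ((n:ℝ) + 1) ^ r * (2 * sin ((n + 1) * |h| / 2)) ^ β with hv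
    have hbd : ∀ n ≤ k, ((n:ℝ) + 1) * |h| ≤ 1 := fun n hn => by
      refine le_trans ?_ hk
      gcongr
    have hsin : ∀ n ≤ k, 0 ≤ sin (((n:ℝ) + 1) * |h| / 2) := fun n hn =>
      sin_nonneg_of_nonneg_of_le_pi (by positivity) (by linarith [hbd n hn, pi_gt_three])
    have hv0 : 0 ≤ v 0 := by
      have := hsin 0 (Nat.zero_le _)
      simp only [hv]; positivity
    have hvm : ∀ i < k, v i ≤ v (i + 1) := fun i hi => by
      have h1 := hsin i hi.le
      have h2 := hbd (i + 1) hi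
      simp only [hv]
      push_cast at h2 ⊢
      gcongr ?_ * (2 * ?_) ^ β
      · gcongr; linarith
      · refine sin_le_sin_of_le_of_le_pi_div_two ?_ ?_ ?_
        · have : 0 ≤ ((i:ℝ) + 1) * |h| / 2 := by positivity
          linarith [pi_gt_three]
        · linarith [pi_gt_three]
        · gcongr; linarith
    have hvk : v k ≤ symbolSize r β δ k := by
      simp only [hv, symbolSize]
      rw [min_eq_right hk]
      have h1 := hsin k le_rfl
      refine mul_le_mul_of_nonneg_left (rpow_le_rpow (by positivity) ?_ hβ.le) (by positivity)
      have h2 := Real.sin_le (show 0 ≤ ((k:ℝ) + 1) * |h| / 2 by positivity)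
      have h3 : ((k:ℝ) + 1) * |h| ≤ (k + 1) * δ := by gcongr
      linarith
    have hsym : ∃ c : ℂ, ‖c‖ = 1 ∧ ∀ n ≤ k, diffSymbol β (((n + 1 : ℕ) : ℝ) * h) =
        (((2 * sin ((n + 1) * |h| / 2)) ^ β : ℝ) : ℂ) *
          (c * Complex.exp (Complex.I * ((((n + 1 : ℕ) : ℝ) * (β * h / 2) : ℝ) : ℂ))) := by
      have hn2 : ∀ n ≤ k, ((n + 1 : ℕ) : ℝ) * |h| < 2 * π := fun n hn => by
        push_cast; linarith [hbd n hn, pi_gt_three]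
      rcases le_or_gt 0 h with h0 | h0
      · refine ⟨Complex.exp ((β * π / 2 : ℝ) * Complex.I), Complex.norm_exp_ofReal_mul_I _,
          fun n hn => ?_⟩
        have := hn2 n hn
        rw [abs_of_nonneg h0] at this ⊢
        rw [diffSymbol_eq hβ (by positivity) this, ← Complex.exp_add]
        refine (mul_comm _ _).trans ?_
        push_cast
        congr 2; ring
      · refine ⟨Complex.exp ((-(β * π / 2) : ℝ) * Complex.I), Complex.norm_exp_ofReal_mul_I _,
          fun n hn => ?_⟩
        have := hn2 n hn
        have e1 : ((n + 1 : ℕ) : ℝ) * h = -(((n + 1 : ℕ) : ℝ) * |h|) := by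
          rw [abs_of_neg h0]; ring
        rw [e1, diffSymbol_neg, diffSymbol_eq hβ (by positivity) this, ← Complex.exp_add,
          map_mul, Complex.conj_ofReal, ← Complex.exp_conj, abs_of_neg h0]
        refine (mul_comm _ _).trans ?_
        push_cast
        simp only [map_mul, map_div₀, map_add, Complex.conj_I, Complex.conj_ofReal, map_natCast,
          map_ofNat, map_neg, map_one]
        congr 2
        ring
    obtain ⟨c, hc1, hc2⟩ := hsym
    have key := enorm_sum_range_mul_exp_le hv0 hvm (x + β * h / 2)
    have h3 : ‖trigPoly (fun n => weylSymbol r β h n) k x‖ₑ ≤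
        ‖Complex.exp (Complex.I * (π * r / 2)) * c * ∑ n ∈ Finset.range (k + 1), (v n : ℂ) *
          Complex.exp (Complex.I * (((n + 1 : ℕ) : ℝ) * (x + β * h / 2) : ℝ))‖ₑ := by
      rw [trigPoly, ← Complex.re_sum, enorm_le_iff_norm_le]
      refine (Complex.abs_re_le_norm _).trans (le_of_eq ?_)
      congr 1
      rw [Finset.mul_sum]
      refine Finset.sum_congr rfl fun n hn => ?_
      have hn' : n ≤ k := Nat.lt_succ_iff.mp (Finset.mem_range.mp hn)
      have e1 : Complex.exp (Complex.I * (((n + 1 : ℕ) : ℝ) * (x + β * h / 2) : ℝ)) =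
          Complex.exp (Complex.I * ((((n + 1 : ℕ) : ℝ) * (β * h / 2) : ℝ) : ℂ)) *
            Complex.exp (Complex.I * (((n + 1 : ℕ) : ℝ) * x : ℝ)) := by
        rw [← Complex.exp_add]; congr 1; push_cast; ring
      have e2 : (v n : ℂ) = ((((n:ℝ) + 1) ^ r : ℝ) : ℂ) *
          (((2 * sin ((n + 1) * |h| / 2)) ^ β : ℝ) : ℂ) := by
        rw [← Complex.ofReal_mul]
      rw [hcast, hc2 n hn', e1, e2]
      ring
    refine h3.trans ?_
    rw [enorm_mul, enorm_mul, ← ofReal_norm, ← ofReal_norm, hc1, hphase,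
      ENNReal.ofReal_one, one_mul, one_mul]
    refine key.trans ?_
    gcongr
    exact hlKernel_le_shiftedKernel_consSeq _ _ _ _ _
  · -- high frequencies: use the defining series of the symbol
    have hsz : symbolSize r β δ k = ((k:ℝ) + 1) ^ r := by
      rw [symbolSize, min_eq_left hk.le, one_rpow, mul_one]
    have hc : Summable fun ν => ‖Complex.exp (Complex.I * (π * r / 2)) * (diffCoef β ν : ℂ)‖ := by
      simpa [norm_mul, hphase] using summable_abs_diffCoef hβ
    refine (enorm_trigPoly_le (v := fun n => ((n:ℝ) + 1) ^ r) (s := fun ν => (β - ν) * h) hc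
      (by positivity) (fun i _ => by
        push_cast
        gcongr
        linarith) (fun n _ => ?_) x).trans ?_
    · rw [hcast, diffSymbol, mul_assoc, ← tsum_mul_left]
      congr 1
      refine tsum_congr fun ν => ?_
      rw [mul_assoc]
      congr 4
      push_cast; ring
    · rw [hsz]
      gcongr
      refine le_trans (le_of_eq ?_) (shiftedKernel_le_shiftedKernel_consSeq _ _ _ _ _)
      congr 1
      ext ν
      rw [enorm_mul, ← ofReal_norm (Complex.exp _), hphase, ENNReal.ofReal_one, one_mul]

theorem diffSymbol_mul_diffSymbol {α γ u : ℝ} {j : ℕ} (hα : 0 < α) (hγ : 0 < γ)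
    (h : α + γ = 2 * j) :
    diffSymbol α u * diffSymbol γ u =
      Complex.exp (Complex.I * (j * u)) * (((-1) ^ j * (2 - 2 * cos u) ^ j : ℝ) : ℂ) := by
  have hj : j ≠ 0 := by
    rintro rfl
    simp at h; linarith
  have hcos : (((-1) ^ j * (2 - 2 * cos u) ^ j : ℝ) : ℂ) =
      (Complex.exp (u * Complex.I) * (1 - Complex.exp (-(u * Complex.I))) ^ 2) ^ j := by
    rw [← mul_pow]
    push_cast
    congr 1
    have h1 : Complex.exp (u * Complex.I) * Complex.exp (-(u * Complex.I)) = 1 := by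
      rw [← Complex.exp_add]; simp
    rw [Complex.cos, neg_mul]
    rw [neg_mul]
    linear_combination (2 - Complex.exp (-(u * Complex.I))) * h1
  rw [diffSymbol_eq_exp_mul_cpow hα, diffSymbol_eq_exp_mul_cpow hγ, hcos]
  set w := 1 - Complex.exp (-(u * Complex.I)) with hw
  by_cases h0 : w = 0
  · rw [h0, Complex.zero_cpow (by exact_mod_cast hα.ne')]
    simp [hj]
  · have e1 : w ^ (α : ℂ) * w ^ (γ : ℂ) = (w ^ 2) ^ j := by
      rw [← Complex.cpow_add _ _ h0, ← Complex.ofReal_add, h, ← pow_mul, ← Complex.cpow_natCast]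
      push_cast; rfl
    have e2 : Complex.exp (Complex.I * (α * u)) * Complex.exp (Complex.I * (γ * u)) =
        Complex.exp (Complex.I * (j * u)) * Complex.exp (u * Complex.I) ^ j := by
      have : (γ : ℂ) = 2 * j - α := by
        have : γ = 2 * j - α := by linarith
        rw [this]; push_cast; ring
      rw [← Complex.exp_nat_mul, ← Complex.exp_add, ← Complex.exp_add, this]
      congr 1; ring
    rw [mul_pow, ← e1, mul_mul_mul_comm, e2]
    ring

/-- Lower bound for the averages of `n^r (2 - 2 cos nδ)^j` over high frequency ranges. -/
theorem le_sum_rpow_mul_cos_pow {r : ℝ} (hr : 0 ≤ r) (j : ℕ) {δ : ℝ} (hδ : 0 < δ) (hδ2 : δ < 1 / 2)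
    {k : ℕ} (hk : 3 < ((k:ℝ) + 1) * δ) :
    (1 / 10 : ℝ) ^ r * (1 / 10) ^ j * (1 / 40) * ((k + 1) * ((k:ℝ) + 1) ^ r) ≤
      ∑ n ∈ Finset.range (k + 1), ((n:ℝ) + 1) ^ r * (2 - 2 * cos ((n + 1) * δ)) ^ j := by
  set K : ℝ := (k:ℝ) + 1 with hK
  have hKpos : 0 < K := by positivity
  have hcossum : |∑ n ∈ Finset.range (k + 1), cos (((n:ℝ) + 1) * δ)| * sin (δ / 2) ≤ 1 := by
    have h1 := norm_sum_range_exp_le k (k + 1) le_rfl δ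
    have hs : 0 < sin (δ / 2) := sin_pos_of_pos_of_lt_pi (by linarith) (by linarith [pi_gt_three])
    have h2 : |∑ n ∈ Finset.range (k + 1), cos (((n:ℝ) + 1) * δ)| ≤
        ‖∑ n ∈ Finset.range (k + 1), Complex.exp (Complex.I * (((n + 1 : ℕ) : ℝ) * δ : ℝ))‖ := by
      refine le_trans (le_of_eq ?_) (Complex.abs_re_le_norm _)
      rw [Complex.re_sum]
      congr 1
      refine Finset.sum_congr rfl fun n _ => ?_
      rw [mul_comm Complex.I, Complex.exp_ofReal_mul_I_re]
      push_cast; rfl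
    rw [abs_of_pos hs] at h1
    have h3 := hlProfile_le_inv (mul_pos hKpos hs)
    calc _ ≤ (K * (K * sin (δ / 2))⁻¹) * sin (δ / 2) := by
          gcongr
          exact h2.trans (h1.trans (by gcongr))
      _ = 1 := by field_simp
  have hsin : 63 / 128 * δ ≤ sin (δ / 2) := by
    have h1 := Real.sin_gt_sub_cube (x := δ / 2) (by linarith)
    nlinarith [mul_pos hδ hδ]
  have hsum : ∑ n ∈ Finset.range (k + 1), cos (((n:ℝ) + 1) * δ) ≤ 7 / 10 * K := by
    have hX := le_abs_self (∑ n ∈ Finset.range (k + 1), cos (((n:ℝ) + 1) * δ))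
    have hX0 := abs_nonneg (∑ n ∈ Finset.range (k + 1), cos (((n:ℝ) + 1) * δ))
    set X := |∑ n ∈ Finset.range (k + 1), cos (((n:ℝ) + 1) * δ)|
    refine hX.trans ?_
    have h1 : X * (63 / 128 * δ) ≤ 1 := (mul_le_mul_of_nonneg_left hsin hX0).trans hcossum
    by_contra hlt
    push Not at hlt
    nlinarith
  have hcard : ∑ n ∈ Finset.range (k + 1), (if (n:ℝ) + 1 < K / 10 then (1:ℝ) else 0) ≤ K / 10 := by
    rw [Finset.sum_boole]
    have hsub : (Finset.range (k + 1)).filter (fun n : ℕ => (n:ℝ) + 1 < K / 10) ⊆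
        Finset.range ⌊K / 10⌋₊ := fun n hn => by
      rw [Finset.mem_filter] at hn
      rw [Finset.mem_range]
      have : n + 1 ≤ ⌊K / 10⌋₊ := Nat.le_floor (by push_cast; exact hn.2.le)
      omega
    have := Finset.card_le_card hsub
    rw [Finset.card_range] at this
    exact (Nat.cast_le.mpr this).trans (Nat.floor_le (by positivity))
  have hpt : ∀ n ∈ Finset.range (k + 1),
      (K / 10) ^ r * (1 / 10) ^ j * ((2 - 2 * cos (((n:ℝ) + 1) * δ) - 1 / 10 -
        4 * (if (n:ℝ) + 1 < K / 10 then (1:ℝ) else 0)) / 4) ≤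
      ((n:ℝ) + 1) ^ r * (2 - 2 * cos ((n + 1) * δ)) ^ j := fun n _ => by
    have c1 := cos_le_one (((n:ℝ) + 1) * δ)
    have c2 := neg_one_le_cos (((n:ℝ) + 1) * δ)
    set a := 2 - 2 * cos (((n:ℝ) + 1) * δ) with ha
    have ha0 : 0 ≤ a := by linarith
    have hR : 0 ≤ ((n:ℝ) + 1) ^ r * a ^ j := by positivity
    have hc : 0 ≤ (K / 10) ^ r * (1 / 10) ^ j := by positivity
    split_ifs with hn
    · exact (mul_nonpos_of_nonneg_of_nonpos hc (by linarith)).trans hR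
    · rcases lt_or_ge a (1 / 10) with h | h
      · exact (mul_nonpos_of_nonneg_of_nonpos hc (by linarith)).trans hR
      · refine (mul_le_of_le_one_right hc (by linarith)).trans ?_
        push Not at hn
        gcongr
  refine le_trans ?_ (Finset.sum_le_sum hpt)
  rw [← Finset.mul_sum, ← Finset.sum_div, Finset.sum_sub_distrib, Finset.sum_sub_distrib,
    Finset.sum_sub_distrib, ← Finset.mul_sum, ← Finset.mul_sum]
  simp only [Finset.sum_const, Finset.card_range, nsmul_eq_mul]
  rw [show (1 / 10 : ℝ) ^ r * (1 / 10) ^ j * (1 / 40) * (K * K ^ r) =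
    (K / 10) ^ r * (1 / 10) ^ j * (K / 40) by
      rw [div_eq_mul_one_div K 10, Real.mul_rpow hKpos.le (by norm_num)]; ring]
  refine mul_le_mul_of_nonneg_left ?_ (by positivity)
  push_cast
  rw [← hK]
  linarith

/-- Lower bound for the averages of `n^r (2 sin (nδ/2))^β` over low frequency ranges. -/
theorem le_sum_rpow_mul_sin_rpow {r β δ : ℝ} (hr : 0 ≤ r) (hβ : 0 < β) (hδ : 0 < δ)
    {k : ℕ} (hk : ((k:ℝ) + 1) * δ ≤ 3) :
    (1 / 2 : ℝ) ^ r * (1 / π) ^ β * (1 / 2) * ((k + 1) * (((k:ℝ) + 1) ^ r * ((k + 1) * δ) ^ β)) ≤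
      ∑ n ∈ Finset.range (k + 1), ((n:ℝ) + 1) ^ r * (2 * sin ((n + 1) * δ / 2)) ^ β := by
  have hbd : ∀ n ∈ Finset.range (k + 1), ((n:ℝ) + 1) * δ ≤ 3 := fun n hn => by
    have : n ≤ k := Nat.lt_succ_iff.mp (Finset.mem_range.mp hn)
    refine le_trans ?_ hk
    gcongr
  have hsin : ∀ n ∈ Finset.range (k + 1), 2 / π * ((n + 1) * δ / 2) ≤ sin (((n:ℝ) + 1) * δ / 2) :=
    fun n hn => Real.mul_le_sin (by positivity) (by linarith [hbd n hn, pi_gt_three])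
  have hnn : ∀ n ∈ Finset.range (k + 1),
      0 ≤ ((n:ℝ) + 1) ^ r * (2 * sin ((n + 1) * δ / 2)) ^ β := fun n hn => by
    have h0 : 0 ≤ 2 / π * (((n:ℝ) + 1) * δ / 2) := by positivity
    have h1 := h0.trans (hsin n hn)
    positivity
  refine le_trans ?_ (Finset.sum_le_sum_of_subset_of_nonneg
    (s := Finset.Ico (k / 2) (k + 1)) (fun n hn => by
      rw [Finset.mem_Ico] at hn; exact Finset.mem_range.mpr hn.2) fun n hn _ => hnn n hn)
  have hterm : ∀ n ∈ Finset.Ico (k / 2) (k + 1),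
      (((k:ℝ) + 1) / 2) ^ r * (((k + 1) * δ) / π) ^ β ≤
        ((n:ℝ) + 1) ^ r * (2 * sin ((n + 1) * δ / 2)) ^ β := fun n hn => by
    rw [Finset.mem_Ico] at hn
    have hn1 : (k:ℝ) + 1 ≤ 2 * (n + 1) := by
      have : k + 1 ≤ 2 * (n + 1) := by omega
      exact_mod_cast this
    have hs := hsin n (Finset.mem_range.mpr hn.2)
    have h2 : (((k:ℝ) + 1) * δ) / π ≤ 2 * sin ((n + 1) * δ / 2) := by
      have : (((k:ℝ) + 1) * δ) / π ≤ 2 * (2 / π * ((n + 1) * δ / 2)) := by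
        rw [div_le_iff₀ pi_pos]
        have : 2 * (2 / π * (((n:ℝ) + 1) * δ / 2)) * π = 2 * (n + 1) * δ := by
          field_simp
        rw [this]; gcongr
      linarith
    gcongr
    linarith
  refine le_trans ?_ (Finset.card_nsmul_le_sum _ _ _ hterm)
  rw [Nat.card_Ico, nsmul_eq_mul]
  have hcard : ((k:ℝ) + 1) * (1 / 2) ≤ ((k + 1 - k / 2 : ℕ) : ℝ) := by
    have : k + 1 ≤ 2 * (k + 1 - k / 2) := by omega
    have : ((k + 1 : ℕ) : ℝ) ≤ ((2 * (k + 1 - k / 2) : ℕ) : ℝ) := by exact_mod_cast this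
    push_cast at this
    linarith
  refine le_trans (le_of_eq ?_) (mul_le_mul_of_nonneg_right hcard (by positivity))
  have e1 : (((k:ℝ) + 1) / 2) ^ r = ((k:ℝ) + 1) ^ r * (1 / 2) ^ r := by
    rw [div_eq_mul_one_div, Real.mul_rpow (by positivity) (by norm_num)]
  have e2 : (((k:ℝ) + 1) * δ / π) ^ β = (((k:ℝ) + 1) * δ) ^ β * (1 / π) ^ β := by
    rw [div_eq_mul_one_div, Real.mul_rpow (by positivity) (by positivity)]
  rw [e1, e2]
  ring

theorem norm_exp_I_mul_ofReal (t : ℝ) : ‖Complex.exp (Complex.I * t)‖ = 1 := by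
  rw [mul_comm, Complex.norm_exp_ofReal_mul_I]

theorem exp_I_mul_mul_conj (t : ℝ) :
    Complex.exp (Complex.I * t) * starRingEnd ℂ (Complex.exp (Complex.I * t)) = 1 := by
  rw [Complex.mul_conj, Complex.normSq_eq_norm_sq, norm_exp_I_mul_ofReal]; simp

theorem weylSymbol_natCast_succ (r β h : ℝ) (n : ℕ) :
    weylSymbol r β h ((n + 1 : ℕ) : ℤ) =
      ((((n:ℝ) + 1) ^ r : ℝ) : ℂ) * Complex.exp (Complex.I * (π * r / 2 : ℝ)) *
        diffSymbol β ((n + 1 : ℕ) * h) := by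
  rw [weylSymbol, Int.cast_natCast, I_mul_natCast_cpow]
  push_cast; rfl

/-- Trigonometric polynomials, controlled by translates of `hlKernel`, whose coefficients are
positively aligned with the symbol `weylSymbol r β δ`. -/
theorem exists_dual_symbol {r β : ℝ} (hr : 0 ≤ r) (hβ : 0 < β) :
    ∃ γ c : ℝ, 0 < γ ∧ 0 < c ∧ ∀ δ : ℝ, 0 < δ → δ < 1 / 2 → ∃ s : ℕ → ℝ, ∀ k : ℕ, ∃ ψ : ℕ → ℂ,
      (∀ x, ‖trigPoly ψ k x‖ₑ ≤ ENNReal.ofReal (2 * (k + 1)) *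
        shiftedKernel (consSeq 1 fun ν => ‖(diffCoef γ ν : ℂ)‖ₑ) s k x) ∧
      (∀ n ≤ k, 0 ≤ (ψ (n + 1) * starRingEnd ℂ (weylSymbol r β δ ((n + 1 : ℕ) : ℤ))).re) ∧
      c * ((k + 1) * symbolSize r β δ k) ≤ ∑ n ∈ Finset.range (k + 1),
        (ψ (n + 1) * starRingEnd ℂ (weylSymbol r β δ ((n + 1 : ℕ) : ℤ))).re := by
  set j : ℕ := ⌈β⌉₊ with hj
  have hjβ : β ≤ j := Nat.le_ceil β
  set γ : ℝ := 2 * j - β with hγd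
  have hγ : 0 < γ := by linarith
  set c₁ : ℝ := (1 / 10 : ℝ) ^ r * (1 / 10) ^ j * (1 / 40) with hc₁
  set c₂ : ℝ := (1 / 2 : ℝ) ^ r * (1 / π) ^ β * (1 / 2) with hc₂
  have hc₁0 : 0 < c₁ := by positivity
  have hc₂0 : 0 < c₂ := by have := pi_pos; positivity
  refine ⟨γ, min c₁ c₂, hγ, lt_min hc₁0 hc₂0, fun δ hδ hδ2 =>
    ⟨consSeq (β * δ / 2) fun ν => -((γ - ν) * δ - j * δ), fun k => ?_⟩⟩
  have hmin0 : 0 ≤ min 1 (((k:ℝ) + 1) * δ) := le_min zero_le_one (by positivity)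
  have hsz0 := symbolSize_nonneg r β hδ.le k
  rcases le_or_gt (((k:ℝ) + 1) * δ) 3 with hk | hk
  · have hbd : ∀ n ≤ k, ((n:ℝ) + 1) * δ ≤ 3 := fun n hn => by
      refine le_trans ?_ hk
      gcongr
    have hsin : ∀ n ≤ k, 0 ≤ sin (((n:ℝ) + 1) * δ / 2) := fun n hn =>
      sin_nonneg_of_nonneg_of_le_pi (by positivity) (by linarith [hbd n hn, pi_gt_three])
    have hre : ∀ n ≤ k, (Complex.exp (Complex.I * ((π * r / 2 + β * ((n + 1 : ℕ) * δ + π) / 2 : ℝ)))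
        * starRingEnd ℂ (weylSymbol r β δ ((n + 1 : ℕ) : ℤ))).re =
        ((n:ℝ) + 1) ^ r * (2 * sin ((n + 1) * δ / 2)) ^ β := fun n hn => by
      have e1 : weylSymbol r β δ ((n + 1 : ℕ) : ℤ) =
          ((((n:ℝ) + 1) ^ r * (2 * sin ((n + 1) * δ / 2)) ^ β : ℝ) : ℂ) *
            Complex.exp (Complex.I * ((π * r / 2 + β * ((n + 1 : ℕ) * δ + π) / 2 : ℝ))) := by
        have hlt : ((n + 1 : ℕ) : ℝ) * δ < 2 * π := by
          push_cast; linarith [hbd n hn, pi_gt_three]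
        have e2 : Complex.exp (Complex.I * ((π * r / 2 + β * ((n + 1 : ℕ) * δ + π) / 2 : ℝ))) =
            Complex.exp (Complex.I * (π * r / 2 : ℝ)) *
              Complex.exp (Complex.I * (β * (((n + 1 : ℕ) * δ : ℝ) + π) / 2)) := by
          rw [← Complex.exp_add]; congr 1; push_cast; ring
        have e3 : ((n:ℝ) + 1) * δ / 2 = ((n + 1 : ℕ) * δ) / 2 := by push_cast; rfl
        rw [weylSymbol_natCast_succ, diffSymbol_eq hβ (by positivity) hlt, Complex.ofReal_mul (((n:ℝ) + 1) ^ r),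
          e2, e3]
        ring
      rw [e1, map_mul, Complex.conj_ofReal, mul_left_comm, exp_I_mul_mul_conj, mul_one,
        Complex.ofReal_re]
    refine ⟨fun n => Complex.exp (Complex.I * ((π * r / 2 + β * (n * δ + π) / 2 : ℝ))),
      fun x => ?_, fun n hn => ?_, ?_⟩
    · have key := enorm_sum_range_mul_exp_le (v := fun _ => 1) (k := k) zero_le_one
        (fun _ _ => le_rfl) (x + β * δ / 2)
      have h3 : ‖trigPoly (fun n => Complex.exp
          (Complex.I * ((π * r / 2 + β * (n * δ + π) / 2 : ℝ)))) k x‖ₑ ≤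
          ‖Complex.exp (Complex.I * ((π * r / 2 + β * π / 2 : ℝ))) *
          ∑ n ∈ Finset.range (k + 1), ((1 : ℝ) : ℂ) *
            Complex.exp (Complex.I * (((n + 1 : ℕ) : ℝ) * (x + β * δ / 2) : ℝ))‖ₑ := by
        rw [trigPoly, ← Complex.re_sum, enorm_le_iff_norm_le]
        refine (Complex.abs_re_le_norm _).trans (le_of_eq ?_)
        congr 1
        rw [Finset.mul_sum]
        refine Finset.sum_congr rfl fun n hn => ?_
        rw [Complex.ofReal_one, one_mul, ← Complex.exp_add, ← Complex.exp_add]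
        congr 1
        push_cast
        ring
      refine h3.trans ?_
      rw [enorm_mul, ← ofReal_norm, norm_exp_I_mul_ofReal, ENNReal.ofReal_one, one_mul]
      refine key.trans ?_
      rw [mul_one]
      gcongr
      exact hlKernel_le_shiftedKernel_consSeq _ _ _ _ _
    · have h1 := hsin n hn
      rw [hre n hn]
      positivity
    · have e : ∀ n ∈ Finset.range (k + 1), (Complex.exp (Complex.I *
          ((π * r / 2 + β * ((n + 1 : ℕ) * δ + π) / 2 : ℝ)))
          * starRingEnd ℂ (weylSymbol r β δ ((n + 1 : ℕ) : ℤ))).re =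
          ((n:ℝ) + 1) ^ r * (2 * sin ((n + 1) * δ / 2)) ^ β := fun n hn =>
        hre n (Nat.lt_succ_iff.mp (Finset.mem_range.mp hn))
      rw [Finset.sum_congr rfl e]
      refine le_trans ?_ (le_sum_rpow_mul_sin_rpow hr hβ hδ hk)
      rw [← hc₂, symbolSize]
      gcongr
      · exact min_le_right _ _
      · exact min_le_right _ _
  · have hre : ∀ n, (Complex.exp (Complex.I * (π * r / 2 : ℝ)) * (-1) ^ j *
          Complex.exp (Complex.I * (j * ((n + 1 : ℕ) * δ) : ℝ)) *
            diffSymbol γ (-((n + 1 : ℕ) * δ))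
        * starRingEnd ℂ (weylSymbol r β δ ((n + 1 : ℕ) : ℤ))).re =
        ((n:ℝ) + 1) ^ r * (2 - 2 * cos ((n + 1) * δ)) ^ j := fun n => by
      have h2 : diffSymbol γ (-((n + 1 : ℕ) * δ)) *
          starRingEnd ℂ (diffSymbol β ((n + 1 : ℕ) * δ)) =
          starRingEnd ℂ (Complex.exp (Complex.I * (j * ((n + 1 : ℕ) * δ) : ℝ))) *
            (((-1) ^ j * (2 - 2 * cos ((n + 1 : ℕ) * δ)) ^ j : ℝ) : ℂ) := by
        rw [diffSymbol_neg, ← map_mul, mul_comm (diffSymbol γ _),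
          diffSymbol_mul_diffSymbol hβ hγ (j := j) (by rw [hγd]; ring), map_mul,
          Complex.conj_ofReal]
        push_cast
        rfl
      have h3 : Complex.exp (Complex.I * (π * r / 2 : ℝ)) * (-1) ^ j *
          Complex.exp (Complex.I * (j * ((n + 1 : ℕ) * δ) : ℝ)) *
            diffSymbol γ (-((n + 1 : ℕ) * δ))
        * starRingEnd ℂ (weylSymbol r β δ ((n + 1 : ℕ) : ℤ)) =
        ((((n:ℝ) + 1) ^ r * (2 - 2 * cos ((n + 1) * δ)) ^ j : ℝ) : ℂ) := by
        rw [weylSymbol_natCast_succ, map_mul, map_mul, Complex.conj_ofReal]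
        have h4 := exp_I_mul_mul_conj (π * r / 2)
        have h5 := exp_I_mul_mul_conj (j * ((n + 1 : ℕ) * δ))
        have h6 : ((-1 : ℂ) ^ j) * (-1) ^ j = 1 := by rw [← mul_pow]; norm_num
        set P := Complex.exp (Complex.I * (π * r / 2 : ℝ))
        set Q := Complex.exp (Complex.I * (j * ((n + 1 : ℕ) * δ) : ℝ))
        set D := diffSymbol γ (-((n + 1 : ℕ) * δ))
        set E := starRingEnd ℂ (diffSymbol β ((n + 1 : ℕ) * δ))
        calc _ = (P * starRingEnd ℂ P) * ((((n:ℝ) + 1) ^ r : ℝ) : ℂ) * ((-1) ^ j * Q * (D * E)) := by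
              ring
          _ = (Q * starRingEnd ℂ Q) * ((-1) ^ j * (-1) ^ j) * ((((n:ℝ) + 1) ^ r : ℝ) : ℂ) *
              (((2 - 2 * cos ((n + 1 : ℕ) * δ)) ^ j : ℝ) : ℂ) := by
              rw [h4, h2, Complex.ofReal_mul]
              push_cast
              ring
          _ = _ := by
              rw [h5, h6]
              push_cast
              ring
      rw [h3, Complex.ofReal_re]
    have hc : Summable fun ν => ‖Complex.exp (Complex.I * (π * r / 2 : ℝ)) * (-1) ^ j *
        (diffCoef γ ν : ℂ)‖ := by
      simpa only [norm_mul, norm_exp_I_mul_ofReal, norm_pow, norm_neg, norm_one, one_pow, one_mul,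
        Complex.norm_real, Real.norm_eq_abs] using summable_abs_diffCoef hγ
    refine ⟨fun n => Complex.exp (Complex.I * (π * r / 2 : ℝ)) * (-1) ^ j *
          Complex.exp (Complex.I * (j * (n * δ) : ℝ)) * diffSymbol γ (-(n * δ)),
      fun x => ?_, fun n hn => ?_, ?_⟩
    · refine (enorm_trigPoly_le (v := fun _ => 1) (s := fun ν => -((γ - ν) * δ - j * δ)) hc
        zero_le_one (fun _ _ => le_rfl) (fun n _ => ?_) x).trans ?_
      · rw [Complex.ofReal_one, one_mul, diffSymbol, ← tsum_mul_left]
        refine tsum_congr fun ν => ?_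
        have : Complex.exp (Complex.I * (((n + 1 : ℕ) : ℝ) * -((γ - ν) * δ - j * δ) : ℝ)) =
            Complex.exp (Complex.I * (j * ((n + 1 : ℕ) * δ) : ℝ)) *
            Complex.exp (Complex.I * ((γ - ν) * ((-((n + 1 : ℕ) * δ) : ℝ) : ℂ))) := by
          rw [← Complex.exp_add]; congr 1; push_cast; ring
        rw [this]
        ring
      · rw [mul_one]
        gcongr
        refine le_trans (le_of_eq ?_) (shiftedKernel_le_shiftedKernel_consSeq _ _ _ _ _)
        congr 1
        ext ν
        rw [enorm_mul, enorm_mul, ← ofReal_norm (Complex.exp _), norm_exp_I_mul_ofReal,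
          ENNReal.ofReal_one, one_mul, enorm_pow, enorm_neg, enorm_one, one_pow, one_mul]
    · rw [hre n]
      have := cos_le_one (((n:ℝ) + 1) * δ)
      have : 0 ≤ 2 - 2 * cos (((n:ℝ) + 1) * δ) := by linarith
      positivity
    · rw [Finset.sum_congr rfl fun n _ => hre n]
      refine le_trans ?_ (le_sum_rpow_mul_cos_pow hr j hδ hδ2 hk)
      rw [← hc₁]
      have h1 : symbolSize r β δ k ≤ ((k:ℝ) + 1) ^ r := by
        rw [symbolSize]
        exact mul_le_of_le_one_right (by positivity)
          (rpow_le_one hmin0 (min_le_left _ _) hβ.le)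
      gcongr
      exact min_le_left _ _

theorem ENNReal.tsum_mul_sum_range (F w : ℕ → ℝ≥0∞) :
    ∑' k, F k * ∑ i ∈ Finset.range (k + 1), w i = ∑' i, w i * ∑' k, F (i + k) := by
  have h1 : ∀ k, F k * ∑ i ∈ Finset.range (k + 1), w i =
      ∑' i, w i * (if i ≤ k then F k else 0) := fun k => by
    rw [Finset.mul_sum, tsum_eq_sum (s := Finset.range (k + 1))]
    · refine Finset.sum_congr rfl fun i hi => ?_
      rw [if_pos (Nat.lt_succ_iff.mp (Finset.mem_range.mp hi)), mul_comm]
    · intro i hi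
      rw [if_neg (fun h => hi (Finset.mem_range.mpr (Nat.lt_succ_of_le h))), mul_zero]
  simp_rw [h1]
  rw [ENNReal.tsum_comm]
  refine tsum_congr fun i => ?_
  rw [ENNReal.tsum_mul_left]
  congr 1
  rw [← ENNReal.summable.sum_add_tsum_nat_add' (k := i), Finset.sum_eq_zero, zero_add]
  · exact tsum_congr fun k => by rw [if_pos (Nat.le_add_left _ _), add_comm]
  · exact fun k hk => if_neg (by have := Finset.mem_range.mp hk; omega)

theorem ENNReal.tsum_tsum_mul_le_of_sum_range {Δ : ℕ → ℕ → ℝ≥0∞} {A B w v : ℕ → ℝ≥0∞}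
    {C D : ℝ≥0∞} (hA : ∀ k, A k ≤ C * ∑ i ∈ Finset.range (k + 1), w i)
    (hB : ∀ l, B l ≤ D * ∑ j ∈ Finset.range (l + 1), v j) :
    ∑' k, ∑' l, Δ k l * (A k * B l) ≤
      C * D * ∑' i, ∑' j, w i * v j * ∑' k, ∑' l, Δ (i + k) (j + l) := by
  calc ∑' k, ∑' l, Δ k l * (A k * B l)
      ≤ ∑' k, ∑' l, Δ k l * ((C * ∑ i ∈ Finset.range (k + 1), w i) *
          (D * ∑ j ∈ Finset.range (l + 1), v j)) := by
        gcongr with k l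
        · exact hA k
        · exact hB l
    _ = C * D * ∑' k, (∑' l, Δ k l * ∑ j ∈ Finset.range (l + 1), v j) *
          ∑ i ∈ Finset.range (k + 1), w i := by
        simp_rw [← ENNReal.tsum_mul_left, ← ENNReal.tsum_mul_right, ← ENNReal.tsum_mul_left]
        refine tsum_congr fun k => tsum_congr fun l => ?_
        ring
    _ = _ := by
        rw [ENNReal.tsum_mul_sum_range]
        congr 1
        refine tsum_congr fun i => ?_
        simp_rw [ENNReal.tsum_mul_sum_range]
        rw [ENNReal.tsum_comm, ← ENNReal.tsum_mul_left]
        refine tsum_congr fun j => ?_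
        rw [ENNReal.tsum_mul_left, mul_assoc]

/-- A doubling weight times an antitone sequence is controlled by its partial sums. -/
theorem ENNReal.mul_le_sum_range_of_doubling {lam κ : ℕ → ℝ≥0∞} {D : ℝ≥0∞}
    (hlam : ∀ i k, i ≤ k → k ≤ 2 * i + 1 → lam k ≤ D * lam i) (hκ : Antitone κ) (k : ℕ) :
    ((k:ℝ≥0∞) + 1) * lam k * κ k ≤ 2 * D * ∑ i ∈ Finset.range (k + 1), lam i * κ i := by
  have h1 : ∀ i ∈ Finset.Ico (k / 2) (k + 1), lam k * κ k ≤ D * (lam i * κ i) := fun i hi => by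
    rw [Finset.mem_Ico] at hi
    rw [← mul_assoc]
    gcongr
    · exact hlam i k (by omega) (by omega)
    · exact hκ (by omega)
  have h2 := Finset.card_nsmul_le_sum _ _ _ h1
  rw [Nat.card_Ico, nsmul_eq_mul, ← Finset.mul_sum] at h2
  have h3 : ((k:ℝ≥0∞) + 1) ≤ 2 * ((k + 1 - k / 2 : ℕ) : ℝ≥0∞) := by
    have : k + 1 ≤ 2 * (k + 1 - k / 2) := by omega
    exact_mod_cast this
  have hsub : Finset.Ico (k / 2) (k + 1) ⊆ Finset.range (k + 1) := fun n hn => by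
    rw [Finset.mem_Ico] at hn; exact Finset.mem_range.mpr hn.2
  calc ((k:ℝ≥0∞) + 1) * lam k * κ k ≤ 2 * ((k + 1 - k / 2 : ℕ) : ℝ≥0∞) * lam k * κ k := by gcongr
    _ = 2 * (((k + 1 - k / 2 : ℕ) : ℝ≥0∞) * (lam k * κ k)) := by ring
    _ ≤ 2 * (D * ∑ i ∈ Finset.Ico (k / 2) (k + 1), lam i * κ i) := by gcongr
    _ ≤ 2 * (D * ∑ i ∈ Finset.range (k + 1), lam i * κ i) := by gcongr
    _ = _ := by ring

theorem hlKernel_antitone (x : ℝ) : Antitone fun k => hlKernel k x := fun i j hij => by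
  simp only [hlKernel]
  refine ENNReal.ofReal_le_ofReal ?_
  rw [hlProfile_comm, hlProfile_comm ((i:ℝ) + 1)]
  refine hlProfile_anti (abs_nonneg _) ?_
  have : (i:ℝ) ≤ j := by exact_mod_cast hij
  linarith

theorem shiftedKernel_antitone (e : ℕ → ℝ≥0∞) (s : ℕ → ℝ) (x : ℝ) :
    Antitone fun k => shiftedKernel e s k x := fun i j hij => by
  simp only [shiftedKernel]
  gcongr with ν
  exact hlKernel_antitone _ hij

theorem symbolSize_doubling {r β δ : ℝ} (hr : 0 ≤ r) (hβ : 0 < β) (hδ : 0 ≤ δ) {i k : ℕ}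
    (h2 : k ≤ 2 * i + 1) :
    symbolSize r β δ k ≤ 2 ^ r * 2 ^ β * symbolSize r β δ i := by
  have hk : (k:ℝ) + 1 ≤ 2 * (i + 1) := by
    have : k + 1 ≤ 2 * (i + 1) := by omega
    exact_mod_cast this
  have h1 : ((k:ℝ) + 1) ^ r ≤ 2 ^ r * ((i:ℝ) + 1) ^ r := by
    rw [← mul_rpow (by norm_num) (by positivity)]
    gcongr
  have h3 : (min 1 (((k:ℝ) + 1) * δ)) ^ β ≤ 2 ^ β * (min 1 (((i:ℝ) + 1) * δ)) ^ β := by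
    rw [← mul_rpow (by norm_num) (le_min zero_le_one (by positivity))]
    refine rpow_le_rpow (le_min zero_le_one (by positivity)) ?_ hβ.le
    rw [mul_min_of_nonneg _ _ (by norm_num)]
    refine min_le_min (by norm_num) ?_
    nlinarith
  have hm : 0 ≤ (min 1 (((k:ℝ) + 1) * δ)) ^ β :=
    rpow_nonneg (le_min zero_le_one (by positivity)) _
  unfold symbolSize
  calc _ ≤ (2 ^ r * ((i:ℝ) + 1) ^ r) * (2 ^ β * (min 1 (((i:ℝ) + 1) * δ)) ^ β) := by gcongr
    _ = _ := by ring

/-- The weighted `ℓ^p` sum of the coefficients that characterizes the modulus of smoothness. -/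
def coefSum (p r₁ β₁ δ₁ r₂ β₂ δ₂ : ℝ) (α : ℕ → ℕ → ℝ≥0∞) : ℝ≥0∞ :=
  ∑' k : ℕ, ∑' l : ℕ, (α k l *
    (ENNReal.ofReal (symbolSize r₁ β₁ δ₁ k) * ENNReal.ofReal (symbolSize r₂ β₂ δ₂ l))) ^ p *
      (((k:ℝ≥0∞) + 1) ^ (p - 2) * ((l:ℝ≥0∞) + 1) ^ (p - 2))

/-- `L_p` bound for a superposition of products of kernels. -/
theorem lintegral_kernel_superposition_le {p : ℝ} (hp : 1 < p) {r₁ β₁ r₂ β₂ : ℝ} (hr₁ : 0 ≤ r₁)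
    (hβ₁ : 0 < β₁) (hr₂ : 0 ≤ r₂) (hβ₂ : 0 < β₂) {e₁ e₂ : ℕ → ℝ≥0∞} (he₁ : ∑' ν, e₁ ν ≠ ⊤)
    (he₂ : ∑' ν, e₂ ν ≠ ⊤) :
    ∃ C : ℝ≥0∞, C ≠ ⊤ ∧ ∀ (δ₁ δ₂ : ℝ) (s₁ s₂ : ℕ → ℝ) (Δ : ℕ → ℕ → ℝ≥0∞), 0 ≤ δ₁ → 0 ≤ δ₂ →
      ∫⁻ x in Set.Ioc (0:ℝ) (2 * π), ∫⁻ y in Set.Ioc (0:ℝ) (2 * π),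
        (∑' k : ℕ, ∑' l : ℕ, Δ k l *
          ((ENNReal.ofReal (2 * symbolSize r₁ β₁ δ₁ k * (k + 1)) * shiftedKernel e₁ s₁ k x) *
          (ENNReal.ofReal (2 * symbolSize r₂ β₂ δ₂ l * (l + 1)) * shiftedKernel e₂ s₂ l y))) ^ p ≤
      C * coefSum p r₁ β₁ δ₁ r₂ β₂ δ₂ (fun i j => ∑' k, ∑' l, Δ (i + k) (j + l)) := by
  set D₁ : ℝ≥0∞ := 2 * (2 * ENNReal.ofReal (2 ^ r₁ * 2 ^ β₁)) with hD₁
  set D₂ : ℝ≥0∞ := 2 * (2 * ENNReal.ofReal (2 ^ r₂ * 2 ^ β₂)) with hD₂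
  set C₁ : ℝ≥0∞ := (∑' ν, e₁ ν) ^ p * ENNReal.ofReal (hlConst' p) with hC₁
  set C₂ : ℝ≥0∞ := (∑' ν, e₂ ν) ^ p * ENNReal.ofReal (hlConst' p) with hC₂
  have hp0 : 0 ≤ p := by linarith
  refine ⟨(D₁ * D₂) ^ p * (C₁ * C₂), ?_, fun δ₁ δ₂ s₁ s₂ Δ hδ₁ hδ₂ => ?_⟩
  · refine ENNReal.mul_ne_top (ENNReal.rpow_ne_top_of_nonneg hp0 ?_) (ENNReal.mul_ne_top ?_ ?_)
    · exact ENNReal.mul_ne_top (by finiteness) (by finiteness)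
    · exact ENNReal.mul_ne_top (ENNReal.rpow_ne_top_of_nonneg hp0 he₁) (by finiteness)
    · exact ENNReal.mul_ne_top (ENNReal.rpow_ne_top_of_nonneg hp0 he₂) (by finiteness)
  have key : ∀ {r β δ : ℝ} {e : ℕ → ℝ≥0∞} {s : ℕ → ℝ}, 0 ≤ r → 0 < β → 0 ≤ δ → ∀ (k : ℕ) (x : ℝ),
      ENNReal.ofReal (2 * symbolSize r β δ k * (k + 1)) * shiftedKernel e s k x ≤
      2 * (2 * ENNReal.ofReal (2 ^ r * 2 ^ β)) * ∑ i ∈ Finset.range (k + 1),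
        ENNReal.ofReal (symbolSize r β δ i) * shiftedKernel e s i x := by
    intro r β δ e s hr hβ hδ k x
    have h1 := ENNReal.mul_le_sum_range_of_doubling
      (lam := fun k => ENNReal.ofReal (symbolSize r β δ k)) (D := ENNReal.ofReal (2 ^ r * 2 ^ β))
      (fun i k _ h2 => by
        rw [← ENNReal.ofReal_mul (by positivity)]
        exact ENNReal.ofReal_le_ofReal (symbolSize_doubling hr hβ hδ h2))
      (shiftedKernel_antitone e s x) k
    have h2 : ENNReal.ofReal (2 * symbolSize r β δ k * (k + 1)) =
        2 * (((k:ℝ≥0∞) + 1) * ENNReal.ofReal (symbolSize r β δ k)) := by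
      have := symbolSize_nonneg r β hδ k
      rw [ENNReal.ofReal_mul (by positivity), ENNReal.ofReal_mul (by positivity),
        ENNReal.ofReal_add (by positivity) zero_le_one]
      simp
      ring
    rw [h2, mul_assoc 2, mul_assoc 2]
    gcongr
  have hpt : ∀ x y, ∑' k : ℕ, ∑' l : ℕ, Δ k l *
          ((ENNReal.ofReal (2 * symbolSize r₁ β₁ δ₁ k * (k + 1)) * shiftedKernel e₁ s₁ k x) *
          (ENNReal.ofReal (2 * symbolSize r₂ β₂ δ₂ l * (l + 1)) * shiftedKernel e₂ s₂ l y)) ≤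
      D₁ * D₂ * ∑' i : ℕ, ∑' j : ℕ, shiftedKernel e₁ s₁ i x * shiftedKernel e₂ s₂ j y *
        ((∑' k, ∑' l, Δ (i + k) (j + l)) * (ENNReal.ofReal (symbolSize r₁ β₁ δ₁ i) *
          ENNReal.ofReal (symbolSize r₂ β₂ δ₂ j))) := fun x y => by
    refine (ENNReal.tsum_tsum_mul_le_of_sum_range (fun k => key hr₁ hβ₁ hδ₁ k x)
      (fun l => key hr₂ hβ₂ hδ₂ l y)).trans (le_of_eq ?_)
    congr 1
    refine tsum_congr fun i => tsum_congr fun j => ?_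
    ring
  refine (lintegral_mono fun x => lintegral_mono fun y =>
    ENNReal.rpow_le_rpow (hpt x y) hp0).trans ?_
  have hfin : (D₁ * D₂) ^ p ≠ ⊤ :=
    ENNReal.rpow_ne_top_of_nonneg hp0 (ENNReal.mul_ne_top (by finiteness) (by finiteness))
  have hprod := HLBound.prod (hlBound_shiftedKernel hp e₁ s₁) (hlBound_shiftedKernel hp e₂ s₂)
    (fun k => measurable_shiftedKernel e₁ s₁ k)
    (fun i j => (∑' k, ∑' l, Δ (i + k) (j + l)) * (ENNReal.ofReal (symbolSize r₁ β₁ δ₁ i) *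
          ENNReal.ofReal (symbolSize r₂ β₂ δ₂ j)))
  simp_rw [ENNReal.mul_rpow_of_nonneg (D₁ * D₂) _ hp0, lintegral_const_mul' _ _ hfin]
  rw [mul_assoc ((D₁ * D₂) ^ p)]
  exact mul_le_mul' le_rfl hprod

/-- Lebesgue measure on one period. -/
abbrev periodMeasure : Measure ℝ := volume.restrict (Set.Ioc (0:ℝ) (2 * π))

/-- The character `x ↦ exp (-i n x)`. -/
def negChar (n : ℤ) (x : ℝ) : ℂ := Complex.exp (-Complex.I * ((n:ℂ) * (x:ℂ)))

theorem continuous_negChar (n : ℤ) : Continuous (negChar n) := by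
  unfold negChar; fun_prop

theorem norm_negChar (n : ℤ) (x : ℝ) : ‖negChar n x‖ = 1 := by
  have : -Complex.I * ((n:ℂ) * (x:ℂ)) = ((-(n * x) : ℝ) : ℂ) * Complex.I := by push_cast; ring
  rw [negChar, this, Complex.norm_exp_ofReal_mul_I]

theorem negChar_add (n : ℤ) (x s : ℝ) : negChar n (x + s) = negChar n x * negChar n s := by
  rw [negChar, negChar, negChar, ← Complex.exp_add]
  congr 1; push_cast; ring

theorem negChar_periodic (n : ℤ) : Function.Periodic (negChar n) (2 * π) := fun x => by
  rw [negChar_add]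
  have : negChar n (2 * π) = 1 := by
    rw [negChar, Complex.exp_eq_one_iff]
    exact ⟨-n, by push_cast; ring⟩
  rw [this, mul_one]

/-- An integrable function on a period with vanishing Fourier coefficients is zero a.e. -/
theorem ae_eq_zero_of_integral_mul_negChar_eq_zero {G : ℝ → ℂ} (hG : Integrable G periodMeasure)
    (h : ∀ n : ℤ, ∫ x, G x * negChar n x ∂periodMeasure = 0) : G =ᵐ[periodMeasure] 0 := by
  have : Fact (0 < 2 * π) := ⟨Real.two_pi_pos⟩
  have h_int : ∀ φ : C(AddCircle (2 * π), ℂ),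
      Integrable (fun x : ℝ => G x * φ (x : AddCircle (2 * π))) periodMeasure := fun φ =>
    hG.mul_bdd (c := ‖φ‖) (φ.continuous.comp (AddCircle.continuous_mk' _)).aestronglyMeasurable
      (Filter.Eventually.of_forall fun x => φ.norm_coe_le_norm _)
  let L₀ : C(AddCircle (2 * π), ℂ) →ₗ[ℂ] ℂ :=
    { toFun := fun φ => ∫ x : ℝ, G x * φ (x : AddCircle (2 * π)) ∂periodMeasure
      map_add' := fun φ ψ => by
        rw [← integral_add (h_int φ) (h_int ψ)]
        simp [mul_add]
      map_smul' := fun c φ => by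
        simp only [ContinuousMap.smul_apply, smul_eq_mul, RingHom.id_apply]
        rw [← integral_const_mul]
        congr 1; ext x; ring }
  let L : C(AddCircle (2 * π), ℂ) →L[ℂ] ℂ := L₀.mkContinuous (∫ x, ‖G x‖ ∂periodMeasure) fun φ => by
    change ‖∫ x : ℝ, G x * φ (x : AddCircle (2 * π)) ∂periodMeasure‖ ≤ _
    rw [← integral_mul_const]
    refine norm_integral_le_of_norm_le (hG.norm.mul_const _)
      (Filter.Eventually.of_forall fun x => ?_)
    rw [norm_mul]
    exact mul_le_mul_of_nonneg_left (φ.norm_coe_le_norm _) (norm_nonneg _)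
  have hL : ∀ φ, L φ = 0 := by
    have hker : (⊤ : Submodule ℂ C(AddCircle (2 * π), ℂ)) ≤ L.ker := by
      rw [← span_fourier_closure_eq_top]
      refine Submodule.topologicalClosure_minimal _ ?_ L.isClosed_ker
      rw [Submodule.span_le]
      rintro _ ⟨n, rfl⟩
      change ∫ x : ℝ, G x * fourier n (x : AddCircle (2 * π)) ∂periodMeasure = 0
      rw [← h (-n)]
      congr 1; ext x
      rw [fourier_coe_apply, negChar]
      congr 2
      have : (π:ℂ) ≠ 0 := by exact_mod_cast pi_ne_zero
      push_cast
      field_simp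
    exact fun φ => hker (Submodule.mem_top)
  have hloc : LocallyIntegrableOn G (Set.Ioo 0 (2 * π)) volume :=
    (IntegrableOn.mono_set hG Set.Ioo_subset_Ioc_self).locallyIntegrableOn
  have key := isOpen_Ioo.ae_eq_zero_of_integral_contDiff_smul_eq_zero hloc fun g hg _ hgs => by
    have hg0 : ∀ x, x ∉ Set.Ioo 0 (2 * π) → g x = 0 := fun x hx =>
      image_eq_zero_of_notMem_tsupport fun hh => hx (hgs hh)
    have hcont : Continuous (AddCircle.liftIco (2 * π) 0 fun x => ((g x : ℝ) : ℂ)) := by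
      refine AddCircle.liftIco_continuous ?_ (Complex.continuous_ofReal.comp hg.continuous).continuousOn
      rw [hg0 0 (by simp), hg0 (0 + 2 * π) (by simp)]
    have h0 := hL ⟨_, hcont⟩
    change ∫ x : ℝ, G x * AddCircle.liftIco (2 * π) 0 (fun x => ((g x : ℝ) : ℂ)) x
      ∂periodMeasure = 0 at h0
    rw [← h0, ← setIntegral_eq_integral_of_forall_compl_eq_zero (s := Set.Ioc 0 (2 * π))
      (f := fun x => g x • G x), ← integral_Ico_eq_integral_Ioc, ← integral_Ico_eq_integral_Ioc]
    · refine setIntegral_congr_fun measurableSet_Ico fun x hx => ?_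
      rw [AddCircle.liftIco_zero_coe_apply hx, Complex.real_smul, mul_comm]
    · intro x hx
      simp [hg0 x fun hh => hx (Set.Ioo_subset_Ioc_self hh)]
  rw [Filter.EventuallyEq, periodMeasure, ← restrict_Ioo_eq_restrict_Ioc, ae_restrict_iff' measurableSet_Ioo]
  exact key

/-- Measurable functions on the plane, `2π`-periodic in each variable and integrable over a
period square. -/
structure PeriodicIntegrable (f : ℝ → ℝ → ℝ) : Prop where
  meas : Measurable (Function.uncurry f)
  periodic_x : ∀ y, Function.Periodic (fun x => f x y) (2 * π)
  periodic_y : ∀ x, Function.Periodic (f x) (2 * π)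
  integrable : Integrable (Function.uncurry f) (periodMeasure.prod periodMeasure)

/-- Unnormalized Fourier coefficients over the period square. -/
def squareCoef (f : ℝ → ℝ → ℝ) (n m : ℤ) : ℂ :=
  ∫ z, (f z.1 z.2 : ℂ) * (negChar n z.1 * negChar m z.2) ∂(periodMeasure.prod periodMeasure)

theorem measurable_negChar_mul (n m : ℤ) :
    Measurable fun z : ℝ × ℝ => negChar n z.1 * negChar m z.2 :=
  (((continuous_negChar n).comp continuous_fst).mul
    ((continuous_negChar m).comp continuous_snd)).measurable

theorem MeasureTheory.Integrable.mul_negChar_mul {F : ℝ × ℝ → ℂ} {μ : Measure (ℝ × ℝ)}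
    (hF : Integrable F μ) (n m : ℤ) :
    Integrable (fun z => F z * (negChar n z.1 * negChar m z.2)) μ :=
  hF.mul_bdd (c := 1) (measurable_negChar_mul n m).aestronglyMeasurable
    (Filter.Eventually.of_forall fun z => by simp [norm_negChar])

theorem enorm_mul_negChar_mul (c : ℝ) (n m : ℤ) (z : ℝ × ℝ) :
    ‖(c:ℂ) * (negChar n z.1 * negChar m z.2)‖ₑ = ‖c‖ₑ := by
  rw [enorm_mul, enorm_mul, ← ofReal_norm (negChar _ _), ← ofReal_norm (negChar m _),
    norm_negChar, norm_negChar, ← ofReal_norm (c:ℂ), Complex.norm_real, ofReal_norm]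
  simp

theorem tsum_enorm_ne_top_of_summable_abs {c : ℕ → ℝ} (hc : Summable fun ν => |c ν|) :
    ∑' ν, ‖c ν‖ₑ ≠ ⊤ := by
  have := hc.tsum_ofReal_ne_top
  simpa [Real.enorm_eq_ofReal_abs] using this

namespace PeriodicIntegrable

variable {f g : ℝ → ℝ → ℝ}

theorem integrable_mul_negChar (hf : PeriodicIntegrable f) (n m : ℤ) :
    Integrable (fun z : ℝ × ℝ => (f z.1 z.2 : ℂ) * (negChar n z.1 * negChar m z.2))
      (periodMeasure.prod periodMeasure) :=
  (hf.integrable.ofReal (𝕜 := ℂ)).mul_negChar_mul n m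

theorem swap (hf : PeriodicIntegrable f) : PeriodicIntegrable fun x y => f y x where
  meas := hf.meas.comp measurable_swap
  periodic_x := hf.periodic_y
  periodic_y := hf.periodic_x
  integrable := hf.integrable.swap

theorem squareCoef_swap (f : ℝ → ℝ → ℝ) (n m : ℤ) :
    squareCoef (fun x y => f y x) n m = squareCoef f m n := by
  unfold squareCoef
  rw [← integral_prod_swap]
  simp only [Prod.fst_swap, Prod.snd_swap, mul_comm]

theorem lintegral_comp_add (hf : PeriodicIntegrable f) (s : ℝ) :
    ∫⁻ z, ‖f (z.1 + s) z.2‖ₑ ∂(periodMeasure.prod periodMeasure) =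
      ∫⁻ z, ‖f z.1 z.2‖ₑ ∂(periodMeasure.prod periodMeasure) := by
  have h1 : Measurable fun z : ℝ × ℝ => ‖f z.1 z.2‖ₑ := hf.meas.enorm
  have h2 : Measurable fun z : ℝ × ℝ => ‖f (z.1 + s) z.2‖ₑ :=
    h1.comp (Measurable.prodMk (measurable_fst.add_const s) measurable_snd)
  rw [lintegral_prod_symm _ h1.aemeasurable, lintegral_prod_symm _ h2.aemeasurable]
  refine lintegral_congr fun y => ?_
  exact setLIntegral_Ioc_comp_add_of_periodic (F := fun x => ‖f x y‖ₑ)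
    (fun x => by simp only [hf.periodic_x y x]) s

theorem comp_add (hf : PeriodicIntegrable f) (s : ℝ) :
    PeriodicIntegrable fun x y => f (x + s) y where
  meas := hf.meas.comp (Measurable.prodMk (measurable_fst.add_const s) measurable_snd)
  periodic_x y x := by
    have := hf.periodic_x y (x + s)
    simp only at this ⊢
    rw [← this]; congr 1; ring
  periodic_y x := hf.periodic_y _
  integrable := by
    refine ⟨(hf.meas.comp (Measurable.prodMk (measurable_fst.add_const s)
      measurable_snd)).aestronglyMeasurable, ?_⟩
    have := hf.integrable.2
    rw [HasFiniteIntegral] at this ⊢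
    exact (hf.lintegral_comp_add s).trans_lt this

theorem squareCoef_comp_add (hf : PeriodicIntegrable f) (s : ℝ) (n m : ℤ) :
    squareCoef (fun x y => f (x + s) y) n m = negChar n (-s) * squareCoef f n m := by
  unfold squareCoef
  rw [integral_prod_symm _ ((hf.comp_add s).integrable_mul_negChar n m),
    integral_prod_symm _ (hf.integrable_mul_negChar n m), ← integral_const_mul]
  refine integral_congr_ae (Filter.Eventually.of_forall fun y => ?_)
  simp only [periodMeasure]
  rw [← integral_const_mul]
  rw [← intervalIntegral.integral_of_le Real.two_pi_pos.le,
    ← intervalIntegral.integral_of_le Real.two_pi_pos.le]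
  set G : ℝ → ℂ := fun x => negChar n (-s) * (f x y * (negChar n x * negChar m y)) with hG
  have hper : Function.Periodic G (2 * π) := fun x => by
    have := hf.periodic_x y x
    simp only at this
    simp only [hG, this, negChar_periodic n x]
  have h1 : ∀ x, (f (x + s) y : ℂ) * (negChar n x * negChar m y) = G (x + s) := fun x => by
    have : negChar n x = negChar n (-s) * negChar n (x + s) := by
      rw [← negChar_add, neg_add_cancel_comm_assoc]
    simp only [hG]
    rw [this]; ring
  simp_rw [h1]
  rw [intervalIntegral.integral_comp_add_right, zero_add, add_comm, hper.intervalIntegral_add_eq s 0,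
    zero_add]

/-- Absolutely convergent series of periodic integrable functions. -/
theorem tsum {ι : Type*} [Countable ι] {F : ι → ℝ → ℝ → ℝ} (hF : ∀ i, PeriodicIntegrable (F i))
    (hs : ∑' i, ∫⁻ z, ‖F i z.1 z.2‖ₑ ∂(periodMeasure.prod periodMeasure) ≠ ⊤) :
    PeriodicIntegrable (fun x y => ∑' i, F i x y) ∧
      ∀ n m, squareCoef (fun x y => ∑' i, F i x y) n m = ∑' i, squareCoef (F i) n m := by
  have hm : Measurable (Function.uncurry fun x y => ∑' i, F i x y) :=
    Measurable.tsum fun i => (hF i).meas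
  refine ⟨⟨hm, fun y x => tsum_congr fun i => (hF i).periodic_x y x,
    fun x y => tsum_congr fun i => (hF i).periodic_y x y, hm.aestronglyMeasurable, ?_⟩,
    fun n m => ?_⟩
  · rw [HasFiniteIntegral]
    refine lt_of_le_of_lt (lintegral_mono fun z => enorm_tsum_le_tsum_enorm) ?_
    have := lintegral_tsum (μ := periodMeasure.prod periodMeasure)
      fun i => (hF i).meas.enorm.aemeasurable
    exact lt_of_eq_of_lt this hs.lt_top
  · unfold squareCoef
    simp_rw [Complex.ofReal_tsum, ← tsum_mul_right]
    refine integral_tsum (fun i => ((hF i).integrable_mul_negChar n m).1) ?_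
    simp_rw [enorm_mul_negChar_mul]
    exact hs

theorem const_mul (hf : PeriodicIntegrable f) (c : ℝ) :
    PeriodicIntegrable fun x y => c * f x y where
  meas := hf.meas.const_mul c
  periodic_x y x := congrArg (c * ·) (hf.periodic_x y x)
  periodic_y x y := congrArg (c * ·) (hf.periodic_y x y)
  integrable := hf.integrable.const_mul c

theorem squareCoef_const_mul (f : ℝ → ℝ → ℝ) (c : ℝ) (n m : ℤ) :
    squareCoef (fun x y => c * f x y) n m = c * squareCoef f n m := by
  unfold squareCoef
  rw [← integral_const_mul]
  simp only [Complex.ofReal_mul, mul_assoc]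

/-- Fractional differences preserve periodic integrable functions and act on Fourier
coefficients by their symbol. -/
theorem diffX_and_squareCoef (hf : PeriodicIntegrable f) {α : ℝ} (hα : 0 < α) (h : ℝ) :
    PeriodicIntegrable (diffX α h f) ∧
      ∀ n m, squareCoef (diffX α h f) n m = diffSymbol α (n * h) * squareCoef f n m := by
  have hs : ∑' ν : ℕ, ∫⁻ z, ‖diffCoef α ν * f (z.1 + (α - (ν:ℝ)) * h) z.2‖ₑ
      ∂(periodMeasure.prod periodMeasure) ≠ ⊤ := by
    simp_rw [enorm_mul, lintegral_const_mul' _ _ enorm_ne_top, hf.lintegral_comp_add]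
    rw [ENNReal.tsum_mul_right]
    refine ENNReal.mul_ne_top ?_ hf.integrable.2.ne
    exact tsum_enorm_ne_top_of_summable_abs (summable_abs_diffCoef hα)
  have key := tsum (fun ν : ℕ => (hf.comp_add ((α - (ν:ℝ)) * h)).const_mul (diffCoef α ν)) hs
  refine ⟨key.1, fun n m => (key.2 n m).trans ?_⟩
  rw [diffSymbol, ← tsum_mul_right]
  refine tsum_congr fun ν => ?_
  rw [squareCoef_const_mul, hf.squareCoef_comp_add, ← mul_assoc]
  congr 2
  rw [negChar]
  congr 1
  push_cast
  ring

theorem diffY_and_squareCoef (hf : PeriodicIntegrable f) {α : ℝ} (hα : 0 < α) (h : ℝ) :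
    PeriodicIntegrable (diffY α h f) ∧
      ∀ n m, squareCoef (diffY α h f) n m = diffSymbol α (m * h) * squareCoef f n m := by
  have key := hf.swap.diffX_and_squareCoef hα h
  refine ⟨key.1.swap, fun n m => ?_⟩
  have h1 := squareCoef_swap (diffX α h fun x y => f y x) n m
  rw [key.2] at h1
  rw [← squareCoef_swap f]
  exact h1

theorem ae_eq_zero_of_squareCoef_eq_zero (hf : PeriodicIntegrable f)
    (h : ∀ n m, squareCoef f n m = 0) :
    Function.uncurry f =ᵐ[periodMeasure.prod periodMeasure] 0 := by
  have hfc := hf.integrable.ofReal (𝕜 := ℂ)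
  have h1 : ∀ m : ℤ, ∀ᵐ x ∂periodMeasure, ∫ y, (f x y : ℂ) * negChar m y ∂periodMeasure = 0 := by
    intro m
    have hi : Integrable (fun z : ℝ × ℝ => (f z.1 z.2 : ℂ) * negChar m z.2)
        (periodMeasure.prod periodMeasure) := by
      simpa [negChar, Function.uncurry_def] using hfc.mul_negChar_mul 0 m
    refine ae_eq_zero_of_integral_mul_negChar_eq_zero hi.integral_prod_left fun n => ?_
    rw [← h n m, squareCoef, integral_prod _ (hf.integrable_mul_negChar n m)]
    refine integral_congr_ae (Filter.Eventually.of_forall fun x => ?_)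
    simp only
    rw [← integral_mul_const]
    refine integral_congr_ae (Filter.Eventually.of_forall fun y => ?_)
    simp only
    ring
  have h2 : ∀ᵐ x ∂periodMeasure, ∀ᵐ y ∂periodMeasure, f x y = 0 := by
    filter_upwards [ae_all_iff.mpr h1, hfc.prod_right_ae] with x hx hxi
    filter_upwards [ae_eq_zero_of_integral_mul_negChar_eq_zero hxi hx] with y hy
    simpa using hy
  exact (Measure.ae_prod_iff_ae_ae (hf.meas (measurableSet_singleton 0))).mpr h2

theorem ae_eq_of_squareCoef_eq (hf : PeriodicIntegrable f) (hg : PeriodicIntegrable g)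
    (h : ∀ n m, squareCoef f n m = squareCoef g n m) :
    Function.uncurry f =ᵐ[periodMeasure.prod periodMeasure] Function.uncurry g := by
  have hsub : PeriodicIntegrable fun x y => f x y - g x y :=
    ⟨hf.meas.sub hg.meas, fun y x => congrArg₂ (· - ·) (hf.periodic_x y x) (hg.periodic_x y x),
      fun x y => congrArg₂ (· - ·) (hf.periodic_y x y) (hg.periodic_y x y),
      hf.integrable.sub hg.integrable⟩
  have key := hsub.ae_eq_zero_of_squareCoef_eq_zero fun n m => by
    unfold squareCoef at h ⊢
    simp_rw [Complex.ofReal_sub, sub_mul]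
    rw [integral_sub (hf.integrable_mul_negChar n m) (hg.integrable_mul_negChar n m), h, sub_self]
  filter_upwards [key] with z hz
  exact sub_eq_zero.mp hz

theorem fourierCoefZ_eq (hf : PeriodicIntegrable f) (n m : ℤ) :
    fourierCoefZ f n m = (((2 * π) ^ 2)⁻¹ : ℝ) * squareCoef f n m := by
  rw [fourierCoefZ, squareCoef, integral_prod _ (hf.integrable_mul_negChar n m),
    intervalIntegral.integral_of_le Real.two_pi_pos.le]
  simp_rw [intervalIntegral.integral_of_le Real.two_pi_pos.le]
  congr 2; ext x; congr 1; ext y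
  rw [negChar, negChar, ← Complex.exp_add, mul_add]

end PeriodicIntegrable

open ComplexConjugate in
/-- Extension of a sequence of multipliers on positive frequencies to a Hermitian symmetric
multiplier on all integers, vanishing at zero. -/
def hermExt (ρ : ℕ → ℂ) (n : ℤ) : ℂ :=
  if 0 < n then ρ n.natAbs else if n < 0 then conj (ρ n.natAbs) else 0

theorem continuous_trigPoly (ρ : ℕ → ℂ) (k : ℕ) : Continuous (trigPoly ρ k) := by
  unfold trigPoly; fun_prop

theorem trigPoly_periodic (ρ : ℕ → ℂ) (k : ℕ) : Function.Periodic (trigPoly ρ k) (2 * π) :=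
  fun x => by
    unfold trigPoly
    refine Finset.sum_congr rfl fun n _ => ?_
    have : Complex.I * ((((n + 1 : ℕ) : ℝ) * (x + 2 * π) : ℝ) : ℂ) =
        Complex.I * ((((n + 1 : ℕ) : ℝ) * x : ℝ) : ℂ) + (n + 1 : ℕ) * (2 * π * Complex.I) := by
      push_cast; ring
    rw [this, Complex.exp_add, Complex.exp_nat_mul_two_pi_mul_I, mul_one]

theorem integral_negChar (n : ℤ) :
    ∫ x, negChar n x ∂periodMeasure = if n = 0 then 2 * (π:ℂ) else 0 := by
  rw [← intervalIntegral.integral_of_le Real.two_pi_pos.le]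
  split_ifs with h
  · subst h; simp [negChar]
  · have hc : (-Complex.I * n : ℂ) ≠ 0 := by
      simpa using h
    have h1 : ∀ x : ℝ, negChar n x = Complex.exp ((-Complex.I * n) * x) := fun x => by
      rw [negChar, mul_assoc]
    simp_rw [h1]
    rw [integral_exp_mul_complex hc, ← h1, ← h1]
    have := negChar_periodic n 0
    rw [zero_add] at this
    rw [this, sub_self, zero_div]

open ComplexConjugate in
theorem integral_trigPoly_mul_negChar (ρ : ℕ → ℂ) (k : ℕ) (n : ℤ) :
    ∫ x, (trigPoly ρ k x : ℂ) * negChar n x ∂periodMeasure =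
      if n.natAbs ≤ k + 1 then π * hermExt ρ n else 0 := by
  have h1 : ∀ x, (trigPoly ρ k x : ℂ) * negChar n x = ∑ j ∈ Finset.range (k + 1),
      (ρ (j + 1) / 2 * negChar (n - (j + 1 : ℕ)) x +
        conj (ρ (j + 1)) / 2 * negChar (n + (j + 1 : ℕ)) x) := fun x => by
    unfold trigPoly
    rw [Complex.ofReal_sum, Finset.sum_mul]
    refine Finset.sum_congr rfl fun j _ => ?_
    have h2 : negChar (n - (j + 1 : ℕ)) x =
        Complex.exp (Complex.I * ((((j + 1 : ℕ) : ℝ) * x : ℝ) : ℂ)) * negChar n x := by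
      rw [negChar, negChar, ← Complex.exp_add]; congr 1; push_cast; ring
    have h3 : negChar (n + (j + 1 : ℕ)) x =
        conj (Complex.exp (Complex.I * ((((j + 1 : ℕ) : ℝ) * x : ℝ) : ℂ))) * negChar n x := by
      rw [negChar, negChar, ← Complex.exp_conj, ← Complex.exp_add]; congr 1
      simp only [map_mul, Complex.conj_I, Complex.conj_ofReal]; push_cast; ring
    rw [h2, h3, Complex.re_eq_add_conj, map_mul]
    ring
  have hi : ∀ m : ℤ, Integrable (negChar m) periodMeasure := fun m =>
    ((continuous_negChar m).integrableOn_Icc).mono_set Set.Ioc_subset_Icc_self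
  simp_rw [h1]
  have h4 : ∀ j ∈ Finset.range (k + 1), Integrable (fun x =>
      ρ (j + 1) / 2 * negChar (n - (j + 1 : ℕ)) x +
        conj (ρ (j + 1)) / 2 * negChar (n + (j + 1 : ℕ)) x) periodMeasure := fun j _ =>
    ((hi _).const_mul _).add ((hi _).const_mul _)
  have h5 : ∀ j, ∫ x, (ρ (j + 1) / 2 * negChar (n - (j + 1 : ℕ)) x +
        conj (ρ (j + 1)) / 2 * negChar (n + (j + 1 : ℕ)) x) ∂periodMeasure =
      ρ (j + 1) / 2 * (if n - (j + 1 : ℕ) = 0 then 2 * (π:ℂ) else 0) +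
        conj (ρ (j + 1)) / 2 * (if n + (j + 1 : ℕ) = 0 then 2 * (π:ℂ) else 0) := fun j => by
    rw [integral_add ((hi _).const_mul _) ((hi _).const_mul _), integral_const_mul,
      integral_const_mul, integral_negChar, integral_negChar]
  rw [integral_finsetSum _ h4]
  simp_rw [h5]
  rcases lt_trichotomy n 0 with hn | hn | hn
  · obtain ⟨N, rfl⟩ : ∃ N : ℕ, n = -((N + 1 : ℕ) : ℤ) :=
      ⟨n.natAbs - 1, by omega⟩
    have e1 : ∀ j : ℕ, ¬ (-((N + 1 : ℕ) : ℤ) - (j + 1 : ℕ) = 0) := fun j => by omega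
    have e2 : ∀ j : ℕ, (-((N + 1 : ℕ) : ℤ) + (j + 1 : ℕ) = 0) ↔ N = j := fun j => by omega
    have e3 : (-((N + 1 : ℕ) : ℤ)).natAbs = N + 1 := by omega
    simp only [e1, e2, if_false, mul_zero, zero_add, mul_ite, Finset.sum_ite_eq, Finset.mem_range,
      hermExt, hn, if_true, not_lt.mpr hn.le, e3, add_le_add_iff_right, Nat.lt_succ_iff]
    congr 1; ring
  · subst hn
    have e1 : ∀ j : ℕ, ¬ ((0:ℤ) - (j + 1 : ℕ) = 0) := fun j => by omega
    have e2 : ∀ j : ℕ, ¬ ((0:ℤ) + (j + 1 : ℕ) = 0) := fun j => by omega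
    simp only [e1, e2, hermExt, if_false, mul_zero, add_zero, Finset.sum_const_zero, lt_irrefl,
      ite_self]
  · obtain ⟨N, rfl⟩ : ∃ N : ℕ, n = ((N + 1 : ℕ) : ℤ) := ⟨n.natAbs - 1, by omega⟩
    have e1 : ∀ j : ℕ, ¬ (((N + 1 : ℕ) : ℤ) + (j + 1 : ℕ) = 0) := fun j => by omega
    have e2 : ∀ j : ℕ, (((N + 1 : ℕ) : ℤ) - (j + 1 : ℕ) = 0) ↔ N = j := fun j => by omega
    have e3 : (((N + 1 : ℕ) : ℤ)).natAbs = N + 1 := by omega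
    simp only [e1, e2, if_false, mul_zero, add_zero, mul_ite, Finset.sum_ite_eq, Finset.mem_range,
      hermExt, hn, if_true, e3, add_le_add_iff_right, Nat.lt_succ_iff]
    congr 1; ring

theorem PeriodicIntegrable.trigPoly_mul (ρ τ : ℕ → ℂ) (k l : ℕ) :
    PeriodicIntegrable fun x y => trigPoly ρ k x * trigPoly τ l y where
  meas := (((continuous_trigPoly ρ k).comp continuous_fst).mul
    ((continuous_trigPoly τ l).comp continuous_snd)).measurable
  periodic_x y x := congrArg (· * trigPoly τ l y) (trigPoly_periodic ρ k x)
  periodic_y x y := congrArg (trigPoly ρ k x * ·) (trigPoly_periodic τ l y)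
  integrable := by
    have hi : ∀ ρ k, Integrable (trigPoly ρ k) periodMeasure := fun ρ k =>
      ((continuous_trigPoly ρ k).integrableOn_Icc).mono_set Set.Ioc_subset_Icc_self
    exact (hi ρ k).mul_prod (hi τ l)

theorem squareCoef_trigPoly_mul (ρ τ : ℕ → ℂ) (k l : ℕ) (n m : ℤ) :
    squareCoef (fun x y => trigPoly ρ k x * trigPoly τ l y) n m =
      π ^ 2 * hermExt ρ n * hermExt τ m *
        if n.natAbs ≤ k + 1 ∧ m.natAbs ≤ l + 1 then 1 else 0 := by
  have h1 : ∀ z : ℝ × ℝ, ((trigPoly ρ k z.1 * trigPoly τ l z.2 : ℝ) : ℂ) *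
      (negChar n z.1 * negChar m z.2) =
      ((trigPoly ρ k z.1 : ℂ) * negChar n z.1) * ((trigPoly τ l z.2 : ℂ) * negChar m z.2) :=
    fun z => by push_cast; ring
  unfold squareCoef
  simp_rw [h1]
  rw [integral_prod_mul (fun x => (trigPoly ρ k x : ℂ) * negChar n x)
    (fun y => (trigPoly τ l y : ℂ) * negChar m y), integral_trigPoly_mul_negChar,
    integral_trigPoly_mul_negChar]
  split_ifs <;> first | (exfalso; tauto) | ring

/-- `α` is the double tail sum of the nonnegative double sequence `Δ`. -/
structure IsTailSum (Δ α : ℕ → ℕ → ℝ) : Prop where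
  nonneg : ∀ k l, 0 ≤ Δ k l
  tail_nonneg : ∀ i j, 0 ≤ α i j
  tsum_eq : ∀ i j, ∑' k, ∑' l, ENNReal.ofReal (Δ (i + k) (j + l)) = ENNReal.ofReal (α i j)

theorem ENNReal.tsum_ite_le (F : ℕ → ℝ≥0∞) (i : ℕ) :
    ∑' k, (if i ≤ k then F k else 0) = ∑' k, F (i + k) := by
  rw [← ENNReal.summable.sum_add_tsum_nat_add' (k := i), Finset.sum_eq_zero, zero_add]
  · exact tsum_congr fun k => by rw [if_pos (Nat.le_add_left _ _), add_comm]
  · exact fun k hk => if_neg (by have := Finset.mem_range.mp hk; omega)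

theorem IsTailSum.tsum_ite {Δ α : ℕ → ℕ → ℝ} (h : IsTailSum Δ α) (i j : ℕ) :
    ∑' kl : ℕ × ℕ, Δ kl.1 kl.2 * (if i ≤ kl.1 ∧ j ≤ kl.2 then 1 else 0) = α i j := by
  have h1 : ∀ kl : ℕ × ℕ, Δ kl.1 kl.2 * (if i ≤ kl.1 ∧ j ≤ kl.2 then 1 else 0) =
      (if i ≤ kl.1 then (if j ≤ kl.2 then ENNReal.ofReal (Δ kl.1 kl.2) else 0) else 0).toReal :=
    fun kl => by
      split_ifs <;> first | (exfalso; tauto) | simp [h.nonneg]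
  simp_rw [h1]
  rw [← ENNReal.tsum_toReal_eq fun kl => by split_ifs <;> finiteness,
    ENNReal.tsum_prod (f := fun k l =>
      if i ≤ k then (if j ≤ l then ENNReal.ofReal (Δ k l) else 0) else 0)]
  have h2 : ∀ k, ∑' l, (if i ≤ k then (if j ≤ l then ENNReal.ofReal (Δ k l) else 0) else 0) =
      if i ≤ k then ∑' l, ENNReal.ofReal (Δ k (j + l)) else 0 := fun k => by
    split_ifs
    · exact ENNReal.tsum_ite_le _ j
    · simp
  simp_rw [h2]
  rw [ENNReal.tsum_ite_le, h.tsum_eq, ENNReal.toReal_ofReal (h.tail_nonneg i j)]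

theorem ENNReal.le_one_add_rpow {p : ℝ} (hp : 1 ≤ p) (t : ℝ≥0∞) : t ≤ 1 + t ^ p := by
  rcases le_total t 1 with h | h
  · exact h.trans le_self_add
  · calc t = t ^ (1:ℝ) := (ENNReal.rpow_one t).symm
      _ ≤ t ^ p := ENNReal.rpow_le_rpow_of_exponent_le h hp
      _ ≤ _ := le_add_self

theorem lintegral_lintegral_ne_top_of_rpow {p : ℝ} (hp : 1 ≤ p) {F : ℝ → ℝ → ℝ≥0∞}
    (h : ∫⁻ x, ∫⁻ y, F x y ^ p ∂periodMeasure ∂periodMeasure ≠ ⊤) :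
    ∫⁻ x, ∫⁻ y, F x y ∂periodMeasure ∂periodMeasure ≠ ⊤ := by
  refine ne_top_of_le_ne_top (b := ∫⁻ x, (periodMeasure Set.univ + ∫⁻ y, F x y ^ p ∂periodMeasure)
    ∂periodMeasure) ?_ (lintegral_mono fun x => ?_)
  · rw [lintegral_add_left measurable_const, lintegral_const]
    exact ENNReal.add_ne_top.mpr ⟨by finiteness, h⟩
  · refine (lintegral_mono fun y => ENNReal.le_one_add_rpow hp _).trans ?_
    rw [lintegral_add_left measurable_const, lintegral_const, one_mul]

namespace PeriodicIntegrable

variable {f : ℝ → ℝ → ℝ}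

theorem ae_volume_of_periodic {P : ℝ → Prop} (hP : ∀ x, P (x + 2 * π) ↔ P x)
    (h : ∀ᵐ x ∂periodMeasure, P x) : ∀ᵐ x, P x := by
  have : VAddInvariantMeasure (AddSubgroup.zmultiples (2 * π)) ℝ volume :=
    ⟨fun c s _ => measure_preimage_add _ _ _⟩
  have hper : Function.Periodic P (2 * π) := fun x => propext (hP x)
  rw [ae_iff]
  have hfd := isAddFundamentalDomain_Ioc (T := 2 * π) Real.two_pi_pos 0 volume
  rw [zero_add] at hfd
  refine hfd.measure_zero_of_invariant _ (fun g => ?_) ?_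
  · ext x
    rw [Set.mem_vadd_set_iff_neg_vadd_mem]
    simp only [Set.mem_ofPred_eq]
    rw [hper.map_vadd_zmultiples]
  · rw [ae_iff, Measure.restrict_apply₀'  measurableSet_Ioc.nullMeasurableSet] at h
    exact h

theorem mean_x_of_squareCoef (hf : PeriodicIntegrable f) (h : ∀ m, squareCoef f 0 m = 0) :
    ∀ᵐ (y : ℝ) ∂volume, (∫ x in (0:ℝ)..(2 * π), f x y) = 0 := by
  refine ae_volume_of_periodic (fun y => by simp_rw [hf.periodic_y _ y]) ?_
  have hfc := hf.integrable.ofReal (𝕜 := ℂ)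
  have key := ae_eq_zero_of_integral_mul_negChar_eq_zero
    (G := fun y => ∫ x, (f x y : ℂ) ∂periodMeasure) hfc.integral_prod_right fun m => by
      rw [← h m, squareCoef, integral_prod_symm _ (hf.integrable_mul_negChar 0 m)]
      refine integral_congr_ae (Filter.Eventually.of_forall fun y => ?_)
      simp only
      rw [← integral_mul_const]
      refine integral_congr_ae (Filter.Eventually.of_forall fun x => ?_)
      simp [negChar]
  filter_upwards [key] with y hy
  rw [integral_complex_ofReal] at hy
  rw [intervalIntegral.integral_of_le Real.two_pi_pos.le]
  exact Complex.ofReal_eq_zero.mp hy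

theorem squareCoef_zero_of_mean_x (hf : PeriodicIntegrable f)
    (h : ∀ᵐ (y : ℝ) ∂volume, (∫ x in (0:ℝ)..(2 * π), f x y) = 0) (m : ℤ) :
    squareCoef f 0 m = 0 := by
  rw [squareCoef, integral_prod_symm _ (hf.integrable_mul_negChar 0 m)]
  refine integral_eq_zero_of_ae ?_
  filter_upwards [ae_restrict_of_ae h] with y hy
  rw [intervalIntegral.integral_of_le Real.two_pi_pos.le] at hy
  have h1 : ∀ x : ℝ, (f x y : ℂ) * (negChar 0 x * negChar m y) = f x y * negChar m y := fun x => by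
    simp [negChar]
  simp_rw [h1]
  rw [integral_mul_const, integral_complex_ofReal, hy]
  simp

theorem mean_y_of_squareCoef (hf : PeriodicIntegrable f) (h : ∀ n, squareCoef f n 0 = 0) :
    ∀ᵐ (x : ℝ) ∂volume, (∫ y in (0:ℝ)..(2 * π), f x y) = 0 :=
  hf.swap.mean_x_of_squareCoef fun m => by rw [squareCoef_swap, h]

theorem squareCoef_zero_of_mean_y (hf : PeriodicIntegrable f)
    (h : ∀ᵐ (x : ℝ) ∂volume, (∫ y in (0:ℝ)..(2 * π), f x y) = 0) (n : ℤ) :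
    squareCoef f n 0 = 0 := by
  rw [← squareCoef_swap]
  exact hf.swap.squareCoef_zero_of_mean_x h n

end PeriodicIntegrable

theorem Lp2Norm_eq {p : ℝ} (hp : 0 ≤ p) (f : ℝ → ℝ → ℝ) :
    Lp2Norm p f = (∫⁻ x, ∫⁻ y, ‖f x y‖ₑ ^ p ∂periodMeasure ∂periodMeasure) ^ (1 / p) := by
  unfold Lp2Norm
  congr 1
  refine lintegral_congr fun x => lintegral_congr fun y => ?_
  rw [Real.enorm_eq_ofReal_abs, ENNReal.ofReal_rpow_of_nonneg (abs_nonneg _) hp]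

theorem Lp2Norm_rpow {p : ℝ} (hp : 0 < p) (f : ℝ → ℝ → ℝ) :
    Lp2Norm p f ^ p = ∫⁻ x, ∫⁻ y, ‖f x y‖ₑ ^ p ∂periodMeasure ∂periodMeasure := by
  rw [Lp2Norm_eq hp.le, ← ENNReal.rpow_mul, one_div, inv_mul_cancel₀ hp.ne', ENNReal.rpow_one]

theorem Lp2Norm_congr {p : ℝ} {f g : ℝ → ℝ → ℝ}
    (h : Function.uncurry f =ᵐ[periodMeasure.prod periodMeasure] Function.uncurry g) :
    Lp2Norm p f = Lp2Norm p g := by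
  unfold Lp2Norm
  congr 1
  refine lintegral_congr_ae ?_
  filter_upwards [Measure.ae_ae_of_ae_prod h] with x hx
  refine lintegral_congr_ae ?_
  filter_upwards [hx] with y hy
  simp only [Function.uncurry_apply_pair] at hy
  rw [hy]

theorem MemLp0.periodicIntegrable {p : ℝ} (hp : 1 < p) {f : ℝ → ℝ → ℝ} (hf : MemLp0 p f) :
    PeriodicIntegrable f where
  meas := hf.meas
  periodic_x := hf.periodic_x
  periodic_y := hf.periodic_y
  integrable := by
    refine ⟨hf.meas.aestronglyMeasurable, ?_⟩
    rw [HasFiniteIntegral, lintegral_prod _ hf.meas.enorm.aemeasurable]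
    refine (lintegral_lintegral_ne_top_of_rpow hp.le ?_).lt_top
    simp only [Function.uncurry_apply_pair]
    rw [← Lp2Norm_rpow (by linarith)]
    exact ENNReal.rpow_ne_top_of_nonneg (by linarith) hf.norm_ne_top

/-- Superposition of products of trigonometric polynomials. -/
def trigSuperposition (Δ : ℕ → ℕ → ℝ) (ρ τ : ℕ → ℂ) (x y : ℝ) : ℝ :=
  ∑' kl : ℕ × ℕ, Δ kl.1 kl.2 * (trigPoly ρ kl.1 x * trigPoly τ kl.2 y)

theorem enorm_trigSuperposition_le {Δ : ℕ → ℕ → ℝ} (hΔ : ∀ k l, 0 ≤ Δ k l) (ρ τ : ℕ → ℂ)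
    (x y : ℝ) : ‖trigSuperposition Δ ρ τ x y‖ₑ ≤
      ∑' k, ∑' l, ENNReal.ofReal (Δ k l) * (‖trigPoly ρ k x‖ₑ * ‖trigPoly τ l y‖ₑ) := by
  refine enorm_tsum_le_tsum_enorm.trans (le_of_eq ?_)
  rw [← ENNReal.tsum_prod]
  refine tsum_congr fun kl => ?_
  rw [enorm_mul, enorm_mul, Real.enorm_eq_ofReal (hΔ _ _)]

theorem IsTailSum.trigSuperposition {Δ α : ℕ → ℕ → ℝ} (h : IsTailSum Δ α) (ρ τ : ℕ → ℂ)
    (hfin : ∫⁻ x, ∫⁻ y, ∑' k, ∑' l, ENNReal.ofReal (Δ k l) *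
      (‖trigPoly ρ k x‖ₑ * ‖trigPoly τ l y‖ₑ) ∂periodMeasure ∂periodMeasure ≠ ⊤) :
    PeriodicIntegrable (trigSuperposition Δ ρ τ) ∧ ∀ n m,
      squareCoef (trigSuperposition Δ ρ τ) n m =
        π ^ 2 * hermExt ρ n * hermExt τ m * α (n.natAbs - 1) (m.natAbs - 1) := by
  have hF : ∀ kl : ℕ × ℕ, PeriodicIntegrable fun x y =>
      Δ kl.1 kl.2 * (trigPoly ρ kl.1 x * trigPoly τ kl.2 y) := fun kl =>
    (PeriodicIntegrable.trigPoly_mul ρ τ kl.1 kl.2).const_mul _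
  have hs : ∑' kl : ℕ × ℕ, ∫⁻ z, ‖Δ kl.1 kl.2 * (trigPoly ρ kl.1 z.1 * trigPoly τ kl.2 z.2)‖ₑ
      ∂(periodMeasure.prod periodMeasure) ≠ ⊤ := by
    have h1 := lintegral_tsum (μ := periodMeasure.prod periodMeasure)
      fun kl => (hF kl).meas.enorm.aemeasurable
    simp only [Function.uncurry_def] at h1
    have h2 := lintegral_prod (μ := periodMeasure) (ν := periodMeasure) _
      (Measurable.tsum (L := .unconditional _) fun kl => (hF kl).meas.enorm).aemeasurable
    simp only [Function.uncurry_def] at h2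
    rw [← h1, h2]
    convert hfin using 6 with x y
    rw [← ENNReal.tsum_prod]
    refine tsum_congr fun kl => ?_
    rw [enorm_mul, enorm_mul, Real.enorm_eq_ofReal (h.nonneg _ _)]
  have key := PeriodicIntegrable.tsum hF hs
  refine ⟨key.1, fun n m => (key.2 n m).trans ?_⟩
  simp_rw [PeriodicIntegrable.squareCoef_const_mul, squareCoef_trigPoly_mul]
  by_cases hn : n = 0
  · subst hn; simp [hermExt]
  by_cases hm : m = 0
  · subst hm; simp [hermExt]
  rw [← h.tsum_ite, Complex.ofReal_tsum, ← tsum_mul_left]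
  refine tsum_congr fun kl => ?_
  have e1 : (n.natAbs ≤ kl.1 + 1 ∧ m.natAbs ≤ kl.2 + 1) ↔
      (n.natAbs - 1 ≤ kl.1 ∧ m.natAbs - 1 ≤ kl.2) := by omega
  simp only [e1]
  split_ifs
  · push_cast
    ring
  · simp

/-- The multiplier `(i n)^r` on natural frequencies. -/
def weylMult (r : ℝ) (n : ℕ) : ℂ := (Complex.I * (n : ℂ)) ^ (r : ℂ)

open ComplexConjugate in
theorem hermExt_weylMult (r : ℝ) {n : ℤ} (hn : n ≠ 0) :
    hermExt (weylMult r) n = (Complex.I * (n : ℂ)) ^ (r : ℂ) := by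
  rcases lt_or_gt_of_ne hn with h | h
  · obtain ⟨N, rfl⟩ : ∃ N : ℕ, n = -((N + 1 : ℕ) : ℤ) := ⟨n.natAbs - 1, by omega⟩
    have e3 : (-((N + 1 : ℕ) : ℤ)).natAbs = N + 1 := by omega
    have harg : (Complex.I * ((N + 1 : ℕ) : ℂ)).arg ≠ π := by
      have h1 : Complex.I * ((N + 1 : ℕ) : ℂ) = (((N + 1 : ℕ) : ℝ) : ℂ) * Complex.I := by
        push_cast; ring
      rw [h1, Complex.arg_real_mul _ (by positivity), Complex.arg_I]
      linarith [pi_pos]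
    rw [hermExt, if_neg (not_lt.mpr h.le), if_pos h, e3, weylMult,
      ← Complex.conj_ofReal r, ← Complex.conj_cpow _ _ harg, map_mul, Complex.conj_I, Complex.conj_natCast]
    rw [Complex.conj_ofReal]
    congr 1
    push_cast
    ring
  · rw [hermExt, if_pos h, weylMult]
    have : ((n.natAbs : ℕ) : ℂ) = (n : ℂ) := by
      rw [Nat.cast_natAbs, abs_of_pos h]
    rw [this]

open ComplexConjugate in
theorem hermExt_mul_diffSymbol (ρ : ℕ → ℂ) (β h : ℝ) (n : ℤ) :
    hermExt (fun n => ρ n * diffSymbol β (n * h)) n = diffSymbol β (n * h) * hermExt ρ n := by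
  unfold hermExt
  split_ifs with h1 h2
  · have : ((n.natAbs : ℕ) : ℝ) = (n : ℝ) := by
      rw [Nat.cast_natAbs, abs_of_pos h1]
    simp only [this, mul_comm]
  · have : ((n.natAbs : ℕ) : ℝ) = -(n : ℝ) := by
      rw [Nat.cast_natAbs, abs_of_neg h2]; push_cast; ring
    simp only [map_mul, ← diffSymbol_neg, this, mul_comm, mul_neg, neg_neg]
  · rw [mul_zero]

/-- `g` has the Fourier coefficients of the mixed Weyl derivative of orders `r₁, r₂` of
the double cosine series with coefficients `α`. -/
structure HasWeylCoef (g : ℝ → ℝ → ℝ) (r₁ r₂ : ℝ) (α : ℕ → ℕ → ℝ) : Prop where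
  periodicIntegrable : PeriodicIntegrable g
  squareCoef_eq : ∀ n m, squareCoef g n m =
    π ^ 2 * hermExt (weylMult r₁) n * hermExt (weylMult r₂) m * α (n.natAbs - 1) (m.natAbs - 1)

theorem HasWeylCoef.diff {g : ℝ → ℝ → ℝ} {r₁ r₂ : ℝ} {α : ℕ → ℕ → ℝ} (hg : HasWeylCoef g r₁ r₂ α)
    {β₁ β₂ : ℝ} (hβ₁ : 0 < β₁) (hβ₂ : 0 < β₂) (h₁ h₂ : ℝ) :
    PeriodicIntegrable (diffX β₁ h₁ (diffY β₂ h₂ g)) ∧ ∀ n m,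
      squareCoef (diffX β₁ h₁ (diffY β₂ h₂ g)) n m =
        π ^ 2 * hermExt (fun n => weylSymbol r₁ β₁ h₁ n) n *
          hermExt (fun n => weylSymbol r₂ β₂ h₂ n) m * α (n.natAbs - 1) (m.natAbs - 1) := by
  have k1 := hg.periodicIntegrable.diffY_and_squareCoef hβ₂ h₂
  have k2 := k1.1.diffX_and_squareCoef hβ₁ h₁
  refine ⟨k2.1, fun n m => ?_⟩
  have e : ∀ r β h, (fun n : ℕ => weylSymbol r β h n) =
      fun n : ℕ => weylMult r n * diffSymbol β (n * h) := fun r β h => by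
    ext n; simp [weylSymbol, weylMult]
  rw [k2.2, k1.2, hg.squareCoef_eq, e, e, hermExt_mul_diffSymbol, hermExt_mul_diffSymbol]
  ring

theorem Lp2Norm_diff_le {p : ℝ} (hp : 1 < p) {r₁ β₁ r₂ β₂ : ℝ} (hr₁ : 0 ≤ r₁)
    (hβ₁ : 0 < β₁) (hr₂ : 0 ≤ r₂) (hβ₂ : 0 < β₂) :
    ∃ C : ℝ≥0∞, C ≠ ⊤ ∧ ∀ (g : ℝ → ℝ → ℝ) (Δ α : ℕ → ℕ → ℝ) (δ₁ δ₂ h₁ h₂ : ℝ),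
      HasWeylCoef g r₁ r₂ α → IsTailSum Δ α → |h₁| ≤ δ₁ → |h₂| ≤ δ₂ →
      Lp2Norm p (diffX β₁ h₁ (diffY β₂ h₂ g)) ^ p ≤
        C * coefSum p r₁ β₁ δ₁ r₂ β₂ δ₂ fun i j => ENNReal.ofReal (α i j) := by
  obtain ⟨C, hC, hle⟩ := lintegral_kernel_superposition_le hp hr₁ hβ₁ hr₂ hβ₂
    (tsum_consSeq_ne_top hβ₁) (tsum_consSeq_ne_top hβ₂)
  refine ⟨C + 1, by finiteness, fun g Δ α δ₁ δ₂ h₁ h₂ hg hα hh₁ hh₂ => ?_⟩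
  have hp0 : 0 < p := by linarith
  have hδ₁ := (abs_nonneg _).trans hh₁
  have hδ₂ := (abs_nonneg _).trans hh₂
  rcases eq_or_ne (coefSum p r₁ β₁ δ₁ r₂ β₂ δ₂ fun i j => ENNReal.ofReal (α i j)) ⊤ with hS | hS
  · rw [hS, ENNReal.mul_top (by simp)]
    exact le_top
  have hmaj := hle δ₁ δ₂ (consSeq (β₁ * h₁ / 2) fun ν => (β₁ - ν) * h₁)
    (consSeq (β₂ * h₂ / 2) fun ν => (β₂ - ν) * h₂) (fun k l => ENNReal.ofReal (Δ k l)) hδ₁ hδ₂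
  simp_rw [hα.tsum_eq] at hmaj
  set ρ : ℕ → ℂ := fun n => weylSymbol r₁ β₁ h₁ n with hρ
  set τ : ℕ → ℂ := fun n => weylSymbol r₂ β₂ h₂ n with hτ
  have hle2 : ∫⁻ x, ∫⁻ y, (∑' k, ∑' l, ENNReal.ofReal (Δ k l) *
      (‖trigPoly ρ k x‖ₑ * ‖trigPoly τ l y‖ₑ)) ^ p ∂periodMeasure ∂periodMeasure ≤
      C * coefSum p r₁ β₁ δ₁ r₂ β₂ δ₂ fun i j => ENNReal.ofReal (α i j) := by
    refine le_trans (lintegral_mono fun x => lintegral_mono fun y => ?_) hmaj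
    refine ENNReal.rpow_le_rpow (ENNReal.tsum_le_tsum fun k => ENNReal.tsum_le_tsum fun l => ?_)
      hp0.le
    exact mul_le_mul' le_rfl (mul_le_mul' (enorm_trigPoly_weylSymbol_le hr₁ hβ₁ hh₁ k x)
      (enorm_trigPoly_weylSymbol_le hr₂ hβ₂ hh₂ l y))
  have hfin := lintegral_lintegral_ne_top_of_rpow hp.le
    (ne_top_of_le_ne_top (ENNReal.mul_ne_top hC hS) hle2)
  obtain ⟨hE, hEc⟩ := hα.trigSuperposition ρ τ hfin
  obtain ⟨hD, hDc⟩ := hg.diff hβ₁ hβ₂ h₁ h₂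
  rw [Lp2Norm_congr (hD.ae_eq_of_squareCoef_eq hE fun n m => by rw [hDc, hEc]), Lp2Norm_rpow hp0]
  refine le_trans (lintegral_mono fun x => lintegral_mono fun y => ENNReal.rpow_le_rpow
    (enorm_trigSuperposition_le hα.nonneg ρ τ x y) hp0.le) (hle2.trans ?_)
  gcongr
  exact le_self_add

theorem IsTailSum.tail_antitone {Δ α : ℕ → ℕ → ℝ} (h : IsTailSum Δ α) {n m k l : ℕ} (hn : n ≤ k)
    (hm : m ≤ l) : α k l ≤ α n m := by
  rw [← ENNReal.ofReal_le_ofReal_iff (h.tail_nonneg _ _), ← h.tsum_eq, ← h.tsum_eq]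
  obtain ⟨k, rfl⟩ := Nat.exists_eq_add_of_le hn
  obtain ⟨l, rfl⟩ := Nat.exists_eq_add_of_le hm
  refine le_trans (ENNReal.tsum_le_tsum fun i => ?_)
    (ENNReal.tsum_comp_le_tsum_of_injective (add_right_injective k)
      fun i => ∑' j, ENNReal.ofReal (Δ (n + i) (m + j)))
  refine le_trans (le_of_eq (tsum_congr fun j => ?_))
    (ENNReal.tsum_comp_le_tsum_of_injective (add_right_injective l)
      fun j => ENNReal.ofReal (Δ (n + (k + i)) (m + j)))
  simp only [add_assoc]

open ComplexConjugate in
theorem trigPoly_eq_sum_negChar (ρ : ℕ → ℂ) (k : ℕ) (x : ℝ) :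
    (trigPoly ρ k x : ℂ) = ∑ j ∈ Finset.range (k + 1),
      (ρ (j + 1) / 2 * negChar (-((j + 1 : ℕ) : ℤ)) x +
        conj (ρ (j + 1)) / 2 * negChar ((j + 1 : ℕ) : ℤ) x) := by
  unfold trigPoly
  rw [Complex.ofReal_sum]
  refine Finset.sum_congr rfl fun j _ => ?_
  have h2 : negChar (-((j + 1 : ℕ) : ℤ)) x =
      Complex.exp (Complex.I * ((((j + 1 : ℕ) : ℝ) * x : ℝ) : ℂ)) := by
    rw [negChar]; congr 1; push_cast; ring
  have h3 : negChar ((j + 1 : ℕ) : ℤ) x =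
      conj (Complex.exp (Complex.I * ((((j + 1 : ℕ) : ℝ) * x : ℝ) : ℂ))) := by
    rw [negChar, ← Complex.exp_conj]; congr 1
    simp only [map_mul, Complex.conj_I, Complex.conj_ofReal]; push_cast; ring
  rw [h2, h3, Complex.re_eq_add_conj, map_mul]
  ring

/-- `F` is integrable over the period square with integral `v`. -/
structure HasIntegralValue (F : ℝ × ℝ → ℂ) (v : ℂ) : Prop where
  integrable : Integrable F (periodMeasure.prod periodMeasure)
  value : ∫ z, F z ∂(periodMeasure.prod periodMeasure) = v

theorem HasIntegralValue.add {F G : ℝ × ℝ → ℂ} {v w : ℂ} (hF : HasIntegralValue F v)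
    (hG : HasIntegralValue G w) : HasIntegralValue (fun z => F z + G z) (v + w) :=
  ⟨hF.integrable.add hG.integrable, by
    rw [integral_add hF.integrable hG.integrable, hF.value, hG.value]⟩

theorem HasIntegralValue.sum {s : Finset ℕ} {F : ℕ → ℝ × ℝ → ℂ} {v : ℕ → ℂ}
    (h : ∀ n ∈ s, HasIntegralValue (F n) (v n)) :
    HasIntegralValue (fun z => ∑ n ∈ s, F n z) (∑ n ∈ s, v n) :=
  ⟨integrable_finsetSum _ fun n hn => (h n hn).integrable, by
    rw [integral_finsetSum _ fun n hn => (h n hn).integrable]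
    exact Finset.sum_congr rfl fun n hn => (h n hn).value⟩

open ComplexConjugate in
theorem PeriodicIntegrable.integral_mul_trigPoly_mul {D : ℝ → ℝ → ℝ} (hD : PeriodicIntegrable D)
    {ρ τ : ℕ → ℂ} {α : ℕ → ℕ → ℝ} (hc : ∀ n m, squareCoef D n m =
      π ^ 2 * hermExt ρ n * hermExt τ m * α (n.natAbs - 1) (m.natAbs - 1))
    (ψ θ : ℕ → ℂ) (k l : ℕ) :
    ∫ z, D z.1 z.2 * (trigPoly ψ k z.1 * trigPoly θ l z.2)
      ∂(periodMeasure.prod periodMeasure) =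
    ∑ n ∈ Finset.range (k + 1), ∑ m ∈ Finset.range (l + 1), π ^ 2 * α n m *
      ((ψ (n + 1) * conj (ρ (n + 1))).re * (θ (m + 1) * conj (τ (m + 1))).re) := by
  rw [← Complex.ofReal_inj, ← integral_complex_ofReal]
  have hexp : ∀ z : ℝ × ℝ, ((D z.1 z.2 * (trigPoly ψ k z.1 * trigPoly θ l z.2) : ℝ) : ℂ) =
      ∑ n ∈ Finset.range (k + 1), ∑ m ∈ Finset.range (l + 1),
        (ψ (n + 1) / 2 * (θ (m + 1) / 2) * (D z.1 z.2 *
            (negChar (-((n + 1 : ℕ) : ℤ)) z.1 * negChar (-((m + 1 : ℕ) : ℤ)) z.2)) +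
          ψ (n + 1) / 2 * (conj (θ (m + 1)) / 2) * (D z.1 z.2 *
            (negChar (-((n + 1 : ℕ) : ℤ)) z.1 * negChar ((m + 1 : ℕ) : ℤ) z.2)) +
          (conj (ψ (n + 1)) / 2 * (θ (m + 1) / 2) * (D z.1 z.2 *
            (negChar ((n + 1 : ℕ) : ℤ) z.1 * negChar (-((m + 1 : ℕ) : ℤ)) z.2)) +
          conj (ψ (n + 1)) / 2 * (conj (θ (m + 1)) / 2) * (D z.1 z.2 *
            (negChar ((n + 1 : ℕ) : ℤ) z.1 * negChar ((m + 1 : ℕ) : ℤ) z.2)))) := fun z => by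
    rw [Complex.ofReal_mul, Complex.ofReal_mul, trigPoly_eq_sum_negChar, trigPoly_eq_sum_negChar,
      Finset.sum_mul_sum, Finset.mul_sum]
    refine Finset.sum_congr rfl fun n _ => ?_
    rw [Finset.mul_sum]
    refine Finset.sum_congr rfl fun m _ => ?_
    ring
  have hi : ∀ (c : ℂ) (n m : ℤ), Integrable (fun z : ℝ × ℝ =>
      c * (D z.1 z.2 * (negChar n z.1 * negChar m z.2))) (periodMeasure.prod periodMeasure) :=
    fun c n m => (hD.integrable_mul_negChar n m).const_mul c
  have hval : ∀ (c : ℂ) (n m : ℤ), ∫ z : ℝ × ℝ,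
      c * (D z.1 z.2 * (negChar n z.1 * negChar m z.2)) ∂(periodMeasure.prod periodMeasure) =
      c * squareCoef D n m := fun c n m => integral_const_mul _ _
  have hadd : ∀ (c₁ c₂ c₃ c₄ : ℂ) (n₁ m₁ n₂ m₂ n₃ m₃ n₄ m₄ : ℤ),
      HasIntegralValue (fun z : ℝ × ℝ =>
        c₁ * (D z.1 z.2 * (negChar n₁ z.1 * negChar m₁ z.2)) +
          c₂ * (D z.1 z.2 * (negChar n₂ z.1 * negChar m₂ z.2)) +
        (c₃ * (D z.1 z.2 * (negChar n₃ z.1 * negChar m₃ z.2)) +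
          c₄ * (D z.1 z.2 * (negChar n₄ z.1 * negChar m₄ z.2))))
        (c₁ * squareCoef D n₁ m₁ + c₂ * squareCoef D n₂ m₂ +
          (c₃ * squareCoef D n₃ m₃ + c₄ * squareCoef D n₄ m₄)) :=
    fun c₁ c₂ c₃ c₄ n₁ m₁ n₂ m₂ n₃ m₃ n₄ m₄ =>
      (((HasIntegralValue.mk (hi c₁ n₁ m₁) (hval _ _ _)).add ⟨hi c₂ n₂ m₂, hval _ _ _⟩).add
        (HasIntegralValue.add ⟨hi c₃ n₃ m₃, hval _ _ _⟩ ⟨hi c₄ n₄ m₄, hval _ _ _⟩))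
  simp_rw [hexp]
  rw [(HasIntegralValue.sum fun n _ => HasIntegralValue.sum fun m _ =>
    hadd _ _ _ _ _ _ _ _ _ _ _ _).value, Complex.ofReal_sum]
  refine Finset.sum_congr rfl fun n _ => ?_
  rw [Complex.ofReal_sum]
  refine Finset.sum_congr rfl fun m _ => ?_
  have hneg : ∀ (σ : ℕ → ℂ) (j : ℕ), hermExt σ (-((j + 1 : ℕ) : ℤ)) = conj (σ (j + 1)) :=
    fun σ j => by
      rw [hermExt, if_neg (by omega), if_pos (by omega)]; congr 2
  have hpos : ∀ (σ : ℕ → ℂ) (j : ℕ), hermExt σ ((j + 1 : ℕ) : ℤ) = σ (j + 1) := fun σ j => by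
    rw [hermExt, if_pos (by omega)]; congr 1
  have ha1 : ∀ j : ℕ, (-((j + 1 : ℕ) : ℤ)).natAbs - 1 = j := fun j => by omega
  have ha2 : ∀ j : ℕ, (((j + 1 : ℕ) : ℤ)).natAbs - 1 = j := fun j => by omega
  simp only [hc, hneg, hpos, ha1, ha2]
  push_cast
  rw [Complex.re_eq_add_conj, Complex.re_eq_add_conj]
  simp only [map_mul, Complex.conj_conj]
  ring

theorem ENNReal.le_rpow_of_le_mul_rpow {p q : ℝ} (hpq : p.HolderConjugate q) {S B : ℝ≥0∞}
    (hS : S ≠ ⊤) (h : S ≤ B * S ^ (1 / q)) : S ≤ B ^ p := by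
  have hp0 := hpq.pos
  rcases eq_or_ne S 0 with h0 | h0
  · rw [h0]; exact zero_le
  have h1 : S ^ (1 / p) * S ^ (1 / q) = S := by
    rw [← ENNReal.rpow_add _ _ h0 hS, one_div, one_div, hpq.inv_add_inv_eq_one, ENNReal.rpow_one]
  have hq0 : 0 ≤ 1 / q := by have := hpq.symm.pos; positivity
  have h2 : S ^ (1 / p) ≤ B := by
    rw [← h1] at h
    conv_rhs at h => rw [h1]
    exact (ENNReal.mul_le_mul_iff_left (by simp [h0, hS])
      (ENNReal.rpow_ne_top_of_nonneg hq0 hS)).mp h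
  calc S = (S ^ (1 / p)) ^ p := by
        rw [← ENNReal.rpow_mul, one_div, inv_mul_cancel₀ hp0.ne', ENNReal.rpow_one]
    _ ≤ B ^ p := ENNReal.rpow_le_rpow h2 hp0.le

theorem rpow_dual_weight {p q : ℝ} (hpq : p.HolderConjugate q) {u M : ℝ} (hu : 0 ≤ u) (hM : 0 < M) :
    (4 * (u ^ (p - 1) * M ^ (p - 3)) * M) ^ q * M ^ (q - 2) = 4 ^ q * (u ^ p * M ^ (p - 2)) := by
  have e1 : (p - 1) * q = p := hpq.sub_one_mul_conj
  have h1 : 4 * (u ^ (p - 1) * M ^ (p - 3)) * M = 4 * (u ^ (p - 1) * M ^ (p - 2)) := by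
    rw [mul_assoc, mul_assoc, ← rpow_add_one hM.ne']
    ring_nf
  rw [h1, mul_rpow (by norm_num) (by positivity), mul_rpow (by positivity) (by positivity),
    ← rpow_mul hu, ← rpow_mul hM.le, e1, mul_assoc, mul_assoc, ← rpow_add hM]
  congr 3
  linear_combination e1

theorem rpow_weight_mul {p : ℝ} (hp : 1 < p) {u M : ℝ} (hu : 0 ≤ u) (hM : 0 < M) :
    u ^ (p - 1) * M ^ (p - 3) * (u * M) = u ^ p * M ^ (p - 2) := by
  have h2 : M ^ (p - 3) * M = M ^ (p - 2) := by
    rw [← rpow_add_one hM.ne']; ring_nf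
  have h3 : u ^ (p - 1) * u = u ^ p := by
    rcases hu.eq_or_lt with h | h
    · rw [← h, zero_rpow (by linarith : p ≠ 0), mul_zero]
    · rw [← rpow_add_one h.ne']; ring_nf
  rw [← h2, ← h3]; ring

open ComplexConjugate in
theorem PeriodicIntegrable.le_integral_mul_trigPoly_mul {D : ℝ → ℝ → ℝ} (hD : PeriodicIntegrable D)
    {ρ τ : ℕ → ℂ} {Δ α : ℕ → ℕ → ℝ} (hα : IsTailSum Δ α) (hc : ∀ n m, squareCoef D n m =
      π ^ 2 * hermExt ρ n * hermExt τ m * α (n.natAbs - 1) (m.natAbs - 1))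
    {ψ θ : ℕ → ℂ} {k l : ℕ} {A B : ℝ} (hA : 0 ≤ A) (hB : 0 ≤ B)
    (hψ : ∀ n ≤ k, 0 ≤ (ψ (n + 1) * conj (ρ (n + 1))).re)
    (hθ : ∀ n ≤ l, 0 ≤ (θ (n + 1) * conj (τ (n + 1))).re)
    (hψA : A ≤ ∑ n ∈ Finset.range (k + 1), (ψ (n + 1) * conj (ρ (n + 1))).re)
    (hθB : B ≤ ∑ n ∈ Finset.range (l + 1), (θ (n + 1) * conj (τ (n + 1))).re) :
    π ^ 2 * α k l * (A * B) ≤ ∫ z, D z.1 z.2 * (trigPoly ψ k z.1 * trigPoly θ l z.2)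
      ∂(periodMeasure.prod periodMeasure) := by
  rw [hD.integral_mul_trigPoly_mul hc]
  have h0 := hα.tail_nonneg k l
  calc π ^ 2 * α k l * (A * B) ≤ π ^ 2 * α k l *
        ((∑ n ∈ Finset.range (k + 1), (ψ (n + 1) * conj (ρ (n + 1))).re) *
          ∑ n ∈ Finset.range (l + 1), (θ (n + 1) * conj (τ (n + 1))).re) := by
        gcongr
        exact hA.trans hψA
    _ = ∑ n ∈ Finset.range (k + 1), ∑ m ∈ Finset.range (l + 1), π ^ 2 * α k l *
      ((ψ (n + 1) * conj (ρ (n + 1))).re * (θ (m + 1) * conj (τ (m + 1))).re) := by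
        rw [Finset.sum_mul_sum, Finset.mul_sum]
        exact Finset.sum_congr rfl fun n _ => Finset.mul_sum _ _ _
    _ ≤ _ := by
        refine Finset.sum_le_sum fun n hn => Finset.sum_le_sum fun m hm => ?_
        have hn' := Nat.lt_succ_iff.mp (Finset.mem_range.mp hn)
        have hm' := Nat.lt_succ_iff.mp (Finset.mem_range.mp hm)
        exact mul_le_mul_of_nonneg_right (mul_le_mul_of_nonneg_left
          (hα.tail_antitone hn' hm') (by positivity)) (mul_nonneg (hψ n hn') (hθ m hm'))

theorem norm_trigPoly_le (ρ : ℕ → ℂ) (k : ℕ) (x : ℝ) :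
    ‖trigPoly ρ k x‖ ≤ ∑ n ∈ Finset.range (k + 1), ‖ρ (n + 1)‖ := by
  refine (norm_sum_le _ _).trans (Finset.sum_le_sum fun n _ => ?_)
  refine (Complex.abs_re_le_norm _).trans (le_of_eq ?_)
  rw [norm_mul, Complex.norm_exp_I_mul_ofReal, mul_one]

/-- Duality bound: testing against products of kernels controls the weighted `ℓ_p` sum. -/
theorem sum_le_Lp2Norm_of_pairing {p q : ℝ} (hpq : p.HolderConjugate q) {D : ℝ → ℝ → ℝ}
    (hD : PeriodicIntegrable D) {Ψ Θ : ℕ → ℕ → ℂ} {κ η : ℕ → ℝ → ℝ≥0∞} {A B : ℝ≥0∞}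
    (hκ : HLBound q A κ) (hη : HLBound q B η) (hκm : ∀ k, Measurable (κ k))
    (hΨ : ∀ k x, ‖trigPoly (Ψ k) k x‖ₑ ≤ ENNReal.ofReal (2 * (k + 1)) * κ k x)
    (hΘ : ∀ k x, ‖trigPoly (Θ k) k x‖ₑ ≤ ENNReal.ofReal (2 * (k + 1)) * η k x)
    {u : ℕ → ℕ → ℝ} (hu : ∀ k l, 0 ≤ u k l) {c : ℝ} (hc : 0 < c)
    (hpair : ∀ k l, c * (u k l * (((k:ℝ) + 1) * ((l:ℝ) + 1))) ≤
      ∫ z, D z.1 z.2 * (trigPoly (Ψ k) k z.1 * trigPoly (Θ l) l z.2)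
        ∂(periodMeasure.prod periodMeasure)) (s : Finset (ℕ × ℕ)) :
    ∑ kl ∈ s, ENNReal.ofReal
        (u kl.1 kl.2 ^ p * (((kl.1:ℝ) + 1) * ((kl.2:ℝ) + 1)) ^ (p - 2)) ≤
      ((ENNReal.ofReal c)⁻¹ * (A * B * ENNReal.ofReal (4 ^ q)) ^ (1 / q)) ^ p *
        Lp2Norm p D ^ p := by
  have hp := hpq.lt
  have hq := hpq.symm.lt
  have hp0 := hpq.pos
  have hq0 := hpq.symm.pos
  set M : ℕ × ℕ → ℝ := fun kl => ((kl.1:ℝ) + 1) * ((kl.2:ℝ) + 1) with hM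
  have hM0 : ∀ kl, 0 < M kl := fun kl => by positivity
  set w : ℕ × ℕ → ℝ := fun kl => u kl.1 kl.2 ^ (p - 1) * M kl ^ (p - 3) with hw
  have hw0 : ∀ kl, 0 ≤ w kl := fun kl =>
    mul_nonneg (rpow_nonneg (hu _ _) _) (rpow_nonneg (hM0 kl).le _)
  set S := ∑ kl ∈ s, ENNReal.ofReal (u kl.1 kl.2 ^ p * M kl ^ (p - 2)) with hS
  have hSt : S ≠ ⊤ := (ENNReal.sum_lt_top.mpr fun _ _ => ENNReal.ofReal_lt_top).ne
  set φ : ℝ × ℝ → ℝ := fun z => ∑ kl ∈ s,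
    w kl * (trigPoly (Ψ kl.1) kl.1 z.1 * trigPoly (Θ kl.2) kl.2 z.2) with hφ
  have hφc : Continuous φ := continuous_finsetSum _ fun kl _ => continuous_const.mul
    (((continuous_trigPoly _ _).comp continuous_fst).mul
      ((continuous_trigPoly _ _).comp continuous_snd))
  set b : ℕ → ℕ → ℝ≥0∞ := fun k l =>
    if (k, l) ∈ s then ENNReal.ofReal (4 * w (k, l) * M (k, l)) else 0 with hb
  have hDm : Measurable fun z : ℝ × ℝ => D z.1 z.2 := hD.meas
  have h_int : ∀ kl : ℕ × ℕ, Integrable (fun z : ℝ × ℝ =>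
      D z.1 z.2 * (trigPoly (Ψ kl.1) kl.1 z.1 * trigPoly (Θ kl.2) kl.2 z.2))
      (periodMeasure.prod periodMeasure) := fun kl => by
    refine hD.integrable.mul_bdd (c := (∑ n ∈ Finset.range (kl.1 + 1), ‖Ψ kl.1 (n + 1)‖) *
      ∑ n ∈ Finset.range (kl.2 + 1), ‖Θ kl.2 (n + 1)‖) ?_ (.of_forall fun z => ?_)
    · exact (((continuous_trigPoly _ _).comp continuous_fst).mul
        ((continuous_trigPoly _ _).comp continuous_snd)).aestronglyMeasurable
    · rw [norm_mul]
      exact mul_le_mul (norm_trigPoly_le _ _ _) (norm_trigPoly_le _ _ _) (norm_nonneg _)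
        (Finset.sum_nonneg fun _ _ => norm_nonneg _)
  have hpairS : ENNReal.ofReal c * S ≤
      ∫⁻ z, ‖D z.1 z.2‖ₑ * ‖φ z‖ₑ ∂(periodMeasure.prod periodMeasure) := by
    have h1 : ENNReal.ofReal c * S =
        ENNReal.ofReal (∑ kl ∈ s, w kl * (c * (u kl.1 kl.2 * M kl))) := by
      rw [hS, Finset.mul_sum, ENNReal.ofReal_sum_of_nonneg fun kl _ => by
        have := hu kl.1 kl.2; have := hM0 kl; have := hw0 kl; positivity]
      refine Finset.sum_congr rfl fun kl _ => ?_
      rw [← ENNReal.ofReal_mul hc.le, ← rpow_weight_mul hp (hu _ _) (hM0 kl)]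
      congr 1
      simp only [hw]; ring
    have h2 : ∑ kl ∈ s, w kl * (c * (u kl.1 kl.2 * M kl)) ≤
        ∫ z, D z.1 z.2 * φ z ∂(periodMeasure.prod periodMeasure) := by
      have h3 : ∀ z : ℝ × ℝ, D z.1 z.2 * φ z = ∑ kl ∈ s, w kl *
          (D z.1 z.2 * (trigPoly (Ψ kl.1) kl.1 z.1 * trigPoly (Θ kl.2) kl.2 z.2)) := fun z => by
        simp only [hφ, Finset.mul_sum]
        exact Finset.sum_congr rfl fun kl _ => by ring
      simp_rw [h3]
      rw [integral_finsetSum _ fun kl _ => (h_int kl).const_mul _]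
      refine Finset.sum_le_sum fun kl _ => ?_
      rw [integral_const_mul]
      exact mul_le_mul_of_nonneg_left (hpair _ _) (hw0 kl)
    rw [h1]
    refine (ENNReal.ofReal_le_ofReal h2).trans ((Real.ofReal_le_enorm _).trans
      ((enorm_integral_le_lintegral_enorm _).trans (le_of_eq ?_)))
    exact lintegral_congr fun z => enorm_mul _ _
  have hφb : ∀ z, ‖φ z‖ₑ ≤ ∑' k, ∑' l, κ k z.1 * η l z.2 * b k l := fun z => by
    refine (enorm_sum_le _ _).trans ?_
    rw [← ENNReal.tsum_prod (f := fun k l => κ k z.1 * η l z.2 * b k l)]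
    refine le_trans ?_ (ENNReal.sum_le_tsum s)
    refine Finset.sum_le_sum fun kl hkl => ?_
    have hbv : b kl.1 kl.2 = ENNReal.ofReal (4 * w kl * M kl) := if_pos hkl
    rw [hbv, enorm_mul (w kl), enorm_mul (trigPoly _ _ _), Real.enorm_eq_ofReal (hw0 kl)]
    refine (mul_le_mul' le_rfl (mul_le_mul' (hΨ _ _) (hΘ _ _))).trans (le_of_eq ?_)
    have h1 : ENNReal.ofReal (4 * w kl * M kl) = ENNReal.ofReal (w kl) *
        (ENNReal.ofReal (2 * (kl.1 + 1)) * ENNReal.ofReal (2 * (kl.2 + 1))) := by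
      rw [← ENNReal.ofReal_mul (by positivity), ← ENNReal.ofReal_mul (hw0 kl)]
      congr 1
      simp only [hM]; ring
    rw [h1]; ring
  have hφq : ∫⁻ z, ‖φ z‖ₑ ^ q ∂(periodMeasure.prod periodMeasure) ≤
      A * B * ENNReal.ofReal (4 ^ q) * S := by
    rw [lintegral_prod _ (hφc.measurable.enorm.pow_const q).aemeasurable]
    refine (lintegral_mono fun x => lintegral_mono fun y =>
      ENNReal.rpow_le_rpow (hφb (x, y)) hq0.le).trans ((hκ.prod hη hκm b).trans ?_)
    rw [mul_assoc (A * B)]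
    refine mul_le_mul' le_rfl (le_of_eq ?_)
    rw [← ENNReal.tsum_prod (f := fun k l => b k l ^ q *
      (((k:ℝ≥0∞) + 1) ^ (q - 2) * ((l:ℝ≥0∞) + 1) ^ (q - 2))), tsum_eq_sum (s := s), hS,
      Finset.mul_sum]
    · refine Finset.sum_congr rfl fun kl hkl => ?_
      have hbv : b kl.1 kl.2 = ENNReal.ofReal (4 * w kl * M kl) := if_pos hkl
      have := hw0 kl
      have := hM0 kl
      rw [hbv, ENNReal.natCast_add_one_rpow, ENNReal.natCast_add_one_rpow,
        ENNReal.ofReal_rpow_of_nonneg (by positivity) hq0.le, ← ENNReal.ofReal_mul (by positivity),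
        ← ENNReal.ofReal_mul (by positivity), ← ENNReal.ofReal_mul (by positivity),
        ← mul_rpow (by positivity) (by positivity)]
      exact congrArg ENNReal.ofReal (rpow_dual_weight hpq (hu _ _) (hM0 kl))
    · intro kl hkl
      have hbv : b kl.1 kl.2 = 0 := if_neg hkl
      rw [hbv, ENNReal.zero_rpow_of_pos hq0, zero_mul]
  have hDp : ∫⁻ z, ‖D z.1 z.2‖ₑ ^ p ∂(periodMeasure.prod periodMeasure) = Lp2Norm p D ^ p := by
    rw [Lp2Norm_rpow hp0, lintegral_prod _ (hDm.enorm.pow_const p).aemeasurable]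
  have hHol := ENNReal.lintegral_mul_le_Lp_mul_Lq (periodMeasure.prod periodMeasure) hpq
    hDm.enorm.aemeasurable hφc.measurable.enorm.aemeasurable
  simp only [Pi.mul_apply] at hHol
  rw [hDp] at hHol
  have hc0 : ENNReal.ofReal c ≠ 0 := by simpa using hc
  rw [← ENNReal.mul_rpow_of_nonneg _ _ hp0.le]
  refine ENNReal.le_rpow_of_le_mul_rpow hpq hSt ?_
  have h5 : ENNReal.ofReal c * S ≤ Lp2Norm p D *
      ((A * B * ENNReal.ofReal (4 ^ q)) ^ (1 / q) * S ^ (1 / q)) := by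
    refine hpairS.trans (hHol.trans (mul_le_mul' (le_of_eq ?_) ?_))
    · rw [← ENNReal.rpow_mul, mul_one_div, div_self hp0.ne', ENNReal.rpow_one]
    · rw [← ENNReal.mul_rpow_of_nonneg _ _ (by positivity)]
      exact ENNReal.rpow_le_rpow hφq (by positivity)
  calc S = (ENNReal.ofReal c)⁻¹ * (ENNReal.ofReal c * S) := by
        rw [← mul_assoc, ENNReal.inv_mul_cancel hc0 ENNReal.ofReal_ne_top, one_mul]
    _ ≤ _ := mul_le_mul' le_rfl h5
    _ = _ := by ring

theorem coefSum_le_Lp2Norm_diff {p : ℝ} (hp : 1 < p) {r₁ β₁ r₂ β₂ : ℝ} (hr₁ : 0 ≤ r₁)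
    (hβ₁ : 0 < β₁) (hr₂ : 0 ≤ r₂) (hβ₂ : 0 < β₂) :
    ∃ C : ℝ≥0∞, C ≠ ⊤ ∧ ∀ (g : ℝ → ℝ → ℝ) (Δ α : ℕ → ℕ → ℝ) (δ₁ δ₂ : ℝ),
      HasWeylCoef g r₁ r₂ α → IsTailSum Δ α → 0 < δ₁ → δ₁ < 1 / 2 → 0 < δ₂ → δ₂ < 1 / 2 →
      (coefSum p r₁ β₁ δ₁ r₂ β₂ δ₂ fun i j => ENNReal.ofReal (α i j)) ≤
        C * Lp2Norm p (diffX β₁ δ₁ (diffY β₂ δ₂ g)) ^ p := by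
  obtain ⟨γ₁, c₁, hγ₁, hc₁, H₁⟩ := exists_dual_symbol hr₁ hβ₁
  obtain ⟨γ₂, c₂, hγ₂, hc₂, H₂⟩ := exists_dual_symbol hr₂ hβ₂
  have hpq := Real.HolderConjugate.conjExponent hp
  set q := p.conjExponent
  have hq := hpq.symm.lt
  have hq0 := hpq.symm.pos
  have hp0 := hpq.pos
  set e₁ : ℕ → ℝ≥0∞ := consSeq 1 fun ν => ‖(diffCoef γ₁ ν : ℂ)‖ₑ with he₁
  set e₂ : ℕ → ℝ≥0∞ := consSeq 1 fun ν => ‖(diffCoef γ₂ ν : ℂ)‖ₑ with he₂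
  have hE₁ : (∑' ν, e₁ ν) ^ q ≠ ⊤ :=
    ENNReal.rpow_ne_top_of_nonneg hq0.le (tsum_consSeq_ne_top hγ₁)
  have hE₂ : (∑' ν, e₂ ν) ^ q ≠ ⊤ :=
    ENNReal.rpow_ne_top_of_nonneg hq0.le (tsum_consSeq_ne_top hγ₂)
  have hc : 0 < π ^ 2 * c₁ * c₂ := by have := pi_pos; positivity
  refine ⟨((ENNReal.ofReal (π ^ 2 * c₁ * c₂))⁻¹ * (((∑' ν, e₁ ν) ^ q * ENNReal.ofReal (hlConst' q)) *
    ((∑' ν, e₂ ν) ^ q * ENNReal.ofReal (hlConst' q)) * ENNReal.ofReal (4 ^ q)) ^ (1 / q)) ^ p,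
    ?_, fun g Δ α δ₁ δ₂ hg hα hδ₁ hδ₁' hδ₂ hδ₂' => ?_⟩
  rotate_left
  · obtain ⟨s₁, K₁⟩ := H₁ δ₁ hδ₁ hδ₁'
    obtain ⟨s₂, K₂⟩ := H₂ δ₂ hδ₂ hδ₂'
    choose Ψ hΨ hΨ0 hΨs using K₁
    choose Θ hΘ hΘ0 hΘs using K₂
    obtain ⟨hD, hDc⟩ := hg.diff hβ₁ hβ₂ δ₁ δ₂
    have hn₁ := symbolSize_nonneg r₁ β₁ hδ₁.le
    have hn₂ := symbolSize_nonneg r₂ β₂ hδ₂.le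
    have hu : ∀ k l, 0 ≤ α k l * (symbolSize r₁ β₁ δ₁ k * symbolSize r₂ β₂ δ₂ l) := fun k l =>
      mul_nonneg (hα.tail_nonneg _ _) (mul_nonneg (hn₁ k) (hn₂ l))
    have hpair : ∀ k l, π ^ 2 * c₁ * c₂ *
        (α k l * (symbolSize r₁ β₁ δ₁ k * symbolSize r₂ β₂ δ₂ l) * (((k:ℝ) + 1) * ((l:ℝ) + 1))) ≤
        ∫ z, diffX β₁ δ₁ (diffY β₂ δ₂ g) z.1 z.2 *
          (trigPoly (Ψ k) k z.1 * trigPoly (Θ l) l z.2)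
          ∂(periodMeasure.prod periodMeasure) := fun k l => by
      have hk := hn₁ k
      have hl := hn₂ l
      refine le_trans (le_of_eq ?_) (hD.le_integral_mul_trigPoly_mul hα hDc
        (A := c₁ * ((k + 1) * symbolSize r₁ β₁ δ₁ k)) (B := c₂ * ((l + 1) * symbolSize r₂ β₂ δ₂ l))
        (by positivity) (by positivity) (hΨ0 k) (hΘ0 l) (hΨs k) (hΘs l))
      ring
    unfold coefSum
    rw [← ENNReal.tsum_prod (f := fun k l => (ENNReal.ofReal (α k l) *
      (ENNReal.ofReal (symbolSize r₁ β₁ δ₁ k) * ENNReal.ofReal (symbolSize r₂ β₂ δ₂ l))) ^ p *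
      (((k:ℝ≥0∞) + 1) ^ (p - 2) * ((l:ℝ≥0∞) + 1) ^ (p - 2))), ENNReal.tsum_eq_iSup_sum]
    refine iSup_le fun s => ?_
    refine le_trans (le_of_eq (Finset.sum_congr rfl fun kl _ => ?_))
      (sum_le_Lp2Norm_of_pairing hpq hD (hlBound_shiftedKernel hq e₁ s₁)
        (hlBound_shiftedKernel hq e₂ s₂) (measurable_shiftedKernel e₁ s₁) hΨ hΘ hu hc hpair s)
    have h1 := hn₁ kl.1
    have h2 := hn₂ kl.2
    have h3 := hα.tail_nonneg kl.1 kl.2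
    rw [ENNReal.natCast_add_one_rpow, ENNReal.natCast_add_one_rpow, ← ENNReal.ofReal_mul h1,
      ← ENNReal.ofReal_mul h3, ENNReal.ofReal_rpow_of_nonneg (by positivity) hp0.le,
      ← ENNReal.ofReal_mul (by positivity), ← ENNReal.ofReal_mul (by positivity),
      ← mul_rpow (by positivity) (by positivity)]
  · refine ENNReal.rpow_ne_top_of_nonneg hp0.le (ENNReal.mul_ne_top ?_
      (ENNReal.rpow_ne_top_of_nonneg (by positivity) ?_))
    · simpa using hc
    · finiteness

theorem tsum_ofReal_sub_succ {u : ℕ → ℝ} (hmono : ∀ n, u (n + 1) ≤ u n)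
    (hlim : Filter.Tendsto u Filter.atTop (nhds 0)) (j : ℕ) :
    0 ≤ u j ∧ ∑' l, ENNReal.ofReal (u (j + l) - u (j + l + 1)) = ENNReal.ofReal (u j) := by
  have ha : Antitone u := antitone_nat_of_succ_le hmono
  refine ⟨ha.le_of_tendsto hlim j, ?_⟩
  have h0 : ∀ l, 0 ≤ u (j + l) - u (j + l + 1) := fun l => sub_nonneg.mpr (hmono _)
  have hs : HasSum (fun l => u (j + l) - u (j + l + 1)) (u j) := by
    rw [hasSum_iff_tendsto_nat_of_nonneg h0]
    have h1 : ∀ n, ∑ l ∈ Finset.range n, (u (j + l) - u (j + l + 1)) = u j - u (n + j) :=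
      fun n => by
        have := Finset.sum_range_sub' (fun l => u (j + l)) n
        rw [add_zero] at this
        rw [add_comm n j, ← this]; rfl
    simp_rw [h1]
    simpa using tendsto_const_nhds.sub ((Filter.tendsto_add_atTop_iff_nat j).mpr hlim)
  rw [← ENNReal.ofReal_tsum_of_nonneg h0 hs.summable, hs.tsum_eq]

theorem IsTailSum.of_tendsto {α : ℕ → ℕ → ℝ}
    (hΔ : ∀ i j, 0 ≤ α i j - α (i + 1) j - α i (j + 1) + α (i + 1) (j + 1))
    (h₁ : ∀ j, Filter.Tendsto (fun i => α i j) Filter.atTop (nhds 0))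
    (h₂ : ∀ i, Filter.Tendsto (fun j => α i j) Filter.atTop (nhds 0)) :
    IsTailSum (fun i j => α i j - α (i + 1) j - α i (j + 1) + α (i + 1) (j + 1)) α := by
  have hd : ∀ i j, 0 ≤ α i j - α (i + 1) j ∧
      ∑' l, ENNReal.ofReal (α i (j + l) - α (i + 1) (j + l) -
        (α i (j + l + 1) - α (i + 1) (j + l + 1))) = ENNReal.ofReal (α i j - α (i + 1) j) :=
    fun i => tsum_ofReal_sub_succ (u := fun j => α i j - α (i + 1) j)
      (fun n => by linarith [hΔ i n]) (by simpa using (h₂ i).sub (h₂ (i + 1)))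
  have he : ∀ j i, 0 ≤ α i j ∧
      ∑' k, ENNReal.ofReal (α (i + k) j - α (i + k + 1) j) = ENNReal.ofReal (α i j) :=
    fun j => tsum_ofReal_sub_succ (u := fun i => α i j)
      (fun n => by linarith [(hd n j).1]) (h₁ j)
  refine ⟨hΔ, fun i j => (he j i).1, fun i j => ?_⟩
  rw [← (he j i).2]
  refine tsum_congr fun k => ?_
  rw [← (hd (i + k) j).2]
  refine tsum_congr fun l => congrArg ENNReal.ofReal ?_
  ring

namespace PeriodicIntegrable

variable {f : ℝ → ℝ → ℝ}

/-- Riemann–Lebesgue lemma for the first frequency. -/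
theorem tendsto_squareCoef (hf : PeriodicIntegrable f) (m : ℤ) :
    Filter.Tendsto (fun n : ℕ => squareCoef f n m) Filter.atTop (nhds 0) := by
  set F : ℝ → ℂ := fun x => ∫ y, (f x y : ℂ) * negChar m y ∂periodMeasure with hF
  have h1 := Real.tendsto_integral_exp_smul_cocompact ((Set.Ioc (0:ℝ) (2 * π)).indicator F)
  have h2 : Filter.Tendsto (fun n : ℕ => (n : ℝ) / (2 * π)) Filter.atTop
      (Filter.cocompact ℝ) :=
    (tendsto_natCast_atTop_atTop.atTop_div_const Real.two_pi_pos).mono_right atTop_le_cocompact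
  refine (h1.comp h2).congr fun n => ?_
  rw [squareCoef, integral_prod _ (hf.integrable_mul_negChar n m)]
  simp only [Function.comp]
  rw [← integral_indicator measurableSet_Ioc]
  refine integral_congr_ae (.of_forall fun x => ?_)
  by_cases hx : x ∈ Set.Ioc (0:ℝ) (2 * π)
  · simp only [Set.indicator_of_mem hx, hF]
    rw [Circle.smul_def, Real.fourierChar_apply, smul_eq_mul, ← integral_const_mul]
    refine integral_congr_ae (.of_forall fun y => ?_)
    have h3 : Complex.exp (↑(2 * π * -(x * (n / (2 * π)))) * Complex.I) = negChar n x := by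
      rw [negChar]; congr 1
      have := pi_ne_zero
      have : (2:ℝ) * π * -(x * (n / (2 * π))) = -(n * x) := by field_simp
      rw [this]; push_cast; ring
    simp only [h3]; ring
  · simp only [Set.indicator_of_notMem hx, smul_zero]

theorem integral_mul_eq (hf : PeriodicIntegrable f) {u v : ℝ → ℝ} (hu : Continuous u)
    (hv : Continuous v) (hu1 : ∀ x, |u x| ≤ 1) (hv1 : ∀ x, |v x| ≤ 1) (c : ℂ) :
    HasIntegralValue (fun z => c * ((f z.1 z.2 * u z.1 * v z.2 : ℝ) : ℂ))
      (c * ((∫ x in (0:ℝ)..(2 * π), ∫ y in (0:ℝ)..(2 * π), f x y * u x * v y : ℝ) : ℂ)) := by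
  have hi : Integrable (fun z : ℝ × ℝ => f z.1 z.2 * u z.1 * v z.2)
      (periodMeasure.prod periodMeasure) := by
    refine (hf.integrable.mul_bdd (c := 1) (hu.comp continuous_fst).aestronglyMeasurable
      (.of_forall fun z => hu1 _)).mul_bdd (c := 1)
        (hv.comp continuous_snd).aestronglyMeasurable (.of_forall fun z => hv1 _)
  refine ⟨(hi.ofReal (𝕜 := ℂ)).const_mul c, ?_⟩
  rw [integral_const_mul, integral_complex_ofReal, integral_prod _ hi,
    intervalIntegral.integral_of_le Real.two_pi_pos.le]
  simp_rw [intervalIntegral.integral_of_le Real.two_pi_pos.le]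

end PeriodicIntegrable

theorem negChar_eq_cos_add_sin (n : ℤ) (x : ℝ) :
    negChar n x = cos ((n.natAbs : ℝ) * x) + -Complex.I * n.sign * sin ((n.natAbs : ℝ) * x) := by
  have h1 : negChar n x = Complex.exp (((-(n * x) : ℝ) : ℂ) * Complex.I) := by
    rw [negChar]; congr 1; push_cast; ring
  rw [h1, Complex.exp_mul_I, ← Complex.ofReal_cos, ← Complex.ofReal_sin, cos_neg, sin_neg]
  rcases lt_trichotomy n 0 with h | h | h
  · have : ((n.natAbs : ℕ) : ℝ) = -(n : ℝ) := by
      rw [Nat.cast_natAbs, abs_of_neg h]; push_cast; ring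
    rw [this, neg_mul, cos_neg, sin_neg, Int.sign_eq_neg_one_of_neg h]
    push_cast; ring
  · subst h; simp
  · have : ((n.natAbs : ℕ) : ℝ) = (n : ℝ) := by
      rw [Nat.cast_natAbs, abs_of_pos h]
    rw [this, Int.sign_eq_one_of_pos h]
    push_cast; ring

theorem PeriodicIntegrable.squareCoef_eq_fourier {f : ℝ → ℝ → ℝ} (hf : PeriodicIntegrable f)
    (n m : ℤ) : squareCoef f n m = π ^ 2 * (fourierCC f n.natAbs m.natAbs +
      -Complex.I * n.sign * fourierSC f n.natAbs m.natAbs +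
      (-Complex.I * m.sign * fourierCS f n.natAbs m.natAbs +
      -Complex.I * n.sign * (-Complex.I * m.sign) * fourierSS f n.natAbs m.natAbs)) := by
  have hc : ∀ k : ℕ, Continuous fun x : ℝ => cos ((k : ℝ) * x) := fun k => by fun_prop
  have hs : ∀ k : ℕ, Continuous fun x : ℝ => sin ((k : ℝ) * x) := fun k => by fun_prop
  have key := (((hf.integral_mul_eq (hc n.natAbs) (hc m.natAbs) (fun _ => abs_cos_le_one _)
    (fun _ => abs_cos_le_one _) 1).add (hf.integral_mul_eq (hs n.natAbs) (hc m.natAbs)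
      (fun _ => abs_sin_le_one _) (fun _ => abs_cos_le_one _) (-Complex.I * n.sign))).add
    ((hf.integral_mul_eq (hc n.natAbs) (hs m.natAbs) (fun _ => abs_cos_le_one _)
      (fun _ => abs_sin_le_one _) (-Complex.I * m.sign)).add
      (hf.integral_mul_eq (hs n.natAbs) (hs m.natAbs) (fun _ => abs_sin_le_one _)
        (fun _ => abs_sin_le_one _) (-Complex.I * n.sign * (-Complex.I * m.sign))))).value
  have hπ : (π : ℂ) ≠ 0 := by exact_mod_cast pi_ne_zero
  refine Eq.trans (Eq.trans (integral_congr_ae (.of_forall fun z => ?_)) key) ?_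
  · simp only [negChar_eq_cos_add_sin]
    push_cast
    ring
  rw [fourierCC, fourierSC, fourierCS, fourierSS]
  push_cast
  field_simp

theorem InMclass.squareCoef_eq {p : ℝ} (hp : 1 < p) {f : ℝ → ℝ → ℝ} {a : ℕ → ℕ → ℝ}
    (hf : InMclass p f a) {n m : ℤ} (hn : n ≠ 0) (hm : m ≠ 0) :
    squareCoef f n m = π ^ 2 * a n.natAbs m.natAbs := by
  have h := hf.2.2.1 n.natAbs m.natAbs
  rw [(hf.1.periodicIntegrable hp).squareCoef_eq_fourier,
    hf.2.1 _ _ (Int.natAbs_pos.mpr hn) (Int.natAbs_pos.mpr hm), h.1, h.2.1, h.2.2]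
  simp

theorem InMclass.hasWeylCoef {p : ℝ} (hp : 1 < p) {f : ℝ → ℝ → ℝ} {a : ℕ → ℕ → ℝ}
    (hf : InMclass p f a) : HasWeylCoef f 0 0 fun i j => a (i + 1) (j + 1) := by
  have hP := hf.1.periodicIntegrable hp
  refine ⟨hP, fun n m => ?_⟩
  rcases eq_or_ne n 0 with rfl | hn
  · rw [hP.squareCoef_zero_of_mean_x hf.1.mean_x]; simp [hermExt]
  rcases eq_or_ne m 0 with rfl | hm
  · rw [hP.squareCoef_zero_of_mean_y hf.1.mean_y]; simp [hermExt]
  rw [hermExt_weylMult _ hn, hermExt_weylMult _ hm, hf.squareCoef_eq hp hn hm]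
  have e : ∀ k : ℤ, k ≠ 0 → k.natAbs - 1 + 1 = k.natAbs := fun k hk => by omega
  simp [e n hn, e m hm]

theorem InMclass.isTailSum {p : ℝ} (hp : 1 < p) {f : ℝ → ℝ → ℝ} {a : ℕ → ℕ → ℝ}
    (hf : InMclass p f a) : IsTailSum
      (fun i j => a (i + 1) (j + 1) - a (i + 1 + 1) (j + 1) - a (i + 1) (j + 1 + 1) +
        a (i + 1 + 1) (j + 1 + 1)) fun i j => a (i + 1) (j + 1) := by
  have hP := hf.1.periodicIntegrable hp
  have hπ : (π : ℂ) ≠ 0 := by exact_mod_cast pi_ne_zero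
  have key : ∀ g : ℕ → ℝ, Filter.Tendsto (fun n : ℕ => (π : ℂ) ^ 2 * (g (n + 1) : ℂ)) Filter.atTop
      (nhds 0) → Filter.Tendsto (fun n => g (n + 1)) Filter.atTop (nhds 0) := fun g hg => by
    have h1 := (Complex.continuous_re.tendsto _).comp (hg.const_mul (((π : ℂ) ^ 2)⁻¹))
    rw [mul_zero, Complex.zero_re] at h1
    refine h1.congr fun n => ?_
    simp only [Function.comp]
    rw [inv_mul_cancel_left₀ (pow_ne_zero 2 hπ), Complex.ofReal_re]
  refine IsTailSum.of_tendsto (α := fun i j => a (i + 1) (j + 1))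
    (fun i j => hf.2.2.2 _ _ (by omega) (by omega)) (fun j => ?_) fun i => ?_
  · refine key (fun n => a n (j + 1)) ?_
    refine ((Filter.tendsto_add_atTop_iff_nat 1).mpr
      (hP.tendsto_squareCoef ((j + 1 : ℕ) : ℤ))).congr fun n => ?_
    rw [hf.squareCoef_eq hp (by omega) (by omega)]; simp only [Int.natAbs_natCast]
  · refine key (fun n => a (i + 1) n) ?_
    refine ((Filter.tendsto_add_atTop_iff_nat 1).mpr
      (hP.swap.tendsto_squareCoef ((i + 1 : ℕ) : ℤ))).congr fun n => ?_
    rw [PeriodicIntegrable.squareCoef_swap, hf.squareCoef_eq hp (by omega) (by omega)]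
    simp only [Int.natAbs_natCast]

theorem HasWeylDeriv.hasWeylCoef {p : ℝ} (hp : 1 < p) {f g : ℝ → ℝ → ℝ} {r₁ r₂ : ℝ}
    {α : ℕ → ℕ → ℝ} (hf : HasWeylCoef f 0 0 α) (hg : HasWeylDeriv p r₁ r₂ f g) :
    HasWeylCoef g r₁ r₂ α := by
  have hP := hg.1.periodicIntegrable hp
  refine ⟨hP, fun n m => ?_⟩
  rcases eq_or_ne n 0 with rfl | hn
  · rw [hP.squareCoef_zero_of_mean_x hg.1.mean_x]; simp [hermExt]
  rcases eq_or_ne m 0 with rfl | hm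
  · rw [hP.squareCoef_zero_of_mean_y hg.1.mean_y]; simp [hermExt]
  have h1 := hg.2 n m
  rw [hP.fourierCoefZ_eq, hf.periodicIntegrable.fourierCoefZ_eq, hf.squareCoef_eq] at h1
  rw [hermExt_weylMult _ hn, hermExt_weylMult _ hm] at h1 ⊢
  have hc : ((((2 * π) ^ 2)⁻¹ : ℝ) : ℂ) ≠ 0 := by
    have := pi_pos
    exact_mod_cast (by positivity : (((2 * π) ^ 2)⁻¹ : ℝ) ≠ 0)
  refine mul_left_cancel₀ hc (h1.trans ?_)
  rw [Complex.ofReal_zero, Complex.cpow_zero, Complex.cpow_zero]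
  ring

theorem enorm_trigPoly_weylMult_le {r β δ : ℝ} (hr : 0 ≤ r) (hβ : 0 < β) (hδ : 0 < δ)
    (hδ1 : δ ≤ 1) (k : ℕ) (x : ℝ) :
    ‖trigPoly (weylMult r) k x‖ₑ ≤ ENNReal.ofReal (δ ^ (-β)) *
      (ENNReal.ofReal (2 * symbolSize r β δ k * (k + 1)) *
        shiftedKernel (Pi.single 0 1) 0 k x) := by
  set w : ℂ := Complex.exp (Complex.I * (π * r / 2)) with hw
  have hw1 : ‖w‖ₑ = 1 := by
    have h1 : ‖w‖ = 1 := by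
      have : (Complex.I * (π * r / 2) : ℂ) = ((π * r / 2 : ℝ) : ℂ) * Complex.I := by
        push_cast; ring
      rw [hw, this, Complex.norm_exp_ofReal_mul_I]
    rw [← ofReal_norm, h1, ENNReal.ofReal_one]
  have hsingle : (fun ν => ‖(Pi.single 0 w : ℕ → ℂ) ν‖ₑ) = Pi.single 0 1 := by
    ext ν
    rcases eq_or_ne ν 0 with rfl | hν
    · simp [hw1]
    · simp [hν]
  have h1 := enorm_trigPoly_le (ρ := weylMult r) (v := fun n => ((n:ℝ) + 1) ^ r) (k := k)
    (c := Pi.single 0 w) (s := 0)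
    (summable_of_ne_finset_zero (s := {0}) fun ν hν => by
      rw [Finset.mem_singleton] at hν; simp [hν])
    (by positivity) (fun i _ => by push_cast; gcongr; linarith)
    (fun n _ => by
      rw [weylMult, I_mul_natCast_cpow, tsum_eq_single 0 fun ν hν => by simp [hν]]
      simp [hw]) x
  rw [hsingle] at h1
  refine h1.trans ?_
  rw [← mul_assoc, ← ENNReal.ofReal_mul (by positivity)]
  refine mul_le_mul' (ENNReal.ofReal_le_ofReal ?_) le_rfl
  have h2 : δ ≤ min 1 (((k:ℝ) + 1) * δ) := le_min hδ1 (by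
    have : 0 ≤ (k:ℝ) * δ := by positivity
    linarith)
  have h3 : δ ^ (-β) * δ ^ β = 1 := by rw [← rpow_add hδ]; simp
  have h4 : δ ^ β ≤ (min 1 (((k:ℝ) + 1) * δ)) ^ β := rpow_le_rpow hδ.le h2 hβ.le
  unfold symbolSize
  calc 2 * ((k:ℝ) + 1) ^ r * (k + 1)
      = (δ ^ (-β) * δ ^ β) * (2 * ((k:ℝ) + 1) ^ r * (k + 1)) := by rw [h3, one_mul]
    _ ≤ (δ ^ (-β) * (min 1 (((k:ℝ) + 1) * δ)) ^ β) * (2 * ((k:ℝ) + 1) ^ r * (k + 1)) := by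
        gcongr
    _ = _ := by ring

theorem exists_hasWeylDeriv {p : ℝ} (hp : 1 < p) {r₁ β₁ r₂ β₂ : ℝ} (hr₁ : 0 ≤ r₁)
    (hβ₁ : 0 < β₁) (hr₂ : 0 ≤ r₂) (hβ₂ : 0 < β₂) {f : ℝ → ℝ → ℝ} {Δ α : ℕ → ℕ → ℝ}
    {δ₁ δ₂ : ℝ} (hf : HasWeylCoef f 0 0 α) (hα : IsTailSum Δ α) (hδ₁ : 0 < δ₁) (hδ₁' : δ₁ ≤ 1)
    (hδ₂ : 0 < δ₂) (hδ₂' : δ₂ ≤ 1)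
    (hS : coefSum p r₁ β₁ δ₁ r₂ β₂ δ₂ (fun i j => ENNReal.ofReal (α i j)) ≠ ⊤) :
    ∃ g, HasWeylDeriv p r₁ r₂ f g := by
  have hp0 : 0 < p := by linarith
  have he : ∑' ν, (Pi.single 0 1 : ℕ → ℝ≥0∞) ν ≠ ⊤ := by
    rw [tsum_eq_single 0 fun ν hν => by simp [hν]]; simp
  obtain ⟨C, hC, hle⟩ := lintegral_kernel_superposition_le hp hr₁ hβ₁ hr₂ hβ₂ he he
  have hmaj := hle δ₁ δ₂ 0 0 (fun k l => ENNReal.ofReal (Δ k l)) hδ₁.le hδ₂.le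
  simp_rw [hα.tsum_eq] at hmaj
  set B : ℝ≥0∞ := ENNReal.ofReal (δ₁ ^ (-β₁)) * ENNReal.ofReal (δ₂ ^ (-β₂)) with hB
  have hBt : B ≠ ⊤ := by finiteness
  set ρ := weylMult r₁
  set τ := weylMult r₂
  have hle2 : ∫⁻ x, ∫⁻ y, (∑' k, ∑' l, ENNReal.ofReal (Δ k l) *
      (‖trigPoly ρ k x‖ₑ * ‖trigPoly τ l y‖ₑ)) ^ p ∂periodMeasure ∂periodMeasure ≤
      B ^ p * (C * coefSum p r₁ β₁ δ₁ r₂ β₂ δ₂ fun i j => ENNReal.ofReal (α i j)) := by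
    refine le_trans ?_ (mul_le_mul' le_rfl hmaj)
    have hBp : B ^ p ≠ ⊤ := ENNReal.rpow_ne_top_of_nonneg hp0.le hBt
    rw [← lintegral_const_mul' _ _ hBp]
    refine lintegral_mono fun x => ?_
    rw [← lintegral_const_mul' _ _ hBp]
    refine lintegral_mono fun y => ?_
    rw [← ENNReal.mul_rpow_of_nonneg _ _ hp0.le]
    refine ENNReal.rpow_le_rpow ?_ hp0.le
    rw [← ENNReal.tsum_mul_left]
    refine ENNReal.tsum_le_tsum fun k => ?_
    rw [← ENNReal.tsum_mul_left]
    refine ENNReal.tsum_le_tsum fun l => ?_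
    refine (mul_le_mul' le_rfl (mul_le_mul' (enorm_trigPoly_weylMult_le hr₁ hβ₁ hδ₁ hδ₁' k x)
      (enorm_trigPoly_weylMult_le hr₂ hβ₂ hδ₂ hδ₂' l y))).trans (le_of_eq ?_)
    rw [hB]; ring
  have hfin2 := ne_top_of_le_ne_top (ENNReal.mul_ne_top
    (ENNReal.rpow_ne_top_of_nonneg hp0.le hBt) (ENNReal.mul_ne_top hC hS)) hle2
  obtain ⟨hE, hEc⟩ := hα.trigSuperposition ρ τ (lintegral_lintegral_ne_top_of_rpow hp.le hfin2)
  refine ⟨trigSuperposition Δ ρ τ, ⟨hE.meas, hE.periodic_x, hE.periodic_y, ?_,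
    hE.mean_x_of_squareCoef fun m => ?_, hE.mean_y_of_squareCoef fun n => ?_⟩, fun n m => ?_⟩
  · intro htop
    have h1 := Lp2Norm_rpow hp0 (trigSuperposition Δ ρ τ)
    rw [htop, ENNReal.top_rpow_of_pos hp0] at h1
    refine ne_top_of_le_ne_top hfin2 (h1.le.trans (lintegral_mono fun x => lintegral_mono fun y =>
      ENNReal.rpow_le_rpow (enorm_trigSuperposition_le hα.nonneg ρ τ x y) hp0.le)) rfl
  · rw [hEc]; simp [hermExt]
  · rw [hEc]; simp [hermExt]
  · rw [hE.fourierCoefZ_eq, hf.periodicIntegrable.fourierCoefZ_eq, hEc, hf.squareCoef_eq]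
    rcases eq_or_ne n 0 with rfl | hn
    · simp [hermExt]
    rcases eq_or_ne m 0 with rfl | hm
    · simp [hermExt]
    simp only [ρ, τ]
    rw [hermExt_weylMult _ hn, hermExt_weylMult _ hm, hermExt_weylMult _ hn, hermExt_weylMult _ hm,
      Complex.ofReal_zero, Complex.cpow_zero, Complex.cpow_zero]
    ring

theorem le_mixedMod (p α₁ α₂ : ℝ) {δ₁ δ₂ h₁ h₂ : ℝ} (hh₁ : |h₁| ≤ δ₁) (hh₂ : |h₂| ≤ δ₂)
    (f : ℝ → ℝ → ℝ) : Lp2Norm p (diffX α₁ h₁ (diffY α₂ h₂ f)) ≤ mixedMod p α₁ α₂ δ₁ δ₂ f :=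
  le_iSup₂_of_le h₁ hh₁ (le_iSup₂_of_le h₂ hh₂ le_rfl)

theorem mixedMod_rpow_le {p : ℝ} (hp : 0 < p) {α₁ α₂ δ₁ δ₂ : ℝ} {f : ℝ → ℝ → ℝ} {X : ℝ≥0∞}
    (h : ∀ h₁ h₂, |h₁| ≤ δ₁ → |h₂| ≤ δ₂ → Lp2Norm p (diffX α₁ h₁ (diffY α₂ h₂ f)) ^ p ≤ X) :
    mixedMod p α₁ α₂ δ₁ δ₂ f ^ p ≤ X := by
  rw [← ENNReal.le_rpow_inv_iff hp]
  exact iSup₂_le fun h₁ hh₁ => iSup₂_le fun h₂ hh₂ =>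
    (ENNReal.le_rpow_inv_iff hp).mpr (h h₁ h₂ hh₁ hh₂)

/-- The mixed modulus is equivalent to a weighted `ℓ_p` sum of the coefficients. -/
theorem mixedMod_rpow_equiv_coefSum {p : ℝ} (hp : 1 < p) {r₁ β₁ r₂ β₂ : ℝ} (hr₁ : 0 ≤ r₁)
    (hβ₁ : 0 < β₁) (hr₂ : 0 ≤ r₂) (hβ₂ : 0 < β₂) :
    ∃ K : ℝ≥0∞, K ≠ ⊤ ∧ ∀ (g : ℝ → ℝ → ℝ) (Δ α : ℕ → ℕ → ℝ) (δ₁ δ₂ : ℝ),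
      HasWeylCoef g r₁ r₂ α → IsTailSum Δ α → 0 < δ₁ → δ₁ < 1 / 2 → 0 < δ₂ → δ₂ < 1 / 2 →
      mixedMod p β₁ β₂ δ₁ δ₂ g ^ p ≤
          K * coefSum p r₁ β₁ δ₁ r₂ β₂ δ₂ (fun i j => ENNReal.ofReal (α i j)) ∧
        coefSum p r₁ β₁ δ₁ r₂ β₂ δ₂ (fun i j => ENNReal.ofReal (α i j)) ≤
          K * mixedMod p β₁ β₂ δ₁ δ₂ g ^ p := by
  obtain ⟨C, hC, hup⟩ := Lp2Norm_diff_le hp hr₁ hβ₁ hr₂ hβ₂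
  obtain ⟨D, hD, hlow⟩ := coefSum_le_Lp2Norm_diff hp hr₁ hβ₁ hr₂ hβ₂
  have hp0 : 0 < p := by linarith
  refine ⟨C + D, by finiteness, fun g Δ α δ₁ δ₂ hg hα hδ₁ hδ₁' hδ₂ hδ₂' => ⟨?_, ?_⟩⟩
  · refine (mixedMod_rpow_le hp0 fun h₁ h₂ hh₁ hh₂ => hup g Δ α δ₁ δ₂ h₁ h₂ hg hα hh₁ hh₂).trans ?_
    exact mul_le_mul' le_self_add le_rfl
  · refine (hlow g Δ α δ₁ δ₂ hg hα hδ₁ hδ₁' hδ₂ hδ₂').trans (mul_le_mul' le_add_self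
      (ENNReal.rpow_le_rpow (le_mixedMod p β₁ β₂ ?_ ?_ g) hp0.le))
    · rw [abs_of_pos hδ₁]
    · rw [abs_of_pos hδ₂]

theorem lintegral_Ioo_rpow_sub_one {s τ : ℝ} (hs : 0 < s) (hτ : 0 ≤ τ) :
    ∫⁻ t in Set.Ioo 0 τ, ENNReal.ofReal (t ^ (s - 1)) = ENNReal.ofReal (τ ^ s / s) := by
  have hi : IntegrableOn (fun t : ℝ => t ^ (s - 1)) (Set.Ioc 0 τ) :=
    (intervalIntegrable_iff_integrableOn_Ioc_of_le hτ).mp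
      (intervalIntegral.intervalIntegrable_rpow' (by linarith))
  rw [setLIntegral_congr Ioo_ae_eq_Ioc, ← ofReal_integral_eq_lintegral_ofReal hi,
    ← intervalIntegral.integral_of_le hτ, integral_rpow (Or.inl (by linarith))]
  · rw [sub_add_cancel, zero_rpow hs.ne', sub_zero]
  · filter_upwards [ae_restrict_mem measurableSet_Ioc] with t ht
    exact rpow_nonneg ht.1.le _

theorem lintegral_Ioi_rpow_neg_sub_one {s c : ℝ} (hs : 0 < s) (hc : 0 < c) :
    ∫⁻ t in Set.Ioi c, ENNReal.ofReal (t ^ (-s - 1)) = ENNReal.ofReal (c ^ (-s) / s) := by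
  rw [← ofReal_integral_eq_lintegral_ofReal (integrableOn_Ioi_rpow_of_lt (by linarith) hc),
    integral_Ioi_rpow_of_lt (by linarith) hc]
  · rw [sub_add_cancel, neg_div_neg_eq]
  · filter_upwards [ae_restrict_mem measurableSet_Ioi] with t ht
    exact rpow_nonneg (hc.trans ht).le _

/-- The weight integrated in the majorant, at a single frequency. -/
def modulusWeight (p r β : ℝ) (k : ℕ) (t : ℝ) : ℝ≥0∞ :=
  ENNReal.ofReal (t ^ (-r * p - 1)) * ENNReal.ofReal (symbolSize 0 (r + β) t k) ^ p

theorem measurable_modulusWeight (p r β : ℝ) (k : ℕ) : Measurable (modulusWeight p r β k) := by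
  unfold modulusWeight symbolSize
  fun_prop

theorem modulusWeight_of_le {p r β : ℝ} (hp : 0 < p) {k : ℕ} {t : ℝ} (ht : 0 < t)
    (hk : ((k:ℝ) + 1) * t ≤ 1) : modulusWeight p r β k t =
      ENNReal.ofReal (((k:ℝ) + 1) ^ ((r + β) * p)) * ENNReal.ofReal (t ^ (β * p - 1)) := by
  have hK : (0:ℝ) < (k:ℝ) + 1 := by positivity
  rw [modulusWeight, symbolSize, rpow_zero, one_mul, min_eq_right hk,
    ENNReal.ofReal_rpow_of_nonneg (by positivity) hp.le, ← ENNReal.ofReal_mul (by positivity),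
    ← ENNReal.ofReal_mul (by positivity), ← rpow_mul (by positivity), mul_rpow hK.le ht.le,
    mul_left_comm, ← rpow_add ht]
  ring_nf

theorem modulusWeight_le {p r β : ℝ} (hp : 0 < p) (hrβ : 0 ≤ r + β) {k : ℕ} {t : ℝ} (ht : 0 < t) :
    modulusWeight p r β k t ≤ ENNReal.ofReal (t ^ (-(r * p) - 1)) := by
  rw [modulusWeight, neg_mul]
  refine mul_le_of_le_one_right' (ENNReal.rpow_le_one ?_ hp.le)
  rw [ENNReal.ofReal_le_one, symbolSize, rpow_zero, one_mul]
  exact rpow_le_one (le_min zero_le_one (by positivity)) (min_le_left _ _) hrβ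

theorem lintegral_modulusWeight_min {p r β δ : ℝ} (hp : 0 < p) (hβ : 0 < β) (hδ : 0 < δ) (k : ℕ) :
    ∫⁻ t in Set.Ioo 0 (min δ (((k:ℝ) + 1)⁻¹)), modulusWeight p r β k t =
      ENNReal.ofReal (1 / (β * p)) * ENNReal.ofReal (symbolSize r β δ k) ^ p := by
  have hK : (0:ℝ) < (k:ℝ) + 1 := by positivity
  set τ := min δ (((k:ℝ) + 1)⁻¹) with hτ
  have hτ0 : 0 < τ := lt_min hδ (by positivity)
  rw [setLIntegral_congr_fun measurableSet_Ioo fun t ht => modulusWeight_of_le hp ht.1 ?_]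
  · rw [lintegral_const_mul' _ _ ENNReal.ofReal_ne_top,
      lintegral_Ioo_rpow_sub_one (by positivity) hτ0.le, ← ENNReal.ofReal_mul (by positivity),
      ENNReal.ofReal_rpow_of_nonneg (symbolSize_nonneg r β hδ.le k) hp.le,
      ← ENNReal.ofReal_mul (by positivity)]
    congr 1
    have h1 : min 1 (((k:ℝ) + 1) * δ) = ((k:ℝ) + 1) * τ := by
      rw [hτ, mul_min_of_nonneg _ _ hK.le, mul_inv_cancel₀ hK.ne', min_comm]
    rw [symbolSize, h1, mul_rpow hK.le hτ0.le, mul_rpow (by positivity) (by positivity),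
      mul_rpow (by positivity) (by positivity), ← rpow_mul hK.le, ← rpow_mul hK.le,
      ← rpow_mul hτ0.le, add_mul, rpow_add hK]
    ring
  · have h2 : t ≤ ((k:ℝ) + 1)⁻¹ := ht.2.le.trans (min_le_right _ _)
    calc ((k:ℝ) + 1) * t ≤ ((k:ℝ) + 1) * ((k:ℝ) + 1)⁻¹ := by gcongr
      _ = 1 := mul_inv_cancel₀ hK.ne'

theorem le_lintegral_modulusWeight {p r β δ : ℝ} (hp : 0 < p) (hβ : 0 < β) (hδ : 0 < δ) (k : ℕ) :
    ENNReal.ofReal (1 / (β * p)) * ENNReal.ofReal (symbolSize r β δ k) ^ p ≤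
      ∫⁻ t in Set.Ioo 0 δ, modulusWeight p r β k t := by
  rw [← lintegral_modulusWeight_min hp hβ hδ k]
  exact lintegral_mono_set (Set.Ioo_subset_Ioo_right (min_le_left _ _))

theorem lintegral_modulusWeight_le {p r β δ : ℝ} (hp : 0 < p) (hr : 0 < r) (hβ : 0 < β)
    (hδ : 0 < δ) (k : ℕ) :
    ∫⁻ t in Set.Ioo 0 δ, modulusWeight p r β k t ≤
      (ENNReal.ofReal (1 / (β * p)) + ENNReal.ofReal (1 / (r * p))) *
        ENNReal.ofReal (symbolSize r β δ k) ^ p := by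
  have hK : (0:ℝ) < (k:ℝ) + 1 := by positivity
  rw [add_mul, ← lintegral_modulusWeight_min hp hβ hδ k]
  rcases le_or_gt δ (((k:ℝ) + 1)⁻¹) with h | h
  · rw [min_eq_left h]; exact le_self_add
  · rw [min_eq_right h.le]
    have hsub : Set.Ioo 0 δ ⊆ Set.Ioo 0 ((k:ℝ) + 1)⁻¹ ∪ Set.Ici ((k:ℝ) + 1)⁻¹ := fun t ht => by
      rcases lt_or_ge t ((k:ℝ) + 1)⁻¹ with h1 | h1
      · exact Or.inl ⟨ht.1, h1⟩
      · exact Or.inr h1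
    refine (lintegral_mono_set hsub).trans ((lintegral_union_le _ _ _).trans ?_)
    gcongr
    rw [setLIntegral_congr (Ioi_ae_eq_Ici).symm]
    refine (setLIntegral_mono' measurableSet_Ioi fun t ht => modulusWeight_le hp (by positivity)
      ((by positivity : 0 < ((k:ℝ) + 1)⁻¹).trans ht)).trans ?_
    rw [lintegral_Ioi_rpow_neg_sub_one (by positivity) (by positivity)]
    have h1 : min 1 (((k:ℝ) + 1) * δ) = 1 := by
      refine min_eq_left ?_
      calc (1:ℝ) = ((k:ℝ) + 1) * ((k:ℝ) + 1)⁻¹ := (mul_inv_cancel₀ hK.ne').symm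
        _ ≤ ((k:ℝ) + 1) * δ := by gcongr
    rw [symbolSize, h1, one_rpow, mul_one, ENNReal.ofReal_rpow_of_nonneg (by positivity) hp.le,
      ← ENNReal.ofReal_mul (by positivity), inv_rpow hK.le, rpow_neg hK.le, inv_inv,
      ← rpow_mul hK.le]
    refine le_of_eq (congrArg _ ?_)
    ring

theorem lintegral_lintegral_tsum_tsum_mul {μ ν : Measure ℝ} {W V : ℕ → ℝ → ℝ≥0∞}
    (hW : ∀ k, Measurable (W k)) (hV : ∀ l, Measurable (V l)) (a : ℕ → ℕ → ℝ≥0∞) :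
    ∫⁻ t, ∫⁻ s, ∑' k, ∑' l, a k l * (W k t * V l s) ∂ν ∂μ =
      ∑' k, ∑' l, a k l * ((∫⁻ t, W k t ∂μ) * ∫⁻ s, V l s ∂ν) := by
  have h1 : ∀ t, ∫⁻ s, ∑' k, ∑' l, a k l * (W k t * V l s) ∂ν =
      ∑' k, ∑' l, a k l * (W k t * ∫⁻ s, V l s ∂ν) := fun t => by
    rw [lintegral_tsum fun k => (Measurable.tsum fun l =>
      ((hV l).const_mul _).const_mul _).aemeasurable]
    refine tsum_congr fun k => ?_
    rw [lintegral_tsum fun l => (((hV l).const_mul _).const_mul _).aemeasurable]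
    refine tsum_congr fun l => ?_
    rw [lintegral_const_mul _ ((hV l).const_mul _), lintegral_const_mul _ (hV l)]
  simp_rw [h1]
  rw [lintegral_tsum fun k => (Measurable.tsum fun l =>
    ((hW k).mul_const _).const_mul _).aemeasurable]
  refine tsum_congr fun k => ?_
  rw [lintegral_tsum fun l => (((hW k).mul_const _).const_mul _).aemeasurable]
  refine tsum_congr fun l => ?_
  rw [lintegral_const_mul _ ((hW k).mul_const _), lintegral_mul_const _ (hW k)]

theorem ofReal_mul_coefSum {p r₁ β₁ r₂ β₂ : ℝ} (hp : 0 < p) {s t : ℝ} (ht : 0 < t)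
    (A : ℕ → ℕ → ℝ≥0∞) :
    ENNReal.ofReal (t ^ (-r₁ * p - 1) * s ^ (-r₂ * p - 1)) *
        coefSum p 0 (r₁ + β₁) t 0 (r₂ + β₂) s A =
      ∑' k : ℕ, ∑' l : ℕ, (A k l ^ p * (((k:ℝ≥0∞) + 1) ^ (p - 2) * ((l:ℝ≥0∞) + 1) ^ (p - 2))) *
        (modulusWeight p r₁ β₁ k t * modulusWeight p r₂ β₂ l s) := by
  rw [coefSum, ENNReal.ofReal_mul (rpow_nonneg ht.le _), ← ENNReal.tsum_mul_left]
  refine tsum_congr fun k => ?_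
  rw [← ENNReal.tsum_mul_left]
  refine tsum_congr fun l => ?_
  rw [modulusWeight, modulusWeight, ENNReal.mul_rpow_of_nonneg _ _ hp.le,
    ENNReal.mul_rpow_of_nonneg _ _ hp.le]
  ring

theorem coefSum_eq_tsum {p : ℝ} (hp : 0 ≤ p) (r₁ β₁ δ₁ r₂ β₂ δ₂ : ℝ) (A : ℕ → ℕ → ℝ≥0∞) :
    coefSum p r₁ β₁ δ₁ r₂ β₂ δ₂ A =
      ∑' k : ℕ, ∑' l : ℕ, (A k l ^ p * (((k:ℝ≥0∞) + 1) ^ (p - 2) * ((l:ℝ≥0∞) + 1) ^ (p - 2))) *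
        (ENNReal.ofReal (symbolSize r₁ β₁ δ₁ k) ^ p *
          ENNReal.ofReal (symbolSize r₂ β₂ δ₂ l) ^ p) := by
  refine tsum_congr fun k => tsum_congr fun l => ?_
  rw [ENNReal.mul_rpow_of_nonneg _ _ hp, ENNReal.mul_rpow_of_nonneg _ _ hp]
  ring

/-- Integrating the weighted coefficient sums over the steps reproduces a coefficient sum. -/
theorem lintegral_coefSum_equiv {p : ℝ} (hp : 0 < p) {r₁ β₁ r₂ β₂ : ℝ} (hr₁ : 0 < r₁)
    (hβ₁ : 0 < β₁) (hr₂ : 0 < r₂) (hβ₂ : 0 < β₂) :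
    ∃ K : ℝ≥0∞, K ≠ ⊤ ∧ ∀ (A : ℕ → ℕ → ℝ≥0∞) (δ₁ δ₂ : ℝ), 0 < δ₁ → 0 < δ₂ →
      (∫⁻ t in Set.Ioo 0 δ₁, ∫⁻ s in Set.Ioo 0 δ₂,
          ENNReal.ofReal (t ^ (-r₁ * p - 1) * s ^ (-r₂ * p - 1)) *
            coefSum p 0 (r₁ + β₁) t 0 (r₂ + β₂) s A) ≤ K * coefSum p r₁ β₁ δ₁ r₂ β₂ δ₂ A ∧
        coefSum p r₁ β₁ δ₁ r₂ β₂ δ₂ A ≤ K * ∫⁻ t in Set.Ioo 0 δ₁, ∫⁻ s in Set.Ioo 0 δ₂,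
          ENNReal.ofReal (t ^ (-r₁ * p - 1) * s ^ (-r₂ * p - 1)) *
            coefSum p 0 (r₁ + β₁) t 0 (r₂ + β₂) s A := by
  set c₁ := ENNReal.ofReal (1 / (β₁ * p)) with hc₁
  set c₂ := ENNReal.ofReal (1 / (β₂ * p)) with hc₂
  set d₁ := c₁ + ENNReal.ofReal (1 / (r₁ * p)) with hd₁
  set d₂ := c₂ + ENNReal.ofReal (1 / (r₂ * p)) with hd₂
  have hc₁0 : c₁ ≠ 0 := (ENNReal.ofReal_pos.mpr (by positivity)).ne'
  have hc₂0 : c₂ ≠ 0 := (ENNReal.ofReal_pos.mpr (by positivity)).ne'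
  have hc0 : c₁ * c₂ ≠ 0 := mul_ne_zero hc₁0 hc₂0
  have hct : c₁ * c₂ ≠ ⊤ := by finiteness
  refine ⟨d₁ * d₂ + (c₁ * c₂)⁻¹, by finiteness, fun A δ₁ δ₂ hδ₁ hδ₂ => ?_⟩
  have key : (∫⁻ t in Set.Ioo 0 δ₁, ∫⁻ s in Set.Ioo 0 δ₂,
      ENNReal.ofReal (t ^ (-r₁ * p - 1) * s ^ (-r₂ * p - 1)) *
        coefSum p 0 (r₁ + β₁) t 0 (r₂ + β₂) s A) =
      ∑' k : ℕ, ∑' l : ℕ, (A k l ^ p * (((k:ℝ≥0∞) + 1) ^ (p - 2) * ((l:ℝ≥0∞) + 1) ^ (p - 2))) *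
        ((∫⁻ t in Set.Ioo 0 δ₁, modulusWeight p r₁ β₁ k t) *
          ∫⁻ s in Set.Ioo 0 δ₂, modulusWeight p r₂ β₂ l s) := by
    rw [← lintegral_lintegral_tsum_tsum_mul (measurable_modulusWeight p r₁ β₁)
      (measurable_modulusWeight p r₂ β₂)]
    refine setLIntegral_congr_fun measurableSet_Ioo fun t ht => ?_
    exact lintegral_congr fun s => ofReal_mul_coefSum hp ht.1 A
  rw [key, coefSum_eq_tsum hp.le]
  constructor
  · rw [← ENNReal.tsum_mul_left]
    refine ENNReal.tsum_le_tsum fun k => ?_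
    rw [← ENNReal.tsum_mul_left]
    refine ENNReal.tsum_le_tsum fun l => ?_
    refine (mul_le_mul' le_rfl (mul_le_mul' (lintegral_modulusWeight_le hp hr₁ hβ₁ hδ₁ k)
      (lintegral_modulusWeight_le hp hr₂ hβ₂ hδ₂ l))).trans ?_
    rw [← hc₁, ← hc₂, ← hd₁, ← hd₂, mul_mul_mul_comm d₁, mul_left_comm]
    exact mul_le_mul' le_self_add le_rfl
  · refine le_trans ?_ (mul_le_mul' le_add_self le_rfl)
    rw [← ENNReal.mul_le_iff_le_inv hc0 hct, ← ENNReal.tsum_mul_left]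
    refine ENNReal.tsum_le_tsum fun k => ?_
    rw [← ENNReal.tsum_mul_left]
    refine ENNReal.tsum_le_tsum fun l => ?_
    rw [mul_left_comm, mul_mul_mul_comm c₁]
    exact mul_le_mul' le_rfl (mul_le_mul' (le_lintegral_modulusWeight hp hβ₁ hδ₁ k)
      (le_lintegral_modulusWeight hp hβ₂ hδ₂ l))

theorem derivMajorant_rpow {p : ℝ} (hp : p ≠ 0) (β₁ β₂ r₁ r₂ a b : ℝ) (f : ℝ → ℝ → ℝ) :
    derivMajorant p β₁ β₂ r₁ r₂ p a b f ^ p =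
      ∫⁻ t₁ in Set.Ioo (0:ℝ) a, ∫⁻ t₂ in Set.Ioo (0:ℝ) b,
        ENNReal.ofReal (t₁ ^ (-r₁*p-1) * t₂ ^ (-r₂*p-1)) *
          mixedMod p (r₁+β₁) (r₂+β₂) t₁ t₂ f ^ p := by
  rw [derivMajorant, ← ENNReal.rpow_mul, one_div_mul_cancel hp, ENNReal.rpow_one]

theorem derivMajorant_rpow_equiv_coefSum {p : ℝ} (hp : 1 < p) {r₁ β₁ r₂ β₂ : ℝ} (hr₁ : 0 < r₁)
    (hβ₁ : 0 < β₁) (hr₂ : 0 < r₂) (hβ₂ : 0 < β₂) :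
    ∃ K : ℝ≥0∞, K ≠ ⊤ ∧ ∀ (f : ℝ → ℝ → ℝ) (Δ α : ℕ → ℕ → ℝ) (δ₁ δ₂ : ℝ),
      HasWeylCoef f 0 0 α → IsTailSum Δ α → 0 < δ₁ → δ₁ < 1 / 2 → 0 < δ₂ → δ₂ < 1 / 2 →
      derivMajorant p β₁ β₂ r₁ r₂ p δ₁ δ₂ f ^ p ≤
          K * coefSum p r₁ β₁ δ₁ r₂ β₂ δ₂ (fun i j => ENNReal.ofReal (α i j)) ∧
        coefSum p r₁ β₁ δ₁ r₂ β₂ δ₂ (fun i j => ENNReal.ofReal (α i j)) ≤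
          K * derivMajorant p β₁ β₂ r₁ r₂ p δ₁ δ₂ f ^ p := by
  have hp0 : 0 < p := by linarith
  obtain ⟨C, hC, hmod⟩ := mixedMod_rpow_equiv_coefSum hp le_rfl (add_pos hr₁ hβ₁) le_rfl
    (add_pos hr₂ hβ₂)
  obtain ⟨D, hD, h_int⟩ := lintegral_coefSum_equiv hp0 hr₁ hβ₁ hr₂ hβ₂
  refine ⟨C * D, by finiteness, fun f Δ α δ₁ δ₂ hf hα hδ₁ hδ₁' hδ₂ hδ₂' => ?_⟩
  obtain ⟨h1, h2⟩ := h_int (fun i j => ENNReal.ofReal (α i j)) δ₁ δ₂ hδ₁ hδ₂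
  rw [derivMajorant_rpow hp0.ne']
  constructor
  · rw [mul_assoc]
    refine le_trans ?_ (mul_le_mul' le_rfl h1)
    rw [← lintegral_const_mul' _ _ hC]
    refine setLIntegral_mono' measurableSet_Ioo fun t ht => ?_
    rw [← lintegral_const_mul' _ _ hC]
    refine setLIntegral_mono' measurableSet_Ioo fun s hs => ?_
    rw [mul_left_comm]
    exact mul_le_mul' le_rfl (hmod f Δ α t s hf hα ht.1 (ht.2.trans hδ₁') hs.1
      (hs.2.trans hδ₂')).1
  · rw [mul_comm C, mul_assoc]
    refine h2.trans (mul_le_mul' le_rfl ?_)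
    rw [← lintegral_const_mul' _ _ hC]
    refine setLIntegral_mono' measurableSet_Ioo fun t ht => ?_
    rw [← lintegral_const_mul' _ _ hC]
    refine setLIntegral_mono' measurableSet_Ioo fun s hs => ?_
    rw [mul_left_comm]
    exact mul_le_mul' le_rfl (hmod f Δ α t s hf hα ht.1 (ht.2.trans hδ₁') hs.1
      (hs.2.trans hδ₂')).2

theorem le_ofReal_mul_of_rpow_le {p : ℝ} (hp : 0 < p) {K x y : ℝ≥0∞} (hK : K ≠ ⊤)
    (h : x ^ p ≤ K * y ^ p) : x ≤ ENNReal.ofReal ((K ^ p⁻¹).toReal + 1) * y := by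
  have h1 : x ≤ K ^ p⁻¹ * y := by
    have h2 := (ENNReal.le_rpow_inv_iff hp).mpr h
    rwa [ENNReal.mul_rpow_of_nonneg _ _ (inv_nonneg.mpr hp.le), ENNReal.rpow_rpow_inv hp.ne'] at h2
  refine h1.trans (mul_le_mul' ?_ le_rfl)
  have h3 : K ^ p⁻¹ ≠ ⊤ := ENNReal.rpow_ne_top_of_nonneg (inv_nonneg.mpr hp.le) hK
  rw [← ENNReal.ofReal_toReal h3]
  exact ENNReal.ofReal_le_ofReal (by rw [ENNReal.ofReal_toReal h3]; linarith)

/-- For `f ∈ M_p`, the mixed modulus of smoothness of the mixed Weyl derivative is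
equivalent to the integral of the higher-order modulus of `f` (Theorem 8.2). -/
theorem modulus_of_derivative_Mclass (p β₁ β₂ r₁ r₂ : ℝ) (hp : 1 < p)
    (hβ₁ : 0 < β₁) (hβ₂ : 0 < β₂) (hr₁ : 0 < r₁) (hr₂ : 0 < r₂) :
    ∃ C : ℝ, 0 < C ∧ ∀ (f : ℝ → ℝ → ℝ) (a : ℕ → ℕ → ℝ) (δ₁ δ₂ : ℝ),
      InMclass p f a → δ₁ ∈ Set.Ioo (0:ℝ) (1/2) → δ₂ ∈ Set.Ioo (0:ℝ) (1/2) →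
      (derivMajorant p β₁ β₂ r₁ r₂ p δ₁ δ₂ f ≠ ⊤ →
        ∃ g : ℝ → ℝ → ℝ, HasWeylDeriv p r₁ r₂ f g) ∧
      (∀ g : ℝ → ℝ → ℝ, HasWeylDeriv p r₁ r₂ f g →
        mixedMod p β₁ β₂ δ₁ δ₂ g ≤
            ENNReal.ofReal C * derivMajorant p β₁ β₂ r₁ r₂ p δ₁ δ₂ f ∧
        derivMajorant p β₁ β₂ r₁ r₂ p δ₁ δ₂ f ≤
            ENNReal.ofReal C * mixedMod p β₁ β₂ δ₁ δ₂ g) := by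
  have hp0 : 0 < p := by linarith
  obtain ⟨C, hC, hmod⟩ := mixedMod_rpow_equiv_coefSum hp hr₁.le hβ₁ hr₂.le hβ₂
  obtain ⟨D, hD, hmaj⟩ := derivMajorant_rpow_equiv_coefSum hp hr₁ hβ₁ hr₂ hβ₂
  have hCD : C * D ≠ ⊤ := by finiteness
  refine ⟨((C * D) ^ p⁻¹).toReal + 1, by positivity, fun f a δ₁ δ₂ hf hδ₁ hδ₂ => ?_⟩
  have hcoef := hf.hasWeylCoef hp
  have htail := hf.isTailSum hp
  obtain ⟨h1, h2⟩ := hmaj f _ _ δ₁ δ₂ hcoef htail hδ₁.1 hδ₁.2 hδ₂.1 hδ₂.2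
  refine ⟨fun hfin => ?_, fun g hg => ?_⟩
  · refine exists_hasWeylDeriv hp hr₁.le hβ₁ hr₂.le hβ₂ hcoef htail hδ₁.1
      (by linarith [hδ₁.2]) hδ₂.1 (by linarith [hδ₂.2]) (ne_top_of_le_ne_top ?_ h2)
    exact ENNReal.mul_ne_top hD (ENNReal.rpow_ne_top_of_nonneg hp0.le hfin)
  · obtain ⟨h3, h4⟩ := hmod g _ _ δ₁ δ₂ (hg.hasWeylCoef hp hcoef) htail hδ₁.1 hδ₁.2 hδ₂.1 hδ₂.2
    refine ⟨le_ofReal_mul_of_rpow_le hp0 hCD ?_, le_ofReal_mul_of_rpow_le hp0 hCD ?_⟩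
    · rw [mul_assoc]
      exact h3.trans (mul_le_mul' le_rfl h2)
    · rw [mul_comm C, mul_assoc]
      exact h1.trans (mul_le_mul' le_rfl h4)

end
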